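/- (Openness) Let Γ^t, t ∈ [0,∞), be a smooth family of graphical tori, and suppose that for some t₀ the function g^{t₀} : Δ̄ × S¹ → ℂ defines a holomorphic transverse foliation of Γ^{t₀}. Then there exist δ > 0 and a continuous function g̃ : Δ̄ × S¹ × (t₀ − δ, t₀ + δ) → ℂ with g̃(·,·,t₀) = g^{t₀} such that for every t with |t − t₀| < δ, the map g̃(·,·,t) defines a holomorphic transverse foliation of Γ^t. -/

import Mathlib

open Set Metric Complex

noncomputable section

/-- The closed curve `c` (periodic of period `2π`) has winding number `1` around `0`:
there is a continuous lift of the argument increasing by `2π` over one period. -/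
def WindingOne (c : ℝ → ℂ) : Prop :=
  ∃ θ : ℝ → ℝ, Continuous θ ∧
    (∀ t, c t = (‖c t‖ : ℂ) * Complex.exp ((θ t : ℂ) * Complex.I)) ∧
    θ (2 * Real.pi) = θ 0 + 2 * Real.pi

/-- `c : ℝ → ℂ` is a smooth simple closed curve (parametrized with period `2π`). -/
def IsSCC (c : ℝ → ℂ) : Prop :=
  ContDiff ℝ (⊤ : ℕ∞) c ∧ (∀ t, c (t + 2 * Real.pi) = c t) ∧
    Set.InjOn c (Ico 0 (2 * Real.pi)) ∧ ∀ t, deriv c t ≠ 0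

/-- `Γ ⊆ S¹ × ℂ` is a graphical torus: every vertical slice `C_λ` is a smooth simple
closed curve in `ℂ ∖ {0}` with winding number `1` around `0`. -/
def IsGraphicalTorus (Γ : Set (ℂ × ℂ)) : Prop :=
  (∀ p ∈ Γ, p.1 ∈ sphere (0 : ℂ) 1) ∧
  ∀ l ∈ sphere (0 : ℂ) 1, ∃ c : ℝ → ℂ,
    IsSCC c ∧ (∀ t, c t ≠ 0) ∧ WindingOne c ∧ Set.range c = {w : ℂ | (l, w) ∈ Γ}

/-- `g` is continuous on the closed unit disk and holomorphic on the open unit disk,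
hence defines a holomorphic disk `{(λ, g λ) : λ ∈ Δ}`. -/
def HolDisk (g : ℂ → ℂ) : Prop :=
  ContinuousOn g (closedBall (0 : ℂ) 1) ∧ DifferentiableOn ℂ g (ball (0 : ℂ) 1)

/-- The trace `{(λ, g λ) : λ ∈ S¹}` of the disk defined by `g` lies in `Γ`. -/
def DiskTraceIn (g : ℂ → ℂ) (Γ : Set (ℂ × ℂ)) : Prop :=
  ∀ l ∈ sphere (0 : ℂ) 1, (l, g l) ∈ Γ

/-- `f` is Hölder continuous with exponent `α` on `s`. -/
def HolderOn (f : ℂ → ℂ) (s : Set ℂ) (α : ℝ) : Prop :=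
  ∃ A : ℝ, ∀ x ∈ s, ∀ y ∈ s, ‖f x - f y‖ ≤ A * ‖x - y‖ ^ α

/-- `g ∈ C^{1,α}(Δ̄)`: the derivative of `g` extends to the closed unit disk as an
`α`-Hölder continuous function. -/
def C1AlphaOnDisk (g : ℂ → ℂ) (α : ℝ) : Prop :=
  ∃ g' : ℂ → ℂ, (∀ z ∈ ball (0 : ℂ) 1, HasDerivAt g (g' z) z) ∧
    ContinuousOn g' (closedBall (0 : ℂ) 1) ∧ HolderOn g' (closedBall (0 : ℂ) 1) α

/-- `g : Δ̄ × S¹ → ℂ` defines a holomorphic transverse foliation of the graphical torus `Γ`: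
`g` is continuous, each `g_ξ = g(·,ξ)` is holomorphic on `Δ`, of class `C^{1,α}(Δ̄)`, with
trace in `Γ`, nonvanishing on `Δ`, the leaves are pairwise disjoint over `Δ`, and the traces
`γ_ξ` are simple, pairwise disjoint and foliate `Γ` (each point of `Γ` lies on exactly one). -/
def IsHolTransFoliation (Γ : Set (ℂ × ℂ)) (g : ℂ → ℂ → ℂ) : Prop :=
  ContinuousOn (fun q : ℂ × ℂ => g q.1 q.2) (closedBall (0 : ℂ) 1 ×ˢ sphere (0 : ℂ) 1) ∧
  (∃ α : ℝ, 0 < α ∧ α < 1 ∧ ∀ ξ ∈ sphere (0 : ℂ) 1, C1AlphaOnDisk (fun l => g l ξ) α) ∧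
  (∀ ξ ∈ sphere (0 : ℂ) 1, HolDisk (fun l => g l ξ)) ∧
  (∀ ξ ∈ sphere (0 : ℂ) 1, DiskTraceIn (fun l => g l ξ) Γ) ∧
  (∀ ξ ∈ sphere (0 : ℂ) 1, ∀ l ∈ ball (0 : ℂ) 1, g l ξ ≠ 0) ∧
  (∀ ξ ∈ sphere (0 : ℂ) 1, ∀ η ∈ sphere (0 : ℂ) 1, ξ ≠ η →
    ∀ l ∈ ball (0 : ℂ) 1, g l ξ ≠ g l η) ∧
  (∀ p ∈ Γ, ∃! ξ : ℂ, ξ ∈ sphere (0 : ℂ) 1 ∧ g p.1 ξ = p.2)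

/-- The Wirtinger derivative `∂f/∂w = ½(∂f/∂x − i ∂f/∂y)` of `f : ℂ → ℝ`, as a complex number. -/
def wirt (f : ℂ → ℝ) (w : ℂ) : ℂ :=
  (((fderiv ℝ f w 1 : ℝ) : ℂ) - Complex.I * ((fderiv ℝ f w Complex.I : ℝ) : ℂ)) / 2

/-- The torus `Γ^t = {(λ, w) : λ ∈ S¹, F(λ,w) = t}` cut out by the defining function `F`. -/
def TorusOf (F : ℂ → ℂ → ℝ) (t : ℝ) : Set (ℂ × ℂ) :=
  {p : ℂ × ℂ | p.1 ∈ sphere (0 : ℂ) 1 ∧ F p.1 p.2 = t}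

/-- `F : S¹ × ℂ → ℝ` is a smooth defining function of a smooth family of graphical tori
`Γ^t = F⁻¹(t)`, `t > 0`: each slice level set is a smooth simple closed curve of winding
number `1` around `0`, the level sets foliate `ℂ ∖ {0}` for each fixed `λ ∈ S¹`,
`F(λ,w) = |w|²` near `w = 0`, and `∂F/∂w ≠ 0` for `w ≠ 0`. -/
def IsSmoothTorusFamily (F : ℂ → ℂ → ℝ) : Prop :=
  ContDiffOn ℝ (⊤ : ℕ∞) (fun p : ℂ × ℂ => F p.1 p.2) (sphere (0 : ℂ) 1 ×ˢ univ) ∧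
  (∀ l ∈ sphere (0 : ℂ) 1, ContDiff ℝ (⊤ : ℕ∞) (F l)) ∧
  (∃ ε : ℝ, 0 < ε ∧ ∀ l ∈ sphere (0 : ℂ) 1, ∀ w : ℂ,
      Complex.normSq w < ε → F l w = Complex.normSq w) ∧
  (∀ l ∈ sphere (0 : ℂ) 1, ∀ w : ℂ, w ≠ 0 → 0 < F l w) ∧
  (∀ l ∈ sphere (0 : ℂ) 1, ∀ w : ℂ, w ≠ 0 → wirt (F l) w ≠ 0) ∧
  (∀ l ∈ sphere (0 : ℂ) 1, ∀ t : ℝ, 0 < t → ∃ c : ℝ → ℂ,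
      IsSCC c ∧ (∀ s, c s ≠ 0) ∧ WindingOne c ∧ Set.range c = {w : ℂ | F l w = t})

namespace TorusFoliation

open MeasureTheory AddCircle Filter Topology

/-- The parametrization of the unit circle in `ℂ` by `ℝ / ℤ`. -/
def circ (x : UnitAddCircle) : ℂ := AddCircle.toCircle x

lemma continuous_circ : Continuous circ := by
  unfold circ; exact continuous_subtype_val.comp AddCircle.continuous_toCircle

lemma norm_circ (x : UnitAddCircle) : ‖circ x‖ = 1 := Circle.norm_coe _

lemma circ_mem (x : UnitAddCircle) : circ x ∈ sphere (0 : ℂ) 1 := by simp [norm_circ]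

lemma circ_mem_closedBall (x : UnitAddCircle) : circ x ∈ closedBall (0 : ℂ) 1 :=
  sphere_subset_closedBall (circ_mem x)

lemma circ_add (x y : UnitAddCircle) : circ (x + y) = circ x * circ y := by
  simp [circ, AddCircle.toCircle_add]

lemma circ_zero : circ 0 = 1 := by simp [circ]

lemma circ_coe (x : ℝ) : circ (x : UnitAddCircle) = Complex.exp (2 * Real.pi * x * I) := by
  simp [circ, AddCircle.toCircle_apply_mk, Circle.coe_exp]

lemma exists_circ_eq {z : ℂ} (hz : z ∈ sphere (0 : ℂ) 1) : ∃ x, circ x = z := by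
  have hz' : ‖z‖ = 1 := by simpa using hz
  refine ⟨((Complex.arg z / (2 * Real.pi) : ℝ) : UnitAddCircle), ?_⟩
  rw [circ_coe]
  have : (2 * Real.pi * ((Complex.arg z / (2 * Real.pi) : ℝ) : ℂ) * I) = Complex.arg z * I := by
    push_cast
    field_simp
  rw [this]
  have := Complex.norm_mul_exp_arg_mul_I z
  rw [hz'] at this
  simpa using this

lemma fourier_eq_circ_zpow (n : ℤ) (x : UnitAddCircle) : fourier n x = circ x ^ n := by
  simp [circ, fourier_apply, AddCircle.toCircle_zsmul]

lemma norm_fourier_apply (n : ℤ) (x : UnitAddCircle) : ‖fourier n x‖ = 1 := Circle.norm_coe _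

lemma fourier_apply_add (n : ℤ) (x y : UnitAddCircle) :
    fourier n (x + y) = fourier n x * fourier n y := by
  simp [fourier_apply, smul_add, AddCircle.toCircle_add]

/-- `f` is Lipschitz under translations in quadratic mean; equivalently `f` lies in the Sobolev
space `H¹` of the circle, with squared seminorm at most `M`. -/
def EnergyLE {E : Type*} [NormedAddCommGroup E] (f : UnitAddCircle → E) (M : ℝ) : Prop :=
  ∀ s : ℝ, ∫ x, ‖f (x + (s : UnitAddCircle)) - f x‖ ^ 2 ∂haarAddCircle ≤ M * s ^ 2

/-- The squared quadratic mean of `f`. -/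
def meanSq {E : Type*} [NormedAddCommGroup E] (f : UnitAddCircle → E) : ℝ :=
  ∫ x, ‖f x‖ ^ 2 ∂haarAddCircle

lemma integrable_of_continuous {E : Type*} [NormedAddCommGroup E] {f : UnitAddCircle → E}
    (hf : Continuous f) : Integrable f (haarAddCircle (T := 1)) :=
  hf.integrable_of_hasCompactSupport (HasCompactSupport.of_compactSpace f)

lemma continuous_translate {E : Type*} [TopologicalSpace E] {f : UnitAddCircle → E}
    (hf : Continuous f) (s : UnitAddCircle) : Continuous fun x => f (x + s) := by fun_prop

section
variable {E : Type*} [NormedAddCommGroup E]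

lemma integral_mono_of_continuous {f g : UnitAddCircle → ℝ} (hf : Continuous f)
    (hg : Continuous g) (h : ∀ x, f x ≤ g x) :
    ∫ x, f x ∂haarAddCircle ≤ ∫ x, g x ∂haarAddCircle :=
  integral_mono (integrable_of_continuous hf) (integrable_of_continuous hg) h

lemma integral_haar_const (c : ℝ) : ∫ _ : UnitAddCircle, c ∂haarAddCircle = c := by simp

lemma meanSq_le_of_norm_le {f : UnitAddCircle → E} (hf : Continuous f) {B : ℝ}
    (h : ∀ x, ‖f x‖ ≤ B) : meanSq f ≤ B ^ 2 := by
  have := integral_mono_of_continuous (f := fun x => ‖f x‖ ^ 2) (g := fun _ => B ^ 2)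
    (by fun_prop) (by fun_prop) (fun x => by gcongr; exact h x)
  rwa [integral_haar_const] at this

end

lemma hasSum_sq_fourierCoeff_of_continuous {f : UnitAddCircle → ℂ} (hf : Continuous f) :
    HasSum (fun n => ‖fourierCoeff f n‖ ^ 2) (meanSq f) := by
  have h := hasSum_sq_fourierCoeff (ContinuousMap.toLp (E := ℂ) 2 haarAddCircle ℂ ⟨f, hf⟩)
  simp only [fourierCoeff_toLp] at h
  refine (congrArg (HasSum _) ?_).mp h
  refine integral_congr_ae ?_
  filter_upwards [ContinuousMap.coeFn_toLp (𝕜 := ℂ) (p := 2) haarAddCircle ⟨f, hf⟩] with x hx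
  rw [hx]; rfl

lemma fourierCoeff_translate (f : UnitAddCircle → ℂ) (s : UnitAddCircle) (n : ℤ) :
    fourierCoeff (fun x => f (x + s)) n = fourier n s * fourierCoeff f n := by
  unfold fourierCoeff
  rw [← integral_add_right_eq_self (μ := haarAddCircle) (fun t : UnitAddCircle => (fourier (-n) t • f t : ℂ)) s,
    ← integral_const_mul]
  congr 1; ext x
  have h1 : fourier n s * fourier (-n) s = 1 := by
    rw [fourier_eq_circ_zpow, fourier_eq_circ_zpow, ← zpow_add₀]
    · simp
    · intro h; have := norm_circ s; simp [h] at this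
  simp only [fourier_apply_add, smul_eq_mul]
  linear_combination (-(fourier (-n) x * f (x + s))) * h1

lemma fourierCoeff_translate_sub {f : UnitAddCircle → ℂ} (hf : Continuous f) (s : UnitAddCircle)
    (n : ℤ) : fourierCoeff (fun x => f (x + s) - f x) n = (fourier n s - 1) * fourierCoeff f n := by
  have h := fourierCoeff.add (integrable_of_continuous (continuous_translate hf s))
    ((integrable_of_continuous hf).smul (-1 : ℂ))
  have h2 := congrFun h n
  simp only [Pi.add_apply, fourierCoeff_translate, fourierCoeff.const_smul] at h2
  rw [sub_mul, one_mul, sub_eq_add_neg]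
  convert h2 using 1
  · congr 1; ext x; simp [sub_eq_add_neg]
  · simp

lemma abs_le_norm_fourier_sub_one {n : ℤ} {s : ℝ} (h : |n * s| ≤ 1 / 2) :
    |n * s| ≤ ‖fourier n (s : UnitAddCircle) - 1‖ := by
  rw [fourier_coe_apply]
  have h1 : (2 * Real.pi * I * n * s / (1 : ℝ) : ℂ) = I * ((2 * Real.pi * (n * s) : ℝ) : ℂ) := by
    push_cast; ring
  rw [h1, Complex.norm_exp_I_mul_ofReal_sub_one]
  have h2 : (2 * Real.pi * (n * s)) / 2 = Real.pi * (n * s) := by ring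
  rw [h2, Real.norm_eq_abs, abs_mul 2, abs_two]
  have h3 := Real.mul_abs_le_abs_sin (x := Real.pi * (n * s)) (by
    rw [abs_mul, abs_of_pos Real.pi_pos]; nlinarith [Real.pi_pos])
  rw [abs_mul, abs_of_pos Real.pi_pos] at h3
  have h4 : 2 / Real.pi * (Real.pi * |(n * s : ℝ)|) = 2 * |(n * s : ℝ)| := by
    field_simp
  rw [h4] at h3
  nlinarith [abs_nonneg (n * s : ℝ)]

lemma exists_pos_small (S : Finset ℤ) {s₀ : ℝ} (hs₀ : 0 < s₀) :
    ∃ s : ℝ, 0 < s ∧ s ≤ s₀ ∧ ∀ n ∈ S, |n * s| ≤ 1 / 2 := by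
  set B : ℝ := 1 + ∑ n ∈ S, |(n : ℝ)|
  have hB : 0 < B := by positivity
  refine ⟨min s₀ (1 / (2 * B)), by positivity, min_le_left _ _, fun n hn => ?_⟩
  have h1 : |(n : ℝ)| ≤ B := by
    have := Finset.single_le_sum (f := fun n : ℤ => |(n : ℝ)|) (fun _ _ => abs_nonneg _) hn
    linarith
  rw [abs_mul, abs_of_pos (by positivity : (0 : ℝ) < min s₀ (1 / (2 * B)))]
  calc |(n : ℝ)| * min s₀ (1 / (2 * B)) ≤ B * (1 / (2 * B)) := by
        gcongr; exact min_le_right _ _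
    _ = 1 / 2 := by field_simp

lemma EnergyLE.sum_le {f : UnitAddCircle → ℂ} (hf : Continuous f) {M : ℝ} (h : EnergyLE f M)
    (S : Finset ℤ) : ∑ n ∈ S, (n : ℝ) ^ 2 * ‖fourierCoeff f n‖ ^ 2 ≤ M := by
  obtain ⟨s, hs, -, hS⟩ := exists_pos_small S one_pos
  have h1 := sum_le_hasSum S (fun n _ => by positivity)
    (hasSum_sq_fourierCoeff_of_continuous
      (f := fun x => f (x + (s : UnitAddCircle)) - f x) (by fun_prop))
  have h2 := h1.trans (h s)
  have h3 : ∑ n ∈ S, (n * s) ^ 2 * ‖fourierCoeff f n‖ ^ 2 ≤ M * s ^ 2 := by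
    refine le_trans (Finset.sum_le_sum fun n hn => ?_) h2
    rw [fourierCoeff_translate_sub hf, norm_mul, mul_pow ‖_‖]
    have := abs_le_norm_fourier_sub_one (hS n hn)
    rw [← sq_abs (n * s : ℝ)]
    gcongr
  have h4 : (∑ n ∈ S, (n : ℝ) ^ 2 * ‖fourierCoeff f n‖ ^ 2) * s ^ 2 ≤ M * s ^ 2 := by
    rw [Finset.sum_mul]
    convert h3 using 2
    ring
  exact le_of_mul_le_mul_right h4 (by positivity)

section
variable {E E' : Type*} [NormedAddCommGroup E] [NormedAddCommGroup E']

lemma EnergyLE.mono {f : UnitAddCircle → E} {M M' : ℝ} (h : EnergyLE f M) (hM : M ≤ M') :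
    EnergyLE f M' := fun s => (h s).trans (by gcongr)

lemma EnergyLE.of_dominated {f : UnitAddCircle → E} {g : UnitAddCircle → E'} {M C₁ C₂ : ℝ}
    (hf : Continuous f) (hg : Continuous g) (h : EnergyLE g M) (hC : 0 ≤ C₁)
    (hfg : ∀ (x : UnitAddCircle) (s : ℝ), ‖f (x + (s : UnitAddCircle)) - f x‖ ^ 2 ≤
      C₁ * ‖g (x + (s : UnitAddCircle)) - g x‖ ^ 2 + C₂ * s ^ 2) :
    EnergyLE f (C₁ * M + C₂) := by
  intro s
  have h1 := integral_mono_of_continuous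
    (f := fun x => ‖f (x + (s : UnitAddCircle)) - f x‖ ^ 2)
    (g := fun x => C₁ * ‖g (x + (s : UnitAddCircle)) - g x‖ ^ 2 + C₂ * s ^ 2)
    (by fun_prop) (by fun_prop) (fun x => hfg x s)
  rw [integral_add (integrable_of_continuous (by fun_prop)) (integrable_of_continuous (by fun_prop)),
    integral_const_mul, integral_haar_const] at h1
  have h2 := mul_le_mul_of_nonneg_left (h s) hC
  linarith

lemma EnergyLE.prodMk {f : UnitAddCircle → E} {g : UnitAddCircle → E'} {M M' : ℝ}
    (hf : Continuous f) (hg : Continuous g) (h : EnergyLE f M) (h' : EnergyLE g M') :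
    EnergyLE (fun x => (f x, g x)) (M + M') := by
  intro s
  have h1 := integral_mono_of_continuous
    (f := fun x => ‖(f (x + (s : UnitAddCircle)), g (x + (s : UnitAddCircle))) - (f x, g x)‖ ^ 2)
    (g := fun x => ‖f (x + (s : UnitAddCircle)) - f x‖ ^ 2 +
      ‖g (x + (s : UnitAddCircle)) - g x‖ ^ 2)
    (by fun_prop) (by fun_prop) (fun x => by
      rw [Prod.mk_sub_mk, Prod.norm_mk]
      rcases max_cases ‖f (x + (s : UnitAddCircle)) - f x‖ ‖g (x + (s : UnitAddCircle)) - g x‖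
        with h | h <;> rw [h.1] <;> nlinarith [sq_nonneg ‖f (x + (s : UnitAddCircle)) - f x‖,
          sq_nonneg ‖g (x + (s : UnitAddCircle)) - g x‖])
  rw [integral_add (integrable_of_continuous (by fun_prop))
    (integrable_of_continuous (by fun_prop))] at h1
  have := h s; have := h' s
  linarith

/-- Composition with a function that is Lipschitz on the range. -/
lemma EnergyLE.comp {f : UnitAddCircle → E} {Ψ : UnitAddCircle → E → E'} {M K : ℝ} {S : Set E}
    (hf : Continuous f) (hΨ : Continuous fun x => Ψ x (f x)) (h : EnergyLE f M)
    (hS : ∀ x, f x ∈ S)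
    (hK : ∀ (x : UnitAddCircle) (s : ℝ), ∀ v ∈ S, ∀ v' ∈ S,
      ‖Ψ (x + (s : UnitAddCircle)) v - Ψ x v'‖ ≤ K * (|s| + ‖v - v'‖)) :
    EnergyLE (fun x => Ψ x (f x)) (2 * K ^ 2 * M + 2 * K ^ 2) := by
  refine h.of_dominated hΨ hf (by positivity) fun x s => ?_
  have h1 := hK x s _ (hS (x + s)) _ (hS x)
  calc _ ≤ (K * (|s| + ‖f (x + (s : UnitAddCircle)) - f x‖)) ^ 2 := by gcongr
    _ = K ^ 2 * (|s| + ‖f (x + (s : UnitAddCircle)) - f x‖) ^ 2 := by ring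
    _ ≤ K ^ 2 * (2 * (|s| ^ 2 + ‖f (x + (s : UnitAddCircle)) - f x‖ ^ 2)) := by
        gcongr; exact add_sq_le
    _ = _ := by rw [sq_abs]; ring

lemma EnergyLE.lipschitz_comp {f : UnitAddCircle → E} {Ψ : E → E'} {M K : ℝ} {S : Set E}
    (hf : Continuous f) (hΨ : Continuous fun x => Ψ (f x)) (h : EnergyLE f M)
    (hS : ∀ x, f x ∈ S) (hK : ∀ v ∈ S, ∀ v' ∈ S, ‖Ψ v - Ψ v'‖ ≤ K * ‖v - v'‖) :
    EnergyLE (fun x => Ψ (f x)) (K ^ 2 * M) := by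
  have := h.of_dominated (C₁ := K ^ 2) (C₂ := 0) hΨ hf (by positivity) fun x s => by
    have h1 := hK _ (hS (x + s)) _ (hS x)
    calc _ ≤ (K * ‖f (x + (s : UnitAddCircle)) - f x‖) ^ 2 := by gcongr
      _ = _ := by ring
  simpa using this

lemma EnergyLE.contraction {f : UnitAddCircle → E} {Ψ : E → E'} {M : ℝ}
    (hf : Continuous f) (hΨ : Continuous Ψ) (h : EnergyLE f M)
    (hK : ∀ v v', ‖Ψ v - Ψ v'‖ ≤ ‖v - v'‖) : EnergyLE (fun x => Ψ (f x)) M := by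
  simpa using h.lipschitz_comp (K := 1) (S := univ) hf (by fun_prop) (fun _ => mem_univ _)
    (fun v _ v' _ => by simpa using hK v v')

lemma EnergyLE.add {f g : UnitAddCircle → E} {M M' : ℝ}
    (hf : Continuous f) (hg : Continuous g) (h : EnergyLE f M) (h' : EnergyLE g M') :
    EnergyLE (fun x => f x + g x) (4 * (M + M')) := by
  have := (h.prodMk hf hg h').lipschitz_comp (Ψ := fun p => p.1 + p.2) (K := 2) (S := univ)
    (by fun_prop) (by fun_prop) (fun _ => mem_univ _) (fun v _ v' _ => by
      have h1 : v.1 + v.2 - (v'.1 + v'.2) = (v - v').1 + (v - v').2 := by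
        simp only [Prod.fst_sub, Prod.snd_sub]; abel
      rw [h1]
      linarith [norm_add_le (v - v').1 (v - v').2, norm_fst_le (v - v'), norm_snd_le (v - v')])
  exact this.mono (le_of_eq (by ring))

lemma EnergyLE.sub {f g : UnitAddCircle → E} {M M' : ℝ}
    (hf : Continuous f) (hg : Continuous g) (h : EnergyLE f M) (h' : EnergyLE g M') :
    EnergyLE (fun x => f x - g x) (4 * (M + M')) := by
  have := h.add (g := fun x => -g x) hf (by fun_prop)
    (h'.contraction (Ψ := fun v => -v) hg continuous_neg (fun v v' => by
      rw [neg_sub_neg, norm_sub_rev]))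
  simpa [sub_eq_add_neg] using this

lemma energyLE_const (c : E) : EnergyLE (fun _ => c) 0 := by intro s; simp

end

lemma summable_rpow_weight :
    Summable fun n : ℤ => (if n = 0 then 1 else |(n : ℝ)| ^ (-(3 / 2) : ℝ)) := by
  have h := Real.summable_abs_int_rpow (b := 3 / 2) (by norm_num)
  have h2 : Summable fun n : ℤ => if n = 0 then (1 : ℝ) else 0 :=
    summable_of_ne_finset_zero (s := {0}) (fun n hn => by simp at hn; simp [hn])
  refine Summable.of_nonneg_of_le (fun n => ?_) (fun n => ?_) (h.add h2)
  · split_ifs <;> positivity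
  · split_ifs with hn
    · simp [hn]
    · simp

/-- The sum of the weights `|n|^(-3/2)`. -/
def weightSum : ℝ := ∑' n : ℤ, (if n = 0 then 1 else |(n : ℝ)| ^ (-(3 / 2) : ℝ))

lemma one_le_weightSum : 1 ≤ weightSum := by
  have := summable_rpow_weight.le_tsum 0 (fun n _ => by split_ifs <;> positivity)
  simpa [weightSum] using this

lemma one_le_weight_mul {j : ℝ} (hj : 0 < j) (hj1 : j ≤ 1) (n : ℤ) :
    1 ≤ (if n = 0 then 1 else |(n : ℝ)| ^ (-(3 / 2) : ℝ)) / j ^ 3 * (1 + j ^ 4 * (n : ℝ) ^ 2) := by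
  split_ifs with hn
  · subst hn
    simp only [Int.cast_zero, ne_eq, OfNat.ofNat_ne_zero, not_false_eq_true, zero_pow, mul_zero,
      add_zero, mul_one]
    rw [le_div_iff₀ (by positivity), one_mul]
    exact pow_le_one₀ hj.le hj1
  · have hn0 : 0 < |(n : ℝ)| := by positivity
    set y := √|(n : ℝ)| with hy
    have hy0 : 0 < y := Real.sqrt_pos.2 hn0
    have h1 : |(n : ℝ)| = y ^ 2 := (Real.sq_sqrt hn0.le).symm
    have h2 : |(n : ℝ)| ^ (-(3 / 2) : ℝ) = (y ^ 3)⁻¹ := by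
      rw [Real.rpow_neg hn0.le, h1, ← Real.rpow_natCast_mul hy0.le]
      norm_num
    rw [h2, ← sq_abs (n : ℝ), h1]
    rw [div_mul_eq_mul_div, inv_mul_eq_div, div_div, le_div_iff₀ (by positivity), one_mul]
    have : 0 < j * y := by positivity
    nlinarith [sq_nonneg (j * y - 1), sq_nonneg ((j * y) ^ 2 - 1), sq_nonneg ((j * y) ^ 2 - j * y),
      mul_pow j y 3, mul_pow j y 4]

lemma EnergyLE.summable_sq {f : UnitAddCircle → ℂ} (hf : Continuous f) {M : ℝ}
    (h : EnergyLE f M) : Summable fun n : ℤ => (n : ℝ) ^ 2 * ‖fourierCoeff f n‖ ^ 2 :=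
  summable_of_sum_le (fun _ => by positivity) (h.sum_le hf)

lemma EnergyLE.summable_and_tsum_le {f : UnitAddCircle → ℂ} (hf : Continuous f) {M : ℝ}
    (h : EnergyLE f M) {j A : ℝ} (hj : 0 < j) (hj1 : j ≤ 1) (hA : 0 < A) :
    Summable (fun n : ℤ => ‖fourierCoeff f n‖) ∧ ∑' n, ‖fourierCoeff f n‖ ≤
      ((meanSq f + j ^ 4 * M) / A + A * (weightSum / j ^ 3)) / 2 := by
  have hs := hasSum_sq_fourierCoeff_of_continuous hf
  have hs2 := (h.summable_sq hf)
  have hz := summable_rpow_weight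
  set z : ℤ → ℝ := fun n => (if n = 0 then 1 else |(n : ℝ)| ^ (-(3 / 2) : ℝ)) with hzdef
  have key : ∀ n, ‖fourierCoeff f n‖ ≤ ((‖fourierCoeff f n‖ ^ 2 +
      j ^ 4 * ((n : ℝ) ^ 2 * ‖fourierCoeff f n‖ ^ 2)) / A + A * (z n / j ^ 3)) / 2 := by
    intro n
    set c := ‖fourierCoeff f n‖
    have hw := one_le_weight_mul hj hj1 n
    change 1 ≤ z n / j ^ 3 * _ at hw
    set v := z n / j ^ 3
    set w := 1 + j ^ 4 * (n : ℝ) ^ 2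
    have hw0 : 0 < w := by positivity
    have h1 : 1 / w ≤ v := by rw [div_le_iff₀ hw0]; exact hw
    have h2 : c ^ 2 + j ^ 4 * ((n : ℝ) ^ 2 * c ^ 2) = w * c ^ 2 := by ring
    rw [h2]
    have h3 : c ≤ (w * c ^ 2 / A + A * (1 / w)) / 2 := by
      have : w * c ^ 2 / A + A * (1 / w) - 2 * c = (w * c - A) ^ 2 / (A * w) := by
        field_simp; ring
      have h4 : 0 ≤ (w * c - A) ^ 2 / (A * w) := by positivity
      linarith
    calc c ≤ _ := h3
      _ ≤ _ := by gcongr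
  have hsum := (((hs.summable.add (hs2.mul_left (j ^ 4))).div_const A).add
    ((hz.div_const (j ^ 3)).mul_left A)).div_const 2
  have hsm := Summable.of_nonneg_of_le (fun n => norm_nonneg _) key hsum
  refine ⟨hsm, (hsm.tsum_le_tsum key hsum).trans ?_⟩
  have h5 : ∑' n : ℤ, (n : ℝ) ^ 2 * ‖fourierCoeff f n‖ ^ 2 ≤ M :=
    hs2.tsum_le_of_sum_le (h.sum_le hf)
  rw [tsum_div_const, Summable.tsum_add ((hs.summable.add (hs2.mul_left (j ^ 4))).div_const A)
    ((hz.div_const (j ^ 3)).mul_left A), tsum_div_const, Summable.tsum_add hs.summable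
    (hs2.mul_left (j ^ 4)), tsum_mul_left, tsum_mul_left, tsum_div_const, hs.tsum_eq]
  have : weightSum = ∑' n, z n := rfl
  rw [this]
  gcongr

lemma norm_le_tsum_fourierCoeff {f : UnitAddCircle → ℂ} (hf : Continuous f)
    (h : Summable fun n : ℤ => ‖fourierCoeff f n‖) (x : UnitAddCircle) :
    ‖f x‖ ≤ ∑' n, ‖fourierCoeff f n‖ := by
  have := has_pointwise_sum_fourier_series_of_summable (f := ⟨f, hf⟩) h.of_norm x
  have h2 := this.tsum_eq
  change _ = f x at h2
  rw [← h2]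
  refine (norm_tsum_le_tsum_norm ?_).trans (le_of_eq ?_)
  · simpa only [smul_eq_mul, norm_mul, norm_fourier_apply, mul_one, ContinuousMap.coe_mk] using h
  · simp only [smul_eq_mul, norm_mul, norm_fourier_apply, mul_one, ContinuousMap.coe_mk]

/-- Interpolation between the quadratic mean and the energy. -/
lemma exists_meanSq_bound (M : ℝ) {ε : ℝ} (hε : 0 < ε) : ∃ ρ : ℝ, 0 < ρ ∧
    ∀ f : UnitAddCircle → ℂ, Continuous f → EnergyLE f M → meanSq f ≤ ρ → ∀ x, ‖f x‖ ≤ ε := by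
  have hZ := one_le_weightSum
  set Z := weightSum
  set j : ℝ := min 1 (ε ^ 2 / ((1 + |M|) * Z))
  have hj : 0 < j := by positivity
  have hj1 : j ≤ 1 := min_le_left _ _
  have hj2 : j ≤ ε ^ 2 / ((1 + |M|) * Z) := min_le_right _ _
  refine ⟨j ^ 4, by positivity, fun f hf h hm x => ?_⟩
  obtain ⟨h1, h2⟩ := h.summable_and_tsum_le hf hj hj1 (A := ε * j ^ 3 / Z) (by positivity)
  refine (norm_le_tsum_fourierCoeff hf h1 x).trans (h2.trans ?_)
  have h3 : ε * j ^ 3 / Z * (Z / j ^ 3) = ε := by field_simp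
  have h4 : (meanSq f + j ^ 4 * M) / (ε * j ^ 3 / Z) ≤ ε := by
    rw [div_le_iff₀ (by positivity)]
    rw [le_div_iff₀ (by positivity)] at hj2
    calc meanSq f + j ^ 4 * M ≤ j ^ 4 + j ^ 4 * |M| := by gcongr; exact le_abs_self M
      _ = (j * ((1 + |M|) * Z)) * (j ^ 3 / Z) := by field_simp
      _ ≤ ε ^ 2 * (j ^ 3 / Z) := by gcongr
      _ = _ := by ring
  change (_ + _ * (Z / j ^ 3)) / 2 ≤ ε
  rw [h3]; linarith

lemma EnergyLE.norm_le {f : UnitAddCircle → ℂ} (hf : Continuous f) {M : ℝ} (h : EnergyLE f M)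
    (x : UnitAddCircle) : ‖f x‖ ≤ (meanSq f + M + weightSum) / 2 := by
  obtain ⟨h1, h2⟩ := h.summable_and_tsum_le hf one_pos le_rfl one_pos
  refine (norm_le_tsum_fourierCoeff hf h1 x).trans (h2.trans (le_of_eq ?_))
  ring

section HolDisk

lemma closedBall_eq_closure : closedBall (0 : ℂ) 1 = closure (ball 0 1) :=
  (closure_ball 0 one_ne_zero).symm

variable {h k : ℂ → ℂ}

lemma _root_.HolDisk.diffContOnCl (hh : HolDisk h) : DiffContOnCl ℂ h (ball 0 1) :=
  ⟨hh.2, closedBall_eq_closure ▸ hh.1⟩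

lemma _root_.HolDisk.continuous_circ (hh : HolDisk h) : Continuous fun x => h (circ x) :=
  hh.1.comp_continuous TorusFoliation.continuous_circ circ_mem_closedBall

lemma holDisk_const (c : ℂ) : HolDisk fun _ => c := ⟨by fun_prop, by fun_prop⟩

lemma _root_.HolDisk.add (hh : HolDisk h) (hk : HolDisk k) : HolDisk fun z => h z + k z :=
  ⟨hh.1.add hk.1, hh.2.add hk.2⟩

lemma _root_.HolDisk.sub (hh : HolDisk h) (hk : HolDisk k) : HolDisk fun z => h z - k z :=
  ⟨hh.1.sub hk.1, hh.2.sub hk.2⟩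

lemma _root_.HolDisk.neg (hh : HolDisk h) : HolDisk fun z => -h z :=
  ⟨hh.1.neg, hh.2.neg⟩

lemma _root_.HolDisk.mul (hh : HolDisk h) (hk : HolDisk k) : HolDisk fun z => h z * k z :=
  ⟨hh.1.mul hk.1, hh.2.mul hk.2⟩

lemma _root_.HolDisk.const_mul (c : ℂ) (hh : HolDisk h) : HolDisk fun z => c * h z :=
  (holDisk_const c).mul hh

lemma _root_.HolDisk.exp (hh : HolDisk h) : HolDisk fun z => Complex.exp (h z) :=
  ⟨hh.1.cexp, hh.2.cexp⟩

lemma _root_.HolDisk.comp_rotation (hh : HolDisk h) (s : UnitAddCircle) :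
    HolDisk fun z => h (circ s * z) :=
  ⟨hh.1.comp (by fun_prop) fun z hz => by simpa [norm_circ] using hz,
    hh.2.comp (by fun_prop) fun z hz => by simpa [norm_circ] using hz⟩

/-- Maximum modulus principle. -/
lemma _root_.HolDisk.norm_le (hh : HolDisk h) {B : ℝ} (hB : ∀ x, ‖h (circ x)‖ ≤ B) :
    ∀ z ∈ closedBall (0 : ℂ) 1, ‖h z‖ ≤ B := fun z hz =>
  norm_le_of_forall_mem_frontier_norm_le isBounded_ball hh.diffContOnCl
    (fun w hw => by
      rw [frontier_ball _ one_ne_zero] at hw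
      obtain ⟨x, rfl⟩ := exists_circ_eq hw
      exact hB x) (closedBall_eq_closure ▸ hz)

lemma re_nonpos_of_circ (hh : HolDisk h) (H : ∀ x, (h (circ x)).re ≤ 0) :
    ∀ z ∈ closedBall (0 : ℂ) 1, (h z).re ≤ 0 := fun z hz => by
  have := hh.exp.norm_le (B := 1) (fun x => by
    rw [Complex.norm_exp]; exact Real.exp_le_one_iff.2 (H x)) z hz
  rwa [Complex.norm_exp, Real.exp_le_one_iff] at this

/-- A holomorphic disk with vanishing real part on the circle is an imaginary constant. -/
lemma _root_.HolDisk.eq_im_const (hh : HolDisk h) (H : ∀ x, (h (circ x)).re = 0) :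
    ∃ c : ℝ, ∀ z ∈ closedBall (0 : ℂ) 1, h z = c * I := by
  have h1 : ∀ z ∈ ball (0 : ℂ) 1, (h z).re = 0 := fun z hz => by
    have hz' := ball_subset_closedBall hz
    refine le_antisymm (re_nonpos_of_circ hh (fun x => (H x).le) z hz') ?_
    have := re_nonpos_of_circ hh.neg (fun x => by simp [H x]) z hz'
    simpa using this
  obtain ⟨c, hc⟩ := (hh.2.analyticOnNhd isOpen_ball).eq_re_add_const_mul_I_of_re_eq_const h1
    isOpen_ball ((convex_ball _ _).isConnected (by simp))
  refine ⟨c, fun z hz => ?_⟩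
  have := EqOn.of_subset_closure (s := ball (0 : ℂ) 1) (t := closedBall 0 1) (f := h)
    (g := fun _ => c * I) (fun z hz => by simpa using hc z hz) hh.1 (by fun_prop)
    ball_subset_closedBall closedBall_eq_closure.le
  exact this hz

end HolDisk

section PowerSeries

variable {a : ℕ → ℂ}

lemma norm_powerSeries_term_le (a : ℕ → ℂ) (n : ℕ) {z : ℂ} (hz : z ∈ closedBall (0 : ℂ) 1) :
    ‖a n * z ^ n‖ ≤ ‖a n‖ := by
  rw [norm_mul, norm_pow]
  exact mul_le_of_le_one_right (norm_nonneg _) (pow_le_one₀ (norm_nonneg _) (by simpa using hz))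

lemma hasSum_powerSeries (ha : Summable fun n => ‖a n‖) {z : ℂ} (hz : z ∈ closedBall (0 : ℂ) 1) :
    HasSum (fun n => a n * z ^ n) (∑' n, a n * z ^ n) :=
  (Summable.of_norm_bounded ha fun n => norm_powerSeries_term_le a n hz).hasSum

lemma holDisk_powerSeries (ha : Summable fun n => ‖a n‖) :
    HolDisk fun z => ∑' n, a n * z ^ n :=
  ⟨continuousOn_tsum (fun n => by fun_prop) ha fun n z hz => norm_powerSeries_term_le a n hz,
    differentiableOn_tsum_of_summable_norm ha (fun n => by fun_prop) isOpen_ball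
      fun n z hz => norm_powerSeries_term_le a n (ball_subset_closedBall hz)⟩

lemma fourierCoeff_powerSeries (ha : Summable fun n => ‖a n‖) (m : ℤ) :
    fourierCoeff (fun x => ∑' n, a n * circ x ^ n) m =
      ∑' n : ℕ, a n * (if m = n then 1 else 0) := by
  have h1 : ∀ n : ℕ, ∀ x, (fourier (-m) x • (a n * circ x ^ n) : ℂ) =
      a n * (fourier (-m) x • fourier (n : ℤ) x) := fun n x => by
    rw [fourier_eq_circ_zpow n]; simp; ring
  have h2 := (hasSum_integral_of_summable_integral_norm (μ := haarAddCircle (T := 1))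
    (F := fun (n : ℕ) (x : UnitAddCircle) => (fourier (-m) x • (a n * circ x ^ n) : ℂ))
    (fun n => integrable_of_continuous (by have := continuous_circ; fun_prop)) (by
      simpa only [norm_smul, norm_mul, norm_pow, norm_circ, norm_fourier_apply, one_pow, mul_one,
        one_mul, integral_haar_const] using ha)).tsum_eq
  unfold fourierCoeff
  have h3 : ∀ x : UnitAddCircle, (fourier (-m) x • ∑' n : ℕ, a n * circ x ^ n : ℂ) =
      ∑' n : ℕ, (fourier (-m) x • (a n * circ x ^ n) : ℂ) := fun x =>
    ((hasSum_powerSeries ha (circ_mem_closedBall x)).const_smul _).tsum_eq.symm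
  simp_rw [h3]
  rw [← h2]
  congr 1; ext n
  simp_rw [h1]
  rw [integral_const_mul]
  congr 1
  have := congrFun (fourierCoeff_fourier (T := 1) (n : ℤ)) m
  simpa [fourierCoeff, Pi.single_apply] using this

lemma fourierCoeff_powerSeries_natCast (ha : Summable fun n => ‖a n‖) (m : ℕ) :
    fourierCoeff (fun x => ∑' n, a n * circ x ^ n) m = a m := by
  rw [fourierCoeff_powerSeries ha, tsum_eq_single m]
  · simp
  · intro n hn; simp [hn.symm]

lemma fourierCoeff_powerSeries_neg (ha : Summable fun n => ‖a n‖) {m : ℤ} (hm : m < 0) :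
    fourierCoeff (fun x => ∑' n, a n * circ x ^ n) m = 0 := by
  rw [fourierCoeff_powerSeries ha]
  convert tsum_zero with n
  rw [if_neg (by omega), mul_zero]

end PowerSeries

section Schwarz

lemma norm_fourierCoeff_powerSeries_le {f : UnitAddCircle → ℂ}
    (hs : Summable fun n : ℤ => ‖fourierCoeff f n‖) (m : ℤ) :
    ‖fourierCoeff (fun x => ∑' n : ℕ, fourierCoeff f n * circ x ^ n) m‖ ≤ ‖fourierCoeff f m‖ := by
  have hs' := hs.comp_injective Nat.cast_injective
  rcases lt_or_ge m 0 with hm | hm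
  · rw [fourierCoeff_powerSeries_neg (a := fun n : ℕ => fourierCoeff f n) hs' hm, norm_zero]
    positivity
  · lift m to ℕ using hm
    rw [fourierCoeff_powerSeries_natCast (a := fun n : ℕ => fourierCoeff f n) hs']

lemma meanSq_le_of_norm_fourierCoeff_le {f g : UnitAddCircle → ℂ} (hf : Continuous f)
    (hg : Continuous g) (h : ∀ n, ‖fourierCoeff f n‖ ≤ ‖fourierCoeff g n‖) :
    meanSq f ≤ meanSq g :=
  hasSum_le (fun n => by gcongr; exact h n) (hasSum_sq_fourierCoeff_of_continuous hf)
    (hasSum_sq_fourierCoeff_of_continuous hg)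

lemma EnergyLE.of_norm_fourierCoeff_le {f g : UnitAddCircle → ℂ} (hf : Continuous f)
    (hg : Continuous g) (h : ∀ n, ‖fourierCoeff f n‖ ≤ ‖fourierCoeff g n‖) {M : ℝ}
    (hM : EnergyLE g M) : EnergyLE f M := fun s =>
  (meanSq_le_of_norm_fourierCoeff_le (f := fun x => f (x + (s : UnitAddCircle)) - f x)
    (g := fun x => g (x + (s : UnitAddCircle)) - g x) (by fun_prop) (by fun_prop) (fun n => by
      rw [fourierCoeff_translate_sub hf, fourierCoeff_translate_sub hg, norm_mul, norm_mul]
      gcongr; exact h n)).trans (hM s)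

lemma EnergyLE.ofReal {u : UnitAddCircle → ℝ} {M : ℝ} (hu : Continuous u) (h : EnergyLE u M) :
    EnergyLE (fun x => (u x : ℂ)) M :=
  h.contraction hu continuous_ofReal fun v v' => by rw [← ofReal_sub, norm_real]

lemma EnergyLE.re {f : UnitAddCircle → ℂ} {M : ℝ} (hf : Continuous f) (h : EnergyLE f M) :
    EnergyLE (fun x => (f x).re) M :=
  h.contraction hf Complex.continuous_re fun v v' => by
    rw [← sub_re, Real.norm_eq_abs]; exact abs_re_le_norm _

lemma EnergyLE.im {f : UnitAddCircle → ℂ} {M : ℝ} (hf : Continuous f) (h : EnergyLE f M) :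
    EnergyLE (fun x => (f x).im) M :=
  h.contraction hf Complex.continuous_im fun v v' => by
    rw [← sub_im, Real.norm_eq_abs]; exact abs_im_le_norm _

lemma meanSq_ofReal (u : UnitAddCircle → ℝ) : meanSq (fun x => (u x : ℂ)) = meanSq u := by
  simp [meanSq]

lemma EnergyLE.summable {f : UnitAddCircle → ℂ} (hf : Continuous f) {M : ℝ} (h : EnergyLE f M) :
    Summable fun n : ℤ => ‖fourierCoeff f n‖ :=
  (h.summable_and_tsum_le hf one_pos le_rfl one_pos).1

/-- The holomorphic function on the disk with real part `u` on the circle and real value at the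
center. -/
def schwarz (u : UnitAddCircle → ℝ) : ℂ → ℂ := fun z =>
  2 * (∑' n : ℕ, fourierCoeff (fun x => (u x : ℂ)) n * z ^ n) - fourierCoeff (fun x => (u x : ℂ)) 0

lemma fourierCoeff_neg_ofReal (u : UnitAddCircle → ℝ) (n : ℤ) :
    fourierCoeff (fun x => (u x : ℂ)) (-n) =
      (starRingEnd ℂ) (fourierCoeff (fun x => (u x : ℂ)) n) := by
  unfold fourierCoeff
  rw [← integral_conj]
  congr 1; ext x
  simp only [smul_eq_mul, map_mul, conj_ofReal, neg_neg]
  rw [← fourier_neg, neg_neg]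

lemma fourierCoeff_zero_ofReal (u : UnitAddCircle → ℝ) :
    fourierCoeff (fun x => (u x : ℂ)) 0 = ((∫ x, u x ∂haarAddCircle : ℝ) : ℂ) := by
  rw [← integral_complex_ofReal]; simp [fourierCoeff]

lemma schwarz_zero (u : UnitAddCircle → ℝ) :
    schwarz u 0 = ((∫ x, u x ∂haarAddCircle : ℝ) : ℂ) := by
  rw [← fourierCoeff_zero_ofReal, schwarz, tsum_eq_single 0]
  · simp; ring
  · intro n hn; simp [hn]

variable {u v : UnitAddCircle → ℝ} {M M' : ℝ}

lemma summable_natCast_coeff (hu : Continuous u) (h : EnergyLE u M) :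
    Summable fun n : ℕ => ‖fourierCoeff (fun x => (u x : ℂ)) n‖ :=
  ((h.ofReal hu).summable (by fun_prop)).comp_injective Nat.cast_injective

lemma holDisk_schwarz (hu : Continuous u) (h : EnergyLE u M) : HolDisk (schwarz u) :=
  ((holDisk_powerSeries (summable_natCast_coeff hu h)).const_mul 2).sub (holDisk_const _)

lemma schwarz_sub (hu : Continuous u) (h : EnergyLE u M) (hv : Continuous v) (h' : EnergyLE v M')
    {z : ℂ} (hz : z ∈ closedBall (0 : ℂ) 1) :
    schwarz u z - schwarz v z = schwarz (fun x => u x - v x) z := by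
  have h1 := hasSum_powerSeries (summable_natCast_coeff hu h) hz
  have h2 := hasSum_powerSeries (summable_natCast_coeff hv h') hz
  have h3 : ∀ n, fourierCoeff (fun x => ((u x - v x : ℝ) : ℂ)) n =
      fourierCoeff (fun x => (u x : ℂ)) n - fourierCoeff (fun x => (v x : ℂ)) n := fun n => by
    have hcu : Continuous fun x => (u x : ℂ) := by fun_prop
    have hcv : Continuous fun x => (v x : ℂ) := by fun_prop
    have := congrFun (fourierCoeff.add (integrable_of_continuous hcu)
      ((integrable_of_continuous hcv).smul (-1 : ℂ))) n
    simp only [Pi.add_apply, fourierCoeff.const_smul] at this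
    rw [sub_eq_add_neg, neg_eq_neg_one_mul, ← smul_eq_mul (-1 : ℂ), ← this]
    congr 1; ext x; simp; ring
  simp only [schwarz, h3, sub_mul]
  rw [(h1.sub h2).tsum_eq]; ring

lemma schwarz_re (hu : Continuous u) (h : EnergyLE u M) (x : UnitAddCircle) :
    (schwarz u (circ x)).re = u x := by
  have hcu : Continuous fun x => (u x : ℂ) := by fun_prop
  have h1 := (has_pointwise_sum_fourier_series_of_summable (f := ⟨fun x => (u x : ℂ), hcu⟩)
    ((h.ofReal hu).summable hcu).of_norm x).nat_add_neg
  simp only [ContinuousMap.coe_mk] at h1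
  have h2 := (hasSum_powerSeries (summable_natCast_coeff hu h) (circ_mem_closedBall x)).mul_left 2
  have h3 := Complex.hasSum_re h1
  have h4 := Complex.hasSum_re h2
  have h5 : ∀ n : ℕ, (fourierCoeff (fun x => (u x : ℂ)) n • fourier (n : ℤ) x +
      fourierCoeff (fun x => (u x : ℂ)) (-(n : ℤ)) • fourier (-(n : ℤ)) x).re =
      (2 * (fourierCoeff (fun x => (u x : ℂ)) n * circ x ^ n)).re := fun n => by
    have e : fourier (n : ℤ) x = circ x ^ n := by rw [fourier_eq_circ_zpow]; simp
    rw [fourierCoeff_neg_ofReal, fourier_neg, e, smul_eq_mul, smul_eq_mul, ← map_mul, add_re,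
      conj_re, two_mul, add_re]
  simp only [h5] at h3
  have h6 := h3.unique h4
  rw [schwarz, sub_re, ← h6]
  simp [fourierCoeff_zero_ofReal]

lemma continuous_schwarz_circ (hu : Continuous u) (h : EnergyLE u M) :
    Continuous fun x => schwarz u (circ x) := (holDisk_schwarz hu h).continuous_circ

lemma energyLE_schwarz (hu : Continuous u) (h : EnergyLE u M) :
    EnergyLE (fun x => schwarz u (circ x)) (4 * M) := by
  have hcu : Continuous fun x => (u x : ℂ) := by fun_prop
  have hp := (holDisk_powerSeries (summable_natCast_coeff hu h)).continuous_circ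
  have h1 := EnergyLE.of_norm_fourierCoeff_le hp hcu
    (norm_fourierCoeff_powerSeries_le ((h.ofReal hu).summable hcu)) (h.ofReal hu)
  have h2 := h1.lipschitz_comp (Ψ := fun z => 2 * z - fourierCoeff (fun x => (u x : ℂ)) 0) (K := 2)
    (S := univ) hp (by fun_prop) (fun _ => mem_univ _) (fun v _ v' _ => by
      rw [sub_sub_sub_cancel_right, ← mul_sub, norm_mul, Complex.norm_ofNat])
  exact h2.mono (by linarith)

lemma meanSq_schwarz_le (hu : Continuous u) (h : EnergyLE u M) :
    meanSq (fun x => schwarz u (circ x)) ≤ 10 * meanSq u := by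
  have hcu : Continuous fun x => (u x : ℂ) := by fun_prop
  have hp := (holDisk_powerSeries (summable_natCast_coeff hu h)).continuous_circ
  have h1 := meanSq_le_of_norm_fourierCoeff_le hp hcu
    (norm_fourierCoeff_powerSeries_le ((h.ofReal hu).summable hcu))
  have h0 : ‖fourierCoeff (fun x => (u x : ℂ)) 0‖ ^ 2 ≤ meanSq (fun x => (u x : ℂ)) :=
    le_hasSum (hasSum_sq_fourierCoeff_of_continuous hcu) 0 fun _ _ => by positivity
  rw [meanSq_ofReal] at h0 h1
  have hb := continuous_schwarz_circ hu h
  have h2 := integral_mono_of_continuous (f := fun x => ‖schwarz u (circ x)‖ ^ 2)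
    (g := fun x => 8 * ‖∑' n : ℕ, fourierCoeff (fun x => (u x : ℂ)) n * circ x ^ n‖ ^ 2 +
      2 * ‖fourierCoeff (fun x => (u x : ℂ)) 0‖ ^ 2) (by fun_prop) (by fun_prop) (fun x => by
        have := norm_sub_le (2 * ∑' n : ℕ, fourierCoeff (fun x => (u x : ℂ)) n * circ x ^ n)
          (fourierCoeff (fun x => (u x : ℂ)) 0)
        rw [norm_mul, Complex.norm_ofNat] at this
        calc ‖schwarz u (circ x)‖ ^ 2 ≤ _ := by rw [schwarz]; gcongr
          _ ≤ _ := add_sq_le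
          _ = _ := by ring)
  rw [integral_add (integrable_of_continuous (by fun_prop)) (integrable_of_continuous (by fun_prop)),
    integral_const_mul, integral_haar_const] at h2
  change meanSq _ ≤ _ at h2
  change _ ≤ 8 * meanSq _ + _ at h2
  linarith

lemma abs_integral_le_of_abs_le {B : ℝ} (hB : ∀ x, |u x| ≤ B) :
    |∫ x, u x ∂haarAddCircle| ≤ B := by
  have := norm_integral_le_of_norm_le_const (μ := haarAddCircle) (f := u) (C := B)
    (ae_of_all _ hB)
  simpa using this

lemma norm_schwarz_le (hu : Continuous u) (h : EnergyLE u M) {B : ℝ} (hB : ∀ x, |u x| ≤ B) :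
    ∀ z ∈ closedBall (0 : ℂ) 1, ‖schwarz u z‖ ≤ 5 * B ^ 2 + 2 * M + weightSum := by
  refine (holDisk_schwarz hu h).norm_le fun x => ?_
  have h1 := (energyLE_schwarz hu h).norm_le (continuous_schwarz_circ hu h) x
  have h2 := meanSq_schwarz_le hu h
  have h3 := meanSq_le_of_norm_le hu hB
  linarith [one_le_weightSum]

/-- The power series of a holomorphic disk of finite energy. -/
lemma _root_.HolDisk.hasSum {k : ℂ → ℂ} (hk : HolDisk k) {M : ℝ}
    (h : EnergyLE (fun x => k (circ x)) M) {z : ℂ} (hz : z ∈ closedBall (0 : ℂ) 1) :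
    HasSum (fun n : ℕ => fourierCoeff (fun x => k (circ x)) n * z ^ n) (k z) := by
  set u : UnitAddCircle → ℝ := fun x => (k (circ x)).re
  have hu : Continuous u := Complex.continuous_re.comp hk.continuous_circ
  have hE : EnergyLE u M := h.re hk.continuous_circ
  obtain ⟨c, hc⟩ := (hk.sub (holDisk_schwarz hu hE)).eq_im_const (fun x => by
    rw [sub_re, schwarz_re hu hE]; simp [u])
  set a : ℕ → ℂ := fun n => 2 * fourierCoeff (fun x => (u x : ℂ)) n +
    if n = 0 then c * I - fourierCoeff (fun x => (u x : ℂ)) 0 else 0 with ha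
  have hone : ∀ (d z : ℂ), HasSum (fun n : ℕ => (if n = 0 then d else 0) * z ^ n) d := fun d z => by
    have := hasSum_single (f := fun n : ℕ => (if n = 0 then d else 0) * z ^ n) 0
      (fun n hn => by simp [hn])
    simpa using this
  have hs := summable_natCast_coeff hu hE
  have hsa : Summable fun n => ‖a n‖ := by
    refine Summable.of_nonneg_of_le (fun _ => norm_nonneg _) (fun n => norm_add_le _ _)
      (Summable.add ?_ ?_)
    · simpa [norm_mul] using hs.mul_left 2
    · exact summable_of_ne_finset_zero (s := {0}) fun n hn => by simp at hn; simp [hn]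
  have hsum : ∀ z ∈ closedBall (0 : ℂ) 1, HasSum (fun n => a n * z ^ n) (k z) := fun z hz => by
    have h1 := ((hasSum_powerSeries hs hz).mul_left 2).add
      (hone (c * I - fourierCoeff (fun x => (u x : ℂ)) 0) z)
    have h2 : 2 * (∑' n : ℕ, fourierCoeff (fun x => (u x : ℂ)) n * z ^ n) +
        (c * I - fourierCoeff (fun x => (u x : ℂ)) 0) = k z := by
      have := hc z hz
      rw [schwarz] at this
      linear_combination -this
    rw [h2] at h1
    refine h1.congr_fun ?_
    intro n; simp only [ha]; ring
  have hco : ∀ n : ℕ, fourierCoeff (fun x => k (circ x)) n = a n := fun n => by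
    rw [← fourierCoeff_powerSeries_natCast hsa n]
    congr 1; ext x
    exact (hsum _ (circ_mem_closedBall x)).tsum_eq.symm
  simpa only [hco] using hsum z hz

end Schwarz

lemma EnergyLE.mul {R : Type*} [NormedRing R] {f g : UnitAddCircle → R} {M M' B B' : ℝ}
    (hf : Continuous f) (hg : Continuous g) (h : EnergyLE f M) (h' : EnergyLE g M')
    (hB : ∀ x, ‖f x‖ ≤ B) (hB' : ∀ x, ‖g x‖ ≤ B') :
    EnergyLE (fun x => f x * g x) ((B + B') ^ 2 * (M + M')) :=
  (h.prodMk hf hg h').lipschitz_comp (Ψ := fun p => p.1 * p.2)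
    (S := {p : R × R | ‖p.1‖ ≤ B ∧ ‖p.2‖ ≤ B'}) (by fun_prop) (by fun_prop)
    (fun x => ⟨hB x, hB' x⟩) (fun v hv v' hv' => by
      have e : v.1 * v.2 - v'.1 * v'.2 = v.1 * (v - v').2 + (v - v').1 * v'.2 := by
        simp only [Prod.fst_sub, Prod.snd_sub]; noncomm_ring
      rw [e]
      calc _ ≤ ‖v.1‖ * ‖(v - v').2‖ + ‖(v - v').1‖ * ‖v'.2‖ :=
            (norm_add_le _ _).trans (add_le_add (norm_mul_le _ _) (norm_mul_le _ _))
        _ ≤ B * ‖v - v'‖ + ‖v - v'‖ * B' := by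
            have := (norm_nonneg _).trans hv.1
            have := (norm_nonneg _).trans hv'.2
            gcongr
            exacts [hv.1, norm_snd_le _, norm_fst_le _, hv'.2]
        _ = _ := by ring)

lemma abs_exp_sub_exp_le {B x y : ℝ} (hx : |x| ≤ B) (hy : |y| ≤ B) :
    |Real.exp x - Real.exp y| ≤ Real.exp B * |x - y| := by
  have := (convex_Icc (-B) B).norm_image_sub_le_of_norm_deriv_le (f := Real.exp)
    (C := Real.exp B) (x := y) (y := x) (fun z _ => Real.differentiableAt_exp) (fun z hz => by
      rw [Real.deriv_exp, Real.norm_eq_abs, Real.abs_exp, Real.exp_le_exp]; exact hz.2)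
    (abs_le.1 hy) (abs_le.1 hx)
  simpa [Real.norm_eq_abs] using this

lemma EnergyLE.exp {u : UnitAddCircle → ℝ} {M B : ℝ} (hu : Continuous u) (h : EnergyLE u M)
    (hB : ∀ x, |u x| ≤ B) : EnergyLE (fun x => Real.exp (u x)) (Real.exp B ^ 2 * M) :=
  h.lipschitz_comp (Ψ := Real.exp) (S := {x | |x| ≤ B}) hu (by fun_prop) hB
    (fun v hv v' hv' => by simpa [Real.norm_eq_abs] using abs_exp_sub_exp_le hv hv')

section RiemannHilbert

/-- The logarithm of the holomorphic factor of `exp L` on the circle. -/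
def rhLog (L : UnitAddCircle → ℂ) : ℂ → ℂ := fun z => I * schwarz (fun x => (L x).im) z

/-- The reciprocal of the positive factor of `exp L` on the circle. -/
def rhWeight (L : UnitAddCircle → ℂ) : UnitAddCircle → ℝ := fun x =>
  Real.exp ((rhLog L (circ x)).re - (L x).re)

/-- The particular solution of the Riemann-Hilbert problem with right hand side `b`. -/
def rhSol (L : UnitAddCircle → ℂ) (b : UnitAddCircle → ℝ) : ℂ → ℂ :=
  schwarz fun x => b x * rhWeight L x

variable {L : UnitAddCircle → ℂ} {b : UnitAddCircle → ℝ} {M Mb B Bb : ℝ}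

lemma rhWeight_pos (L : UnitAddCircle → ℂ) (x : UnitAddCircle) : 0 < rhWeight L x :=
  Real.exp_pos _

section
variable (hL : Continuous L) (hM : EnergyLE L M)
include hL hM

lemma holDisk_rhLog : HolDisk (rhLog L) :=
  (holDisk_schwarz (by fun_prop) (hM.im hL)).const_mul I

lemma rhLog_circ_im (x : UnitAddCircle) : (rhLog L (circ x)).im = (L x).im := by
  have := schwarz_re (u := fun x => (L x).im) (by fun_prop) (hM.im hL) x
  simp [rhLog, this]

lemma energyLE_rhLog : EnergyLE (fun x => rhLog L (circ x)) (4 * M) :=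
  (energyLE_schwarz (by fun_prop) (hM.im hL)).contraction (Ψ := fun z => I * z)
    (continuous_schwarz_circ (by fun_prop) (hM.im hL)) (by fun_prop) (fun v v' => by
      rw [← mul_sub, norm_mul, norm_I, one_mul])

lemma norm_rhLog_le (hB : ∀ x, ‖L x‖ ≤ B) : ∀ z ∈ closedBall (0 : ℂ) 1,
    ‖rhLog L z‖ ≤ 5 * B ^ 2 + 2 * M + weightSum := fun z hz => by
  have := norm_schwarz_le (by fun_prop) (hM.im hL) (fun x => (abs_im_le_norm _).trans (hB x)) z hz
  rwa [rhLog, norm_mul, norm_I, one_mul]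

lemma continuous_rhWeight : Continuous (rhWeight L) := by
  have := Complex.continuous_re.comp (holDisk_rhLog hL hM).continuous_circ
  exact Real.continuous_exp.comp (this.sub (Complex.continuous_re.comp hL))

lemma exp_eq_rhWeight (x : UnitAddCircle) :
    Complex.exp (rhLog L (circ x)) = rhWeight L x * Complex.exp (L x) := by
  rw [rhWeight, ofReal_exp, ← Complex.exp_add]
  congr 1
  apply Complex.ext <;> simp [rhLog_circ_im hL hM]

lemma abs_log_rhWeight_le (hB : ∀ x, ‖L x‖ ≤ B) (x : UnitAddCircle) :
    |(rhLog L (circ x)).re - (L x).re| ≤ 5 * B ^ 2 + 2 * M + weightSum + B := by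
  have h1 := (abs_re_le_norm _).trans (norm_rhLog_le hL hM hB _ (circ_mem_closedBall x))
  have h2 := (abs_re_le_norm _).trans (hB x)
  exact (abs_sub _ _).trans (add_le_add h1 h2)

lemma energyLE_rhWeight (hB : ∀ x, ‖L x‖ ≤ B) : EnergyLE (rhWeight L)
    (Real.exp (5 * B ^ 2 + 2 * M + weightSum + B) ^ 2 * (20 * M)) := by
  have hc := (holDisk_rhLog hL hM).continuous_circ
  have hr : Continuous fun x => (L x).re := by fun_prop
  have hcr : Continuous fun x => (rhLog L (circ x)).re := Complex.continuous_re.comp hc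
  have h1 := ((energyLE_rhLog hL hM).re hc).sub hcr hr (hM.re hL)
  have h2 := h1.exp (hcr.sub hr) (abs_log_rhWeight_le hL hM hB)
  exact h2.mono (le_of_eq (by ring))

lemma rhWeight_le (hB : ∀ x, ‖L x‖ ≤ B) (x : UnitAddCircle) :
    rhWeight L x ≤ Real.exp (5 * B ^ 2 + 2 * M + weightSum + B) :=
  Real.exp_le_exp.2 ((le_abs_self _).trans (abs_log_rhWeight_le hL hM hB x))

variable (hb : Continuous b) (hMb : EnergyLE b Mb)
include hb hMb

lemma exists_energyLE_mul_rhWeight :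
    ∃ M', Continuous (fun x => b x * rhWeight L x) ∧ EnergyLE (fun x => b x * rhWeight L x) M' := by
  have hw := continuous_rhWeight hL hM
  obtain ⟨B, hB⟩ := (isCompact_range hL).isBounded.exists_norm_le
  obtain ⟨Bb, hBb⟩ := (isCompact_range hb).isBounded.exists_norm_le
  obtain ⟨Bw, hBw⟩ := (isCompact_range hw).isBounded.exists_norm_le
  exact ⟨_, by fun_prop, hMb.mul hb hw (energyLE_rhWeight hL hM fun x => hB _ ⟨x, rfl⟩)
    (fun x => hBb _ ⟨x, rfl⟩) (fun x => hBw _ ⟨x, rfl⟩)⟩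

lemma holDisk_rhSol : HolDisk (rhSol L b) := by
  obtain ⟨M', h1, h2⟩ := exists_energyLE_mul_rhWeight hL hM hb hMb
  exact holDisk_schwarz h1 h2

lemma rhSol_re (x : UnitAddCircle) : (rhSol L b (circ x)).re = b x * rhWeight L x := by
  obtain ⟨M', h1, h2⟩ := exists_energyLE_mul_rhWeight hL hM hb hMb
  exact schwarz_re h1 h2 x

/-- Solutions of the linear Riemann-Hilbert problem `Re (exp L * D) = β * b`. -/
lemma riemannHilbert {D : ℂ → ℂ} (hD : HolDisk D) {β : ℝ}
    (h : ∀ x, (Complex.exp (L x) * D (circ x)).re = β * b x) :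
    ∃ c : ℝ, ∀ z ∈ closedBall (0 : ℂ) 1,
      Complex.exp (rhLog L z) * D z = β * rhSol L b z + c * I := by
  obtain ⟨c, hc⟩ := (((holDisk_rhLog hL hM).exp.mul hD).sub
    ((holDisk_rhSol hL hM hb hMb).const_mul β)).eq_im_const (fun x => by
      rw [exp_eq_rhWeight hL hM, sub_re, re_ofReal_mul, rhSol_re hL hM hb hMb, mul_assoc,
        re_ofReal_mul, h]
      ring)
  exact ⟨c, fun z hz => by linear_combination hc z hz⟩

end

lemma rhSol_zero_im (L : UnitAddCircle → ℂ) (b : UnitAddCircle → ℝ) : (rhSol L b 0).im = 0 := by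
  rw [rhSol, schwarz_zero, ofReal_im]

lemma rhLog_zero (L : UnitAddCircle → ℂ) :
    rhLog L 0 = ((∫ x, (L x).im ∂haarAddCircle : ℝ) : ℂ) * I := by
  rw [rhLog, schwarz_zero, mul_comm]

/-- A priori bounds for the solutions of the linear Riemann-Hilbert problem. -/
lemma exists_riemannHilbert_bound (B M Bb Mb : ℝ) : ∃ C : ℝ, 0 < C ∧
    ∀ (L : UnitAddCircle → ℂ) (b : UnitAddCircle → ℝ), Continuous L → EnergyLE L M →
      (∀ x, ‖L x‖ ≤ B) → Continuous b → EnergyLE b Mb → (∀ x, |b x| ≤ Bb) →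
      EnergyLE (fun x => rhLog L (circ x)) C ∧ EnergyLE (fun x => rhSol L b (circ x)) C ∧
      ∀ z ∈ closedBall (0 : ℂ) 1, ‖rhLog L z‖ ≤ C ∧ ‖rhSol L b z‖ ≤ C := by
  set B₁ := 5 * B ^ 2 + 2 * M + weightSum
  set W := Real.exp (B₁ + B)
  set M' := (Bb + W) ^ 2 * (Mb + W ^ 2 * (20 * M))
  set C₂ := 5 * (Bb * W) ^ 2 + 2 * M' + weightSum
  refine ⟨|4 * M| + |4 * M'| + |B₁| + |C₂| + 1, by positivity, fun L b hL hM hB hb hMb hBb => ?_⟩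
  have hw := continuous_rhWeight hL hM
  have hwb : ∀ x, ‖rhWeight L x‖ ≤ W := fun x => by
    rw [Real.norm_of_nonneg (rhWeight_pos L x).le]; exact rhWeight_le hL hM hB x
  have h1 : EnergyLE (fun x => b x * rhWeight L x) M' :=
    hMb.mul hb hw (energyLE_rhWeight hL hM hB) hBb hwb
  have h2 : ∀ x, |b x * rhWeight L x| ≤ Bb * W := fun x => by
    rw [abs_mul]
    have := (abs_nonneg _).trans (hBb x)
    gcongr
    exacts [hBb x, hwb x]
  refine ⟨(energyLE_rhLog hL hM).mono ?_, (energyLE_schwarz (by fun_prop) h1).mono ?_,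
    fun z hz => ⟨(norm_rhLog_le hL hM hB z hz).trans ?_,
      (norm_schwarz_le (by fun_prop) h1 h2 z hz).trans ?_⟩⟩
  · linarith [le_abs_self (4 * M), abs_nonneg (4 * M'), abs_nonneg B₁, abs_nonneg C₂]
  · linarith [abs_nonneg (4 * M), le_abs_self (4 * M'), abs_nonneg B₁, abs_nonneg C₂]
  · linarith [abs_nonneg (4 * M), abs_nonneg (4 * M'), le_abs_self B₁, abs_nonneg C₂]
  · linarith [abs_nonneg (4 * M), abs_nonneg (4 * M'), abs_nonneg B₁, le_abs_self C₂]

end RiemannHilbert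

section Lipschitz

variable {E : Type*} [NormedAddCommGroup E] [NormedSpace ℝ E]

lemma periodic_apply_int {X : Type*} {f : ℝ × ℂ → X} (hf : ∀ x w, f (x + 1, w) = f (x, w))
    (n : ℤ) (x : ℝ) (w : ℂ) : f (x + n, w) = f (x, w) := by
  have h : Function.Periodic (fun x => f (x, w)) 1 := fun x => hf x w
  simpa using h.int_mul n x

omit [NormedSpace ℝ E] in
lemma exists_bound_of_periodic {f : ℝ × ℂ → E} (hc : Continuous f)
    (hf : ∀ x w, f (x + 1, w) = f (x, w)) (R : ℝ) :
    ∃ K : ℝ, 0 < K ∧ ∀ p : ℝ × ℂ, ‖p.2‖ ≤ R → ‖f p‖ ≤ K := by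
  obtain ⟨K, hK⟩ := ((isCompact_Icc (a := (0 : ℝ)) (b := 1)).prod
    (isCompact_closedBall (0 : ℂ) R)).exists_bound_of_continuousOn hc.continuousOn
  refine ⟨|K| + 1, by positivity, fun p hp => ?_⟩
  have h1 : f p = f (Int.fract p.1, p.2) := by
    rw [← periodic_apply_int hf ⌊p.1⌋ (Int.fract p.1) p.2, Int.fract_add_floor]
  rw [h1]
  refine (hK _ ⟨⟨Int.fract_nonneg _, (Int.fract_lt_one _).le⟩, by simpa using hp⟩).trans ?_
  linarith [le_abs_self K]

lemma fderiv_periodic {f : ℝ × ℂ → E} (hf : ∀ x w, f (x + 1, w) = f (x, w)) (x : ℝ) (w : ℂ) :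
    fderiv ℝ f (x + 1, w) = fderiv ℝ f (x, w) := by
  have h : (fun p : ℝ × ℂ => f (p + (1, 0))) = f := by
    ext ⟨x, w⟩; simpa using hf x w
  have h2 := fderiv_comp_add_right (𝕜 := ℝ) (f := f) (x := (x, w)) ((1 : ℝ), (0 : ℂ))
  rw [h] at h2
  simpa using h2.symm

lemma norm_image_sub_le_of_strip {f : ℝ × ℂ → E} (hd : Differentiable ℝ f) {R K : ℝ}
    (hK : ∀ p : ℝ × ℂ, ‖p.2‖ ≤ R → ‖fderiv ℝ f p‖ ≤ K) {p q : ℝ × ℂ} (hp : ‖p.2‖ ≤ R)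
    (hq : ‖q.2‖ ≤ R) : ‖f p - f q‖ ≤ K * ‖p - q‖ :=
  ((convex_univ (𝕜 := ℝ) (E := ℝ)).prod (convex_closedBall (0 : ℂ) R)
    ).norm_image_sub_le_of_norm_fderiv_le (fun x _ => hd x) (fun x hx => hK x (by simpa using hx.2))
    ⟨mem_univ _, by simpa using hq⟩ ⟨mem_univ _, by simpa using hp⟩

lemma exists_lipschitz_of_periodic {f : ℝ × ℂ → E} (hc : ContDiff ℝ 1 f)
    (hf : ∀ x w, f (x + 1, w) = f (x, w)) (R : ℝ) :
    ∃ K : ℝ, 0 < K ∧ ∀ p q : ℝ × ℂ, ‖p.2‖ ≤ R → ‖q.2‖ ≤ R → ‖f p - f q‖ ≤ K * ‖p - q‖ := by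
  obtain ⟨K, hK0, hK⟩ := exists_bound_of_periodic (hc.continuous_fderiv one_ne_zero)
    (fderiv_periodic hf) R
  exact ⟨K, hK0, fun p q hp hq =>
    norm_image_sub_le_of_strip (hc.differentiable one_ne_zero) hK hp hq⟩

end Lipschitz

lemma norm_prod_le (s : ℝ) (v : ℂ) : ‖(s, v)‖ ≤ |s| + ‖v‖ := by
  rw [Prod.norm_mk, Real.norm_eq_abs]
  exact max_le (by linarith [norm_nonneg v]) (by linarith [abs_nonneg s])

section DefiningFunction

variable {F : ℂ → ℂ → ℝ}

/-- The defining function in the coordinate `x` with `λ = exp (2 π i x)`. -/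
def liftFun (F : ℂ → ℂ → ℝ) : ℝ × ℂ → ℝ := fun p => F (circ (p.1 : UnitAddCircle)) p.2

/-- Twice the Wirtinger derivative of the defining function along the fiber over `circ x`. -/
def grad (F : ℂ → ℂ → ℝ) (x : UnitAddCircle) (w : ℂ) : ℂ := 2 * wirt (F (circ x)) w

lemma liftFun_periodic (x : ℝ) (w : ℂ) : liftFun F (x + 1, w) = liftFun F (x, w) := by
  simp only [liftFun]
  congr 2
  exact AddCircle.coe_add_period 1 x

variable (hF : IsSmoothTorusFamily F)
include hF

lemma contDiff_liftFun : ContDiff ℝ (⊤ : ℕ∞) (liftFun F) := by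
  have h : ContDiff ℝ (⊤ : ℕ∞) fun p : ℝ × ℂ => (circ (p.1 : UnitAddCircle), p.2) := by
    simp only [circ_coe]
    have : ContDiff ℝ (⊤ : ℕ∞) fun p : ℝ × ℂ => (p.1 : ℂ) :=
      ofRealCLM.contDiff.comp contDiff_fst
    have h2 : ContDiff ℝ (⊤ : ℕ∞) fun p : ℝ × ℂ => 2 * Real.pi * (p.1 : ℂ) * I := by fun_prop
    exact h2.cexp.prodMk contDiff_snd
  exact hF.1.comp_contDiff h fun p => ⟨circ_mem _, mem_univ _⟩

lemma contDiff_slice (x : UnitAddCircle) : ContDiff ℝ (⊤ : ℕ∞) (F (circ x)) := hF.2.1 _ (circ_mem x)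

lemma fderiv_slice (x : ℝ) (w v : ℂ) :
    fderiv ℝ (F (circ (x : UnitAddCircle))) w v = fderiv ℝ (liftFun F) (x, w) (0, v) := by
  have h1 : HasFDerivAt (fun w : ℂ => (x, w)) (ContinuousLinearMap.inr ℝ ℝ ℂ) w :=
    hasFDerivAt_prodMk_right x w
  have h2 := (((contDiff_liftFun hF).differentiable (by simp)).differentiableAt
    (x := (x, w))).hasFDerivAt.comp w h1
  have h3 : (liftFun F ∘ fun w : ℂ => (x, w)) = F (circ (x : UnitAddCircle)) := rfl
  rw [h3] at h2
  rw [h2.fderiv]; simp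

omit hF in
lemma fderiv_eq_re_grad (x : UnitAddCircle) (w v : ℂ) :
    fderiv ℝ (F (circ x)) w v = (grad F x w * v).re := by
  have h : v = v.re • (1 : ℂ) + v.im • I := by
    simp [Complex.re_add_im]
  conv_lhs => rw [h]
  rw [map_add, map_smul, map_smul]
  simp [grad, wirt]
  ring

lemma hasFDerivAt_slice (x : UnitAddCircle) (w : ℂ) :
    HasFDerivAt (F (circ x)) (fderiv ℝ (F (circ x)) w) w :=
  ((contDiff_slice hF x).differentiable (by simp)).differentiableAt.hasFDerivAt

lemma grad_ne_zero (x : UnitAddCircle) {w : ℂ} (hw : w ≠ 0) : grad F x w ≠ 0 :=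
  mul_ne_zero two_ne_zero (hF.2.2.2.2.1 _ (circ_mem x) w hw)

/-- The defining function and its fiber gradient are Lipschitz on bounded sets, and so are the
difference quotients of the defining function along the circle. -/
lemma exists_lipschitz (R : ℝ) : ∃ K : ℝ, 0 < K ∧ ∀ (x : UnitAddCircle) (s : ℝ) (w w' : ℂ),
    ‖w‖ ≤ R → ‖w'‖ ≤ R →
    |F (circ (x + s)) w - F (circ x) w'| ≤ K * (|s| + ‖w - w'‖) ∧
    ‖grad F (x + s) w - grad F x w'‖ ≤ K * (|s| + ‖w - w'‖) ∧
    ∀ σ : ℝ, |(F (circ (x + σ + s)) w - F (circ (x + s)) w) -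
      (F (circ (x + σ)) w' - F (circ x) w')| ≤ K * |σ| * (|s| + ‖w - w'‖) := by
  have hΦ := contDiff_liftFun hF
  have hD : ContDiff ℝ 1 (fderiv ℝ (liftFun F)) := hΦ.fderiv_right (by norm_cast)
  obtain ⟨K₁, hK₁0, hK₁⟩ := exists_lipschitz_of_periodic (hΦ.of_le (by norm_cast))
    liftFun_periodic R
  obtain ⟨K₂, hK₂0, hK₂⟩ := exists_lipschitz_of_periodic hD (fderiv_periodic liftFun_periodic) R
  have hd : Differentiable ℝ (liftFun F) := hΦ.differentiable (by simp)
  refine ⟨K₁ + 2 * K₂, by positivity, fun x s w w' hw hw' => ?_⟩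
  obtain ⟨x, rfl⟩ := QuotientAddGroup.mk_surjective x
  have hn := norm_prod_le s (w - w')
  have e : ((x + s, w) : ℝ × ℂ) - (x, w') = (s, w - w') := by simp
  refine ⟨?_, ?_, fun σ => ?_⟩
  · have := hK₁ (x + s, w) (x, w') hw hw'
    rw [e, Real.norm_eq_abs] at this
    refine this.trans ?_
    gcongr
    linarith
  · have h := hK₂ (x + s, w) (x, w') hw hw'
    rw [e] at h
    have e2 : ∀ (y : ℝ) (z : ℂ), grad F (y : UnitAddCircle) z =
        fderiv ℝ (liftFun F) (y, z) (0, 1) - I * fderiv ℝ (liftFun F) (y, z) (0, I) := fun y z => by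
      rw [grad, wirt, fderiv_slice hF, fderiv_slice hF]; ring
    have hb : ∀ v : ℂ, ‖v‖ = 1 → ‖((fderiv ℝ (liftFun F) (x + s, w) (0, v) -
        fderiv ℝ (liftFun F) (x, w') (0, v) : ℝ) : ℂ)‖ ≤ K₂ * (|s| + ‖w - w'‖) := fun v hv => by
      rw [norm_real, ← sub_apply]
      refine (ContinuousLinearMap.le_opNorm _ _).trans ?_
      rw [Prod.norm_mk, hv]
      simp only [norm_zero, zero_le_one, sup_of_le_right, mul_one]
      exact h.trans (by gcongr)
    change ‖grad F ((x + s : ℝ) : UnitAddCircle) w - grad F (x : UnitAddCircle) w'‖ ≤ _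
    rw [e2, e2]
    have h1 := hb 1 (by simp)
    have h2 := hb I (by simp)
    have := norm_sub_le ((fderiv ℝ (liftFun F) (x + s, w) (0, 1) -
      fderiv ℝ (liftFun F) (x, w') (0, 1) : ℝ) : ℂ) (I * ((fderiv ℝ (liftFun F) (x + s, w) (0, I) -
        fderiv ℝ (liftFun F) (x, w') (0, I) : ℝ) : ℂ))
    rw [norm_mul, norm_I, one_mul] at this
    have h3 : 0 ≤ K₁ * (|s| + ‖w - w'‖) := by positivity
    refine le_trans (le_of_eq ?_) (this.trans (by linarith))
    congr 1; push_cast; ring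
  · have h := norm_image_sub_le_of_strip (f := fun p => liftFun F (p + (σ, 0)) - liftFun F p)
      (R := R) (K := K₂ * |σ|) (p := (x + s, w)) (q := (x, w')) (by fun_prop) (fun p hp => by
        rw [fderiv_fun_sub (by fun_prop) (by fun_prop), fderiv_comp_add_right]
        have := hK₂ (p + (σ, 0)) p (by simpa using hp) hp
        simpa [Prod.norm_mk] using this) hw hw'
    rw [e, Real.norm_eq_abs] at h
    have e3 : (x + s, w) + (σ, 0) = (x + σ + s, w) := by ext1 <;> simp; ring
    have e4 : (x, w') + (σ, 0) = (x + σ, w') := by simp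
    rw [e3, e4] at h
    refine h.trans ?_
    gcongr
    linarith

omit hF in
lemma exists_real_eq_add (x y : UnitAddCircle) : ∃ s : ℝ, y = x + (s : UnitAddCircle) ∧
    |s| = ‖y - x‖ := by
  obtain ⟨t, ht⟩ := QuotientAddGroup.mk_surjective (y - x)
  have h1 : ((t - round t : ℝ) : UnitAddCircle) = y - x := by
    rw [← ht]
    have h : ((round t : ℝ) : UnitAddCircle) = 0 :=
      (AddCircle.coe_eq_zero_iff 1).2 ⟨round t, by simp⟩
    rw [AddCircle.coe_sub, h, sub_zero]
  refine ⟨t - round t, by rw [h1]; abel, ?_⟩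
  rw [← ht]
  exact UnitAddCircle.norm_eq.symm

omit hF in
lemma continuous_of_lipschitz {X : Type*} [NormedAddCommGroup X] {f : UnitAddCircle → ℂ → X}
    (hf : ∀ R : ℝ, ∃ K : ℝ, ∀ (x : UnitAddCircle) (s : ℝ) (w w' : ℂ), ‖w‖ ≤ R → ‖w'‖ ≤ R →
      ‖f (x + s) w - f x w'‖ ≤ K * (|s| + ‖w - w'‖)) :
    Continuous fun p : UnitAddCircle × ℂ => f p.1 p.2 := by
  rw [continuous_iff_continuousAt]
  rintro ⟨x, w⟩
  obtain ⟨K, hK⟩ := hf (‖w‖ + 1)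
  rw [ContinuousAt, tendsto_iff_norm_sub_tendsto_zero]
  refine squeeze_zero' (g := fun p : UnitAddCircle × ℂ => K * (‖p.1 - x‖ + ‖p.2 - w‖))
    (Eventually.of_forall fun _ => norm_nonneg _) ?_ ?_
  · have h1 : ∀ᶠ p : UnitAddCircle × ℂ in 𝓝 (x, w), ‖p.2‖ < ‖w‖ + 1 :=
      (by fun_prop : Continuous fun p : UnitAddCircle × ℂ => ‖p.2‖).continuousAt.eventually
        (gt_mem_nhds (by simp))
    filter_upwards [h1] with p hp
    obtain ⟨s, hs, hs'⟩ := exists_real_eq_add x p.1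
    rw [← hs', hs]
    exact hK x s p.2 w hp.le (by linarith)
  · have : Continuous fun p : UnitAddCircle × ℂ => K * (‖p.1 - x‖ + ‖p.2 - w‖) := by fun_prop
    simpa using this.tendsto (x, w)

lemma continuous_slice : Continuous fun p : UnitAddCircle × ℂ => F (circ p.1) p.2 :=
  continuous_of_lipschitz (f := fun x w => F (circ x) w) fun R => by
    obtain ⟨K, -, hK⟩ := exists_lipschitz hF R
    exact ⟨K, fun x s w w' hw hw' => (hK x s w w' hw hw').1⟩

lemma continuous_grad : Continuous fun p : UnitAddCircle × ℂ => grad F p.1 p.2 :=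
  continuous_of_lipschitz (f := grad F) fun R => by
    obtain ⟨K, -, hK⟩ := exists_lipschitz hF R
    exact ⟨K, fun x s w w' hw hw' => (hK x s w w' hw hw').2.1⟩

/-- The average of the fiber gradient along a segment. -/
def avgGrad (F : ℂ → ℂ → ℝ) (x : UnitAddCircle) (w w' : ℂ) : ℂ :=
  ∫ σ in (0 : ℝ)..1, grad F x (w' + σ * (w - w'))

omit hF in
lemma avgGrad_self (x : UnitAddCircle) (w : ℂ) : avgGrad F x w w = grad F x w := by
  simp [avgGrad]

lemma slice_sub_eq (x : UnitAddCircle) (w w' : ℂ) :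
    F (circ x) w - F (circ x) w' = (avgGrad F x w w' * (w - w')).re := by
  have hg := continuous_grad hF
  have h1 : ∀ σ : ℝ, HasDerivAt (fun σ : ℝ => F (circ x) (w' + σ * (w - w')))
      (grad F x (w' + σ * (w - w')) * (w - w')).re σ := fun σ => by
    have h := (hasFDerivAt_slice hF x (w' + σ * (w - w'))).comp_hasDerivAt σ
      (((hasDerivAt_id σ).ofReal_comp.mul_const (w - w')).const_add w')
    rw [fderiv_eq_re_grad, ofReal_one, one_mul] at h
    exact h
  have h3 : Continuous fun σ : ℝ => grad F x (w' + σ * (w - w')) := by fun_prop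
  have h5 : Continuous fun σ : ℝ => (grad F x (w' + σ * (w - w')) * (w - w')).re :=
    Complex.continuous_re.comp (h3.mul continuous_const)
  have h2 := intervalIntegral.integral_eq_sub_of_hasDerivAt (a := 0) (b := 1)
    (fun σ _ => h1 σ) (h5.intervalIntegrable _ _)
  rw [avgGrad, ← intervalIntegral.integral_mul_const]
  have h4 := Complex.reCLM.intervalIntegral_comp_comm
    (μ := volume) (a := 0) (b := 1)
    ((h3.mul (continuous_const (y := w - w'))).intervalIntegrable _ _)
  simp only [reCLM_apply, Pi.mul_apply] at h4
  rw [← h4, h2]; simp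

lemma avgGrad_lipschitz {R K : ℝ} (hK : ∀ (x : UnitAddCircle) (s : ℝ) (w w' : ℂ),
    ‖w‖ ≤ R → ‖w'‖ ≤ R → ‖grad F (x + s) w - grad F x w'‖ ≤ K * (|s| + ‖w - w'‖)) (hK0 : 0 ≤ K)
    (x : UnitAddCircle) (s : ℝ) {w w' v v' : ℂ} (hw : ‖w‖ ≤ R) (hw' : ‖w'‖ ≤ R) (hv : ‖v‖ ≤ R)
    (hv' : ‖v'‖ ≤ R) :
    ‖avgGrad F (x + s) w w' - avgGrad F x v v'‖ ≤ K * (|s| + (‖w - v‖ + ‖w' - v'‖)) := by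
  have hg := continuous_grad hF
  have h3 : ∀ (y : UnitAddCircle) (a b : ℂ),
      Continuous fun σ : ℝ => grad F y (b + σ * (a - b)) := by intros; fun_prop
  rw [avgGrad, avgGrad, ← intervalIntegral.integral_sub ((h3 _ _ _).intervalIntegrable _ _)
    ((h3 _ _ _).intervalIntegrable _ _)]
  refine (intervalIntegral.norm_integral_le_of_norm_le_const
    (C := K * (|s| + (‖w - v‖ + ‖w' - v'‖))) fun σ hσ => ?_).trans (le_of_eq (by simp))
  rw [uIoc_of_le zero_le_one] at hσ
  have hseg : ∀ a b : ℂ, ‖a‖ ≤ R → ‖b‖ ≤ R → ‖b + σ * (a - b)‖ ≤ R := fun a b ha hb => by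
    have := (convex_closedBall (0 : ℂ) R) (x := b) (by simpa using hb) (y := a)
      (by simpa using ha) (a := 1 - σ) (b := σ) (by linarith [hσ.2]) hσ.1.le (by ring)
    have e : b + σ * (a - b) = (1 - σ) • b + σ • a := by
      simp only [real_smul]; push_cast; ring
    rw [e]; simpa using this
  refine (hK x s _ _ (hseg w w' hw hw') (hseg v v' hv hv')).trans ?_
  gcongr
  have e : w' + σ * (w - w') - (v' + σ * (v - v')) =
      (σ : ℂ) * (w - v) + ((1 - σ : ℝ) : ℂ) * (w' - v') := by
    push_cast; ring
  rw [e]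
  refine (norm_add_le _ _).trans ?_
  rw [norm_mul, norm_mul, norm_real, norm_real, Real.norm_of_nonneg hσ.1.le,
    Real.norm_of_nonneg (by linarith [hσ.2])]
  gcongr
  · exact mul_le_of_le_one_left (norm_nonneg _) hσ.2
  · exact mul_le_of_le_one_left (norm_nonneg _) (by linarith [hσ.1])

end DefiningFunction

section Logarithm

lemma exists_log_of_homotopy {X : Type*} [TopologicalSpace X] {H : ℝ → X → ℂ} {c : ℂ}
    (hH : ContinuousOn (fun p : ℝ × X => H p.1 p.2) (Icc 0 1 ×ˢ univ))
    (h0 : ∀ τ ∈ Icc (0 : ℝ) 1, ∀ x, H τ x ≠ 0) (hc : ∀ x, H 0 x = c) :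
    ∃ L : X → ℂ, Continuous L ∧ ∀ x, Complex.exp (L x) = H 1 x := by
  have hcont : Continuous fun p : unitInterval × X => H p.1 p.2 :=
    hH.comp_continuous (f := fun p : unitInterval × X => ((p.1 : ℝ), p.2)) (by fun_prop)
      fun p => ⟨p.1.2, mem_univ _⟩
  let H' : C(unitInterval × X, {z : ℂ // z ≠ 0}) :=
    ⟨fun p => ⟨H p.1 p.2, h0 _ p.1.2 _⟩, hcont.subtype_mk _⟩
  have hz : ∀ x, H' (0, x) = (fun z : ℂ ↦ (⟨_, z.exp_ne_zero⟩ : {z : ℂ // z ≠ 0}))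
      (ContinuousMap.const X (Complex.log c) x) := fun x => by
    have hc0 : c ≠ 0 := hc x ▸ h0 0 (by simp) x
    ext
    simp [H', hc, Complex.exp_log hc0]
  refine ⟨fun x => Complex.isCoveringMap_exp.liftHomotopy H' _ hz (1, x), by fun_prop, fun x => ?_⟩
  have := congrFun (Complex.isCoveringMap_exp.liftHomotopy_lifts H' _ hz) (1, x)
  exact congrArg Subtype.val this

lemma norm_sub_le_two_mul_norm_exp_sub_one {z : ℂ} (hz : ‖z‖ ≤ 1 / 2) :
    ‖z‖ ≤ 4 * ‖Complex.exp z - 1‖ := by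
  have h := Complex.norm_exp_sub_one_sub_id_le (hz.trans (by norm_num))
  have h2 := norm_sub_norm_le z (z - (Complex.exp z - 1))
  have h3 : ‖z - (Complex.exp z - 1)‖ = ‖Complex.exp z - 1 - z‖ := by rw [← norm_neg]; ring_nf
  have h4 : ‖z‖ ^ 2 ≤ 1 / 2 * ‖z‖ := by nlinarith [norm_nonneg z]
  have h5 : z - (z - (Complex.exp z - 1)) = Complex.exp z - 1 := by ring
  rw [h5] at h2
  linarith [norm_nonneg z]

/-- A continuous logarithm of a finite energy function has finite energy. -/
lemma exists_energyLE_log {L : UnitAddCircle → ℂ} (hL : Continuous L) {M : ℝ}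
    (h : EnergyLE (fun x => Complex.exp (L x)) M) : ∃ M' : ℝ, EnergyLE L M' := by
  obtain ⟨B, hB⟩ := isCompact_univ.exists_bound_of_continuousOn hL.continuousOn
  have hB0 : 0 ≤ B := (norm_nonneg _).trans (hB 0 (mem_univ _))
  obtain ⟨d, hd, hdL⟩ := Metric.uniformContinuous_iff.1
    (CompactSpace.uniformContinuous_of_continuous hL) (1 / 2) (by norm_num)
  have hn : ∀ s : ℝ, ‖(s : UnitAddCircle)‖ ≤ |s| := fun s => by
    rw [UnitAddCircle.norm_eq]; simpa using round_le s 0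
  refine ⟨(4 * Real.exp B) ^ 2 * M + (2 * B / d) ^ 2, EnergyLE.of_dominated hL
    (by fun_prop) h (by positivity) fun x s => ?_⟩
  rcases lt_or_ge |s| d with hs | hs
  · have h1 : ‖L (x + s) - L x‖ < 1 / 2 := by
      rw [← dist_eq_norm]
      exact hdL (by rw [dist_eq_norm]; simpa using (hn s).trans_lt hs)
    have h2 := norm_sub_le_two_mul_norm_exp_sub_one h1.le
    have h3 : Complex.exp (L (x + s) - L x) - 1 =
        Complex.exp (-L x) * (Complex.exp (L (x + s)) - Complex.exp (L x)) := by
      rw [Complex.exp_neg, Complex.exp_sub]; field_simp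
    rw [h3, norm_mul] at h2
    have h4 : ‖Complex.exp (-L x)‖ ≤ Real.exp B := by
      refine (Complex.norm_exp_le_exp_norm _).trans (Real.exp_le_exp.2 ?_)
      rw [norm_neg]; exact hB x (mem_univ _)
    have h5 : ‖L (x + s) - L x‖ ≤
        4 * Real.exp B * ‖Complex.exp (L (x + s)) - Complex.exp (L x)‖ := by
      refine h2.trans ?_
      rw [mul_assoc]; gcongr
    have h6 := pow_le_pow_left₀ (norm_nonneg _) h5 2
    rw [mul_pow _ ‖_‖] at h6
    nlinarith [sq_nonneg (2 * B / d * s)]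
  · have h1 : ‖L (x + s) - L x‖ ≤ 2 * B := (norm_sub_le _ _).trans
      (by linarith [hB (x + s) (mem_univ _), hB x (mem_univ _)])
    have h2 : 2 * B ≤ 2 * B / d * |s| := by
      rw [div_mul_eq_mul_div, le_div_iff₀ hd]; gcongr
    have h3 := pow_le_pow_left₀ (norm_nonneg _) (h1.trans h2) 2
    rw [mul_pow, sq_abs] at h3
    have : 0 ≤ (4 * Real.exp B) ^ 2 * ‖Complex.exp (L (x + s)) - Complex.exp (L x)‖ ^ 2 := by
      positivity
    linarith

end Logarithm

section LogGrad

variable {F : ℂ → ℂ → ℝ} (hF : IsSmoothTorusFamily F)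
include hF

lemma exists_grad_eq_conj : ∃ ε : ℝ, 0 < ε ∧ ∀ x w, Complex.normSq w < ε →
    grad F x w = 2 * (starRingEnd ℂ) w := by
  obtain ⟨ε, hε, h⟩ := hF.2.2.1
  refine ⟨ε, hε, fun x w hw => ?_⟩
  have h1 : F (circ x) =ᶠ[𝓝 w] Complex.normSq := by
    have : ∀ᶠ v in 𝓝 w, Complex.normSq v < ε :=
      Complex.continuous_normSq.continuousAt.eventually (gt_mem_nhds hw)
    filter_upwards [this] with v hv using h _ (circ_mem x) v hv
  have h2 : ∀ v : ℂ, fderiv ℝ Complex.normSq w v = 2 * (w.re * v.re + w.im * v.im) := fun v => by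
    have e : HasFDerivAt Complex.normSq (w.re • reCLM + w.re • reCLM + (w.im • imCLM + w.im • imCLM)) w := by
      have hr : HasFDerivAt (fun z : ℂ => z.re) reCLM w := reCLM.hasFDerivAt
      have hi : HasFDerivAt (fun z : ℂ => z.im) imCLM w := imCLM.hasFDerivAt
      exact (hr.mul hr).add (hi.mul hi)
    rw [e.fderiv]; simp; ring
  rw [grad, wirt, h1.fderiv_eq, h2, h2]
  apply Complex.ext
  · simp
  · simp; ring

lemma exists_log_grad {g : ℂ → ℂ} (hg : HolDisk g) (h0 : ∀ z ∈ closedBall (0 : ℂ) 1, g z ≠ 0) :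
    ∃ L : UnitAddCircle → ℂ, Continuous L ∧ ∀ x, Complex.exp (L x) = grad F x (g (circ x)) := by
  obtain ⟨ε, hε, hgrad⟩ := exists_grad_eq_conj hF
  obtain ⟨σ, hσ, hσ1, hσε⟩ : ∃ σ : ℝ, 0 < σ ∧ σ ≤ 1 ∧ Complex.normSq (σ * g 0) < ε := by
    have h : Tendsto (fun σ : ℝ => Complex.normSq (σ * g 0)) (𝓝[>] 0) (𝓝 0) := by
      have : ContinuousAt (fun σ : ℝ => Complex.normSq (σ * g 0)) 0 :=
        (Complex.continuous_normSq.comp (by fun_prop : Continuous fun σ : ℝ => (σ : ℂ) * g 0)).continuousAt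
      have h := this.tendsto
      simp only [ofReal_zero, zero_mul, map_zero] at h
      exact h.mono_left nhdsWithin_le_nhds
    have := (h.eventually (gt_mem_nhds hε)).and (Ioc_mem_nhdsGT (zero_lt_one (α := ℝ)))
    obtain ⟨σ, h1, h2⟩ := this.exists
    exact ⟨σ, h2.1, h2.2, h1⟩
  have hmem : ∀ τ ∈ Icc (0 : ℝ) 1, ∀ x, (τ : ℂ) * circ x ∈ closedBall (0 : ℂ) 1 := fun τ hτ x => by
    simp [norm_circ, abs_of_nonneg hτ.1, hτ.2]
  have key := exists_log_of_homotopy (X := UnitAddCircle)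
    (H := fun τ x => grad F x (((σ + (1 - σ) * τ : ℝ) : ℂ) * g (τ * circ x)))
    (c := grad F 0 (σ * g 0)) ?_ ?_ ?_
  · obtain ⟨L, hL, h⟩ := key
    exact ⟨L, hL, fun x => by rw [h]; simp⟩
  · refine (continuous_grad hF).comp_continuousOn (f := fun p : ℝ × UnitAddCircle =>
      (p.2, ((σ + (1 - σ) * p.1 : ℝ) : ℂ) * g (p.1 * circ p.2))) ?_
    refine continuousOn_snd.prodMk (ContinuousOn.mul (by fun_prop) ?_)
    refine hg.1.comp (f := fun p : ℝ × UnitAddCircle => (p.1 : ℂ) * circ p.2) ?_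
      fun p hp => hmem _ hp.1 _
    exact ((continuous_ofReal.comp continuous_fst).mul
      (continuous_circ.comp continuous_snd)).continuousOn
  · intro τ hτ x
    refine grad_ne_zero hF x (mul_ne_zero ?_ (h0 _ (hmem _ hτ _)))
    have : 0 < σ + (1 - σ) * τ := by nlinarith [hτ.1, hτ.2, mul_nonneg (sub_nonneg.2 hσ1) hτ.1]
    exact_mod_cast this.ne'
  · intro x
    simp only [mul_zero, add_zero, ofReal_zero, zero_mul]
    rw [hgrad _ _ hσε, hgrad _ _ hσε]

lemma exists_energyLE_grad {k : UnitAddCircle → ℂ} (hk : Continuous k) {M : ℝ} (h : EnergyLE k M) :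
    ∃ M' : ℝ, EnergyLE (fun x => grad F x (k x)) M' := by
  obtain ⟨R, hR⟩ := isCompact_univ.exists_bound_of_continuousOn hk.continuousOn
  obtain ⟨K, hK0, hK⟩ := exists_lipschitz hF R
  have hg := continuous_grad hF
  exact ⟨_, h.comp (Ψ := fun x w => grad F x w) (S := {w | ‖w‖ ≤ R}) hk (by fun_prop)
    (fun x => hR x (mem_univ _)) fun x s w hw w' hw' => (hK x s w w' hw hw').2.1⟩

/-- Along a nonvanishing disk of finite energy the fiber gradient has a logarithm of finite
energy. -/
lemma exists_log_grad_energyLE {g : ℂ → ℂ} (hg : HolDisk g)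
    (h0 : ∀ z ∈ closedBall (0 : ℂ) 1, g z ≠ 0) {M : ℝ} (h : EnergyLE (fun x => g (circ x)) M) :
    ∃ (L : UnitAddCircle → ℂ) (M' : ℝ), Continuous L ∧ EnergyLE L M' ∧
      ∀ x, Complex.exp (L x) = grad F x (g (circ x)) := by
  obtain ⟨L, hL, hexp⟩ := exists_log_grad hF hg h0
  obtain ⟨M₁, hM₁⟩ := exists_energyLE_grad hF hg.continuous_circ h
  obtain ⟨M₂, hM₂⟩ := exists_energyLE_log hL (M := M₁) (by simpa only [hexp] using hM₁)
  exact ⟨L, M₂, hL, hM₂, hexp⟩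

end LogGrad

lemma EnergyLE.of_dominated₂ {E E' E'' : Type*} [NormedAddCommGroup E] [NormedAddCommGroup E']
    [NormedAddCommGroup E''] {f : UnitAddCircle → E} {g : UnitAddCircle → E'}
    {k : UnitAddCircle → E''} {M M' C₁ C₂ C₃ : ℝ}
    (hf : Continuous f) (hg : Continuous g) (hk : Continuous k) (h : EnergyLE g M)
    (h' : EnergyLE k M') (hC : 0 ≤ C₁) (hC' : 0 ≤ C₂)
    (hfg : ∀ (x : UnitAddCircle) (s : ℝ), ‖f (x + (s : UnitAddCircle)) - f x‖ ^ 2 ≤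
      C₁ * ‖g (x + (s : UnitAddCircle)) - g x‖ ^ 2 +
        C₂ * ‖k (x + (s : UnitAddCircle)) - k x‖ ^ 2 + C₃ * s ^ 2) :
    EnergyLE f (C₁ * M + C₂ * M' + C₃) := by
  intro s
  have h1 := integral_mono_of_continuous
    (f := fun x => ‖f (x + (s : UnitAddCircle)) - f x‖ ^ 2)
    (g := fun x => C₁ * ‖g (x + (s : UnitAddCircle)) - g x‖ ^ 2 +
      C₂ * ‖k (x + (s : UnitAddCircle)) - k x‖ ^ 2 + C₃ * s ^ 2)
    (by fun_prop) (by fun_prop) (fun x => hfg x s)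
  rw [integral_add (integrable_of_continuous (by fun_prop)) (integrable_of_continuous (by fun_prop)),
    integral_add (integrable_of_continuous (by fun_prop)) (integrable_of_continuous (by fun_prop)),
    integral_const_mul, integral_const_mul, integral_haar_const] at h1
  have h2 := mul_le_mul_of_nonneg_left (h s) hC
  have h3 := mul_le_mul_of_nonneg_left (h' s) hC'
  linarith

lemma EnergyLE.cexp {f : UnitAddCircle → ℂ} {M C : ℝ} (hf : Continuous f)
    (hC : ∀ x, ‖f x‖ ≤ C) (h : EnergyLE f M) :
    EnergyLE (fun x => Complex.exp (f x)) (Real.exp C ^ 2 * M) := by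
  refine h.lipschitz_comp (Ψ := Complex.exp) (S := closedBall 0 C) hf (by fun_prop)
    (fun x => by simpa using hC x) fun v hv v' hv' => ?_
  refine (convex_closedBall (0 : ℂ) C).norm_image_sub_le_of_norm_deriv_le (𝕜 := ℂ)
    (fun z _ => Complex.differentiable_exp.differentiableAt) (fun z hz => ?_) hv' hv
  rw [Complex.deriv_exp]
  exact (Complex.norm_exp_le_exp_norm z).trans (Real.exp_le_exp.2 (by simpa using hz))

/-- `k` is a holomorphic disk of finite energy whose boundary lies on the level `t` of `F`. -/
structure IsLevelDisk (F : ℂ → ℂ → ℝ) (t : ℝ) (k : ℂ → ℂ) : Prop where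
  hol : HolDisk k
  energy : ∃ M : ℝ, EnergyLE (fun x => k (circ x)) M
  level : ∀ x, F (circ x) (k (circ x)) = t

/-- A nonvanishing level disk together with a logarithm of the fiber gradient along it. -/
structure BaseDisk (F : ℂ → ℂ → ℝ) where
  g : ℂ → ℂ
  t : ℝ
  isLevelDisk : IsLevelDisk F t g
  ne_zero : ∀ z ∈ closedBall (0 : ℂ) 1, g z ≠ 0
  L : UnitAddCircle → ℂ
  continuous_L : Continuous L
  energyL : ℝ
  energyLE_L : EnergyLE L energyL
  exp_L : ∀ x, Complex.exp (L x) = grad F x (g (circ x))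

lemma exists_baseDisk {F : ℂ → ℂ → ℝ} (hF : IsSmoothTorusFamily F) {t : ℝ} {g : ℂ → ℂ}
    (hg : IsLevelDisk F t g) (h0 : ∀ z ∈ closedBall (0 : ℂ) 1, g z ≠ 0) :
    ∃ B : BaseDisk F, B.g = g ∧ B.t = t := by
  obtain ⟨M, hM⟩ := hg.energy
  obtain ⟨L, M', hL, hL', hexp⟩ := exists_log_grad_energyLE hF hg.hol h0 hM
  exact ⟨⟨g, t, hg, h0, L, hL, M', hL', hexp⟩, rfl, rfl⟩

namespace BaseDisk

variable {F : ℂ → ℂ → ℝ} (B : BaseDisk F)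

/-- The holomorphic integrating factor of the linearized problem. -/
def factor (z : ℂ) : ℂ := Complex.exp (rhLog B.L z)

/-- The inverse of the holomorphic integrating factor. -/
def invFactor (z : ℂ) : ℂ := Complex.exp (-rhLog B.L z)

lemma factor_mul_invFactor (z : ℂ) : B.factor z * B.invFactor z = 1 := by
  rw [factor, invFactor, ← Complex.exp_add]; simp

lemma invFactor_mul_factor (z : ℂ) : B.invFactor z * B.factor z = 1 := by
  rw [mul_comm, factor_mul_invFactor]

lemma holDisk_factor : HolDisk B.factor := (holDisk_rhLog B.continuous_L B.energyLE_L).exp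

lemma holDisk_invFactor : HolDisk B.invFactor :=
  (holDisk_rhLog B.continuous_L B.energyLE_L).neg.exp

lemma factor_circ (x : UnitAddCircle) :
    B.factor (circ x) = rhWeight B.L x * grad F x (B.g (circ x)) := by
  rw [factor, exp_eq_rhWeight B.continuous_L B.energyLE_L, B.exp_L]

/-- The coefficients of the boundary value problem in the coordinate `h = factor * (k - g)`. -/
def coeffs (x : UnitAddCircle) : ℂ × ℂ × ℝ := (B.g (circ x), B.invFactor (circ x), rhWeight B.L x)

/-- The nonlinear part of the boundary value problem in the coordinate `h = factor * (k - g)`. -/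
def resid (x : UnitAddCircle) (z : ℂ) : ℝ :=
  z.re - rhWeight B.L x * (F (circ x) (B.g (circ x) + B.invFactor (circ x) * z) - B.t)

/-- Quantitative bounds for the nonlinear boundary value problem around a base disk. -/
structure Bounds (C : ℝ) : Prop where
  one_le : 1 ≤ C
  energyLE_coeffs : EnergyLE B.coeffs C
  norm_coeffs_le : ∀ x, ‖B.coeffs x‖ ≤ C
  norm_factor_le : ∀ z ∈ closedBall (0 : ℂ) 1, ‖B.factor z‖ ≤ C
  norm_invFactor_le : ∀ z ∈ closedBall (0 : ℂ) 1, ‖B.invFactor z‖ ≤ C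
  resid_lipschitz : ∀ η ≤ 1, ∀ x z z', ‖z‖ ≤ η → ‖z'‖ ≤ η →
    |B.resid x z - B.resid x z'| ≤ C * η * ‖z - z'‖
  resid_translate : ∀ (x : UnitAddCircle) (s : ℝ) (z : ℂ), ‖z‖ ≤ 1 →
    |B.resid (x + s) z - B.resid x z| ≤ C * (|s| + ‖B.coeffs (x + s) - B.coeffs x‖)

lemma resid_zero (x : UnitAddCircle) : B.resid x 0 = 0 := by
  simp [resid, B.isLevelDisk.level]

lemma continuous_coeffs : Continuous B.coeffs :=
  B.isLevelDisk.hol.continuous_circ.prodMk (B.holDisk_invFactor.continuous_circ.prodMk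
    (continuous_rhWeight B.continuous_L B.energyLE_L))

lemma exists_energyLE_coeffs : ∃ M, EnergyLE B.coeffs M := by
  have hL := B.continuous_L
  have hM := B.energyLE_L
  have hc := (holDisk_rhLog hL hM).continuous_circ
  obtain ⟨C, hC⟩ := (isCompact_range hc).isBounded.exists_norm_le
  obtain ⟨C', hC'⟩ := (isCompact_range hL).isBounded.exists_norm_le
  obtain ⟨M, h1⟩ := B.isLevelDisk.energy
  have h2 : EnergyLE (fun x => B.invFactor (circ x)) _ :=
    EnergyLE.cexp (C := C) hc.neg (fun x => by rw [norm_neg]; exact hC _ ⟨x, rfl⟩)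
      ((energyLE_rhLog hL hM).contraction hc continuous_neg fun v v' => by
        rw [neg_sub_neg, norm_sub_rev])
  have h3 := energyLE_rhWeight hL hM fun x => hC' _ ⟨x, rfl⟩
  exact ⟨_, h1.prodMk B.isLevelDisk.hol.continuous_circ
    (B.holDisk_invFactor.continuous_circ.prodMk (continuous_rhWeight hL hM))
    (h2.prodMk B.holDisk_invFactor.continuous_circ (continuous_rhWeight hL hM) h3)⟩

variable (hF : IsSmoothTorusFamily F)
include hF

lemma continuous_resid : Continuous fun p : UnitAddCircle × ℂ => B.resid p.1 p.2 := by
  have h1 := B.isLevelDisk.hol.continuous_circ.comp (continuous_fst (X := UnitAddCircle) (Y := ℂ))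
  have h2 := B.holDisk_invFactor.continuous_circ.comp (continuous_fst (X := UnitAddCircle) (Y := ℂ))
  have h3 := (continuous_rhWeight B.continuous_L B.energyLE_L).comp
    (continuous_fst (X := UnitAddCircle) (Y := ℂ))
  have h4 := (continuous_slice hF).comp (continuous_fst.prodMk (h1.add (h2.mul continuous_snd)))
  exact (Complex.continuous_re.comp continuous_snd).sub (h3.mul (h4.sub continuous_const))

lemma exists_bounds : ∃ C : ℝ, B.Bounds C := by
  obtain ⟨M, hM⟩ := B.exists_energyLE_coeffs
  obtain ⟨C₀, hC₀⟩ := (isCompact_range B.continuous_coeffs).isBounded.exists_norm_le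
  replace hC₀ : ∀ x, ‖B.coeffs x‖ ≤ C₀ := fun x => hC₀ _ ⟨x, rfl⟩
  have hC₀0 : 0 ≤ C₀ := (norm_nonneg _).trans (hC₀ 0)
  obtain ⟨C₁, hC₁⟩ := (isCompact_closedBall (0 : ℂ) 1).exists_bound_of_continuousOn B.holDisk_factor.1
  obtain ⟨C₂, hC₂⟩ := (isCompact_closedBall (0 : ℂ) 1).exists_bound_of_continuousOn
    B.holDisk_invFactor.1
  obtain ⟨K, hK0, hK⟩ := exists_lipschitz hF (2 * C₀)
  have hg : ∀ x, ‖B.g (circ x)‖ ≤ C₀ := fun x => (norm_fst_le (B.coeffs x)).trans (hC₀ x)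
  have he : ∀ x, ‖B.invFactor (circ x)‖ ≤ C₀ := fun x =>
    ((norm_fst_le (B.coeffs x).2).trans (norm_snd_le (B.coeffs x))).trans (hC₀ x)
  have hq : ∀ x, |rhWeight B.L x| ≤ C₀ := fun x =>
    ((norm_snd_le (B.coeffs x).2).trans (norm_snd_le (B.coeffs x))).trans (hC₀ x)
  have hw : ∀ x z, ‖z‖ ≤ 1 → ‖B.g (circ x) + B.invFactor (circ x) * z‖ ≤ 2 * C₀ := fun x z hz => by
    refine (norm_add_le _ _).trans ?_
    rw [norm_mul]
    nlinarith [hg x, he x, norm_nonneg z, norm_nonneg (B.invFactor (circ x)),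
      mul_le_mul (he x) hz (norm_nonneg z) hC₀0]
  have hw0 : ∀ x, ‖B.g (circ x)‖ ≤ 2 * C₀ := fun x => (hg x).trans (by linarith)
  refine ⟨1 + |M| + C₀ + |C₁| + |C₂| + 2 * K * C₀ ^ 3 + (C₀ * K * (2 + C₀) + K * C₀), ?_, ?_, ?_, ?_, ?_,
    ?_, ?_⟩
  · have : 0 ≤ 2 * K * C₀ ^ 3 + (C₀ * K * (2 + C₀) + K * C₀) := by positivity
    linarith [abs_nonneg M, abs_nonneg C₁, abs_nonneg C₂]
  · refine hM.mono ?_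
    have : 0 ≤ 2 * K * C₀ ^ 3 + (C₀ * K * (2 + C₀) + K * C₀) := by positivity
    linarith [le_abs_self M, abs_nonneg C₁, abs_nonneg C₂]
  · refine fun x => (hC₀ x).trans ?_
    have : 0 ≤ 2 * K * C₀ ^ 3 + (C₀ * K * (2 + C₀) + K * C₀) := by positivity
    linarith [abs_nonneg M, abs_nonneg C₁, abs_nonneg C₂]
  · have : 0 ≤ 2 * K * C₀ ^ 3 + (C₀ * K * (2 + C₀) + K * C₀) := by positivity
    exact fun z hz => (hC₁ z hz).trans (by linarith [abs_nonneg M, le_abs_self C₁, abs_nonneg C₂])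
  · have : 0 ≤ 2 * K * C₀ ^ 3 + (C₀ * K * (2 + C₀) + K * C₀) := by positivity
    exact fun z hz => (hC₂ z hz).trans (by linarith [abs_nonneg M, abs_nonneg C₁, le_abs_self C₂])
  · intro η hη x z z' hz hz'
    have hη0 : 0 ≤ η := (norm_nonneg z).trans hz
    set w := B.g (circ x) + B.invFactor (circ x) * z
    set w' := B.g (circ x) + B.invFactor (circ x) * z'
    have h1 := slice_sub_eq hF x w w'
    have h2 : w - w' = B.invFactor (circ x) * (z - z') := by simp only [w, w']; ring
    have h3 := avgGrad_lipschitz hF (R := 2 * C₀) (fun x s w w' hw hw' => (hK x s w w' hw hw').2.1)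
      hK0.le x 0 (hw0 x) (hw0 x) (hw x z (hz.trans hη)) (hw x z' (hz'.trans hη))
    rw [avgGrad_self] at h3
    have h4 : ‖B.g (circ x) - w‖ ≤ C₀ * η ∧ ‖B.g (circ x) - w'‖ ≤ C₀ * η := by
      constructor
      · simp only [w, sub_add_cancel_left, norm_neg, norm_mul]; gcongr; exact he x
      · simp only [w', sub_add_cancel_left, norm_neg, norm_mul]; gcongr; exact he x
    have h5 : B.resid x z - B.resid x z' = ((rhWeight B.L x : ℂ) * B.invFactor (circ x) *
        (grad F x (B.g (circ x)) - avgGrad F x w w') * (z - z')).re := by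
      have e1 : (rhWeight B.L x : ℂ) * B.invFactor (circ x) * grad F x (B.g (circ x)) = 1 := by
        rw [← B.invFactor_mul_factor (circ x), B.factor_circ]; ring
      have e2 : (rhWeight B.L x : ℂ) * B.invFactor (circ x) *
          (grad F x (B.g (circ x)) - avgGrad F x w w') * (z - z') =
          (z - z') - rhWeight B.L x * (avgGrad F x w w' * (w - w')) := by
        rw [h2]; linear_combination (z - z') * e1
      rw [e2, sub_re, re_ofReal_mul, ← h1, sub_re]
      simp only [resid, w, w']; ring
    have h6 : ‖grad F x (B.g (circ x)) - avgGrad F x w w'‖ ≤ 2 * K * C₀ * η := by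
      have := h3
      simp only [coe_zero, add_zero, abs_zero, zero_add] at this
      refine this.trans ?_
      nlinarith [h4.1, h4.2]
    rw [h5]
    refine (abs_re_le_norm _).trans ?_
    rw [norm_mul, norm_mul, norm_mul, norm_real, Real.norm_eq_abs]
    have h7 : |rhWeight B.L x| * ‖B.invFactor (circ x)‖ *
        ‖grad F x (B.g (circ x)) - avgGrad F x w w'‖ ≤ C₀ * C₀ * (2 * K * C₀ * η) := by
      gcongr
      exacts [hq x, he x]
    refine mul_le_mul_of_nonneg_right (h7.trans ?_) (norm_nonneg _)
    have : 0 ≤ 1 + |M| + C₀ + |C₁| + |C₂| + (C₀ * K * (2 + C₀) + K * C₀) := by positivity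
    nlinarith
  · intro x s z hz
    set w := B.g (circ x) + B.invFactor (circ x) * z
    set w' := B.g (circ (x + s)) + B.invFactor (circ (x + s)) * z
    set d := ‖B.coeffs (x + s) - B.coeffs x‖
    have h1 : ‖w' - w‖ ≤ 2 * d := by
      have e1 : ‖B.g (circ (x + s)) - B.g (circ x)‖ ≤ d := norm_fst_le (B.coeffs (x + s) - B.coeffs x)
      have e2 : ‖B.invFactor (circ (x + s)) - B.invFactor (circ x)‖ ≤ d :=
        (norm_fst_le (B.coeffs (x + s) - B.coeffs x).2).trans
          (norm_snd_le (B.coeffs (x + s) - B.coeffs x))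
      have e3 : w' - w = (B.g (circ (x + s)) - B.g (circ x)) +
          (B.invFactor (circ (x + s)) - B.invFactor (circ x)) * z := by simp only [w, w']; ring
      rw [e3]
      refine (norm_add_le _ _).trans ?_
      rw [norm_mul]
      nlinarith [mul_le_mul e2 hz (norm_nonneg z) (norm_nonneg (B.coeffs (x + s) - B.coeffs x))]
    have h2 : |rhWeight B.L (x + s) - rhWeight B.L x| ≤ d :=
      (norm_snd_le (B.coeffs (x + s) - B.coeffs x).2).trans
        (norm_snd_le (B.coeffs (x + s) - B.coeffs x))
    have h3 := (hK x s w' w (hw (x + s) z hz) (hw x z hz)).1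
    have h4 : |F (circ x) w - B.t| ≤ K * C₀ := by
      have := (hK x 0 w _ (hw x z hz) (hw0 x)).1
      rw [← B.isLevelDisk.level x]
      simp only [coe_zero, add_zero, abs_zero, zero_add] at this
      refine this.trans ?_
      gcongr
      simp only [w, add_sub_cancel_left, norm_mul]
      nlinarith [he x, norm_nonneg z, mul_le_mul (he x) hz (norm_nonneg z) hC₀0]
    have h5 : B.resid (x + s) z - B.resid x z =
        -(rhWeight B.L (x + s) * (F (circ (x + s)) w' - F (circ x) w) +
          (rhWeight B.L (x + s) - rhWeight B.L x) * (F (circ x) w - B.t)) := by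
      simp only [resid, w, w']; ring
    have hd : 0 ≤ d := norm_nonneg _
    have h6 : |B.resid (x + s) z - B.resid x z| ≤ C₀ * (K * (|s| + 2 * d)) + d * (K * C₀) := by
      rw [h5, abs_neg]
      refine (abs_add_le _ _).trans ?_
      rw [abs_mul, abs_mul]
      gcongr
      · exact hq _
      · exact h3.trans (by gcongr)
    refine h6.trans ?_
    have h7 : 0 ≤ 1 + |M| + C₀ + |C₁| + |C₂| + 2 * K * C₀ ^ 3 := by positivity
    have h8 : C₀ * (K * (|s| + 2 * d)) + d * (K * C₀) ≤
        (C₀ * K * (2 + C₀) + K * C₀) * (|s| + d) := by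
      have := abs_nonneg s
      have : 0 ≤ C₀ * K * |s| + C₀ * K * (C₀ * |s|) + C₀ * K * (C₀ * d) + K * C₀ * |s|:= by positivity
      nlinarith
    nlinarith [mul_nonneg h7 (add_nonneg (abs_nonneg s) hd)]

end BaseDisk

lemma energyLE_add_const {E : Type*} [NormedAddCommGroup E] {f : UnitAddCircle → E} {M : ℝ} (c : E) :
    EnergyLE (fun x => f x + c) M ↔ EnergyLE f M := by
  simp [EnergyLE]

lemma energyLE_of_tendsto {f : ℕ → UnitAddCircle → ℂ} {g : UnitAddCircle → ℂ} {M b : ℝ}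
    (hf : ∀ n, Continuous (f n)) (hb : ∀ n x, ‖f n x‖ ≤ b) (hM : ∀ n, EnergyLE (f n) M)
    (h : ∀ x, Tendsto (fun n => f n x) atTop (𝓝 (g x))) : EnergyLE g M := by
  intro s
  refine le_of_tendsto (tendsto_integral_of_dominated_convergence
    (F := fun n x => ‖f n (x + (s : UnitAddCircle)) - f n x‖ ^ 2) (fun _ => (2 * b) ^ 2)
    (fun n => ?_) (integrable_const _) (fun n => ae_of_all _ fun x => ?_)
    (ae_of_all _ fun x => ?_)) (Eventually.of_forall fun n => hM n s)
  · have := hf n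
    exact (by fun_prop : Continuous fun x =>
      ‖f n (x + (s : UnitAddCircle)) - f n x‖ ^ 2).aestronglyMeasurable
  · rw [Real.norm_of_nonneg (by positivity)]
    gcongr
    exact (norm_sub_le _ _).trans (by linarith [hb n (x + s), hb n x])
  · exact ((h (x + s)).sub (h x)).norm.pow 2

lemma _root_.HolDisk.eq_schwarz_re {h : ℂ → ℂ} (hh : HolDisk h) {M : ℝ}
    (hM : EnergyLE (fun x => (h (circ x)).re) M) : ∃ c : ℝ, ∀ z ∈ closedBall (0 : ℂ) 1,
      h z = schwarz (fun x => (h (circ x)).re) z + c * I := by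
  have hc : Continuous fun x => (h (circ x)).re := Complex.continuous_re.comp hh.continuous_circ
  obtain ⟨c, h1⟩ := (hh.sub (holDisk_schwarz hc hM)).eq_im_const fun x => by
    rw [sub_re, schwarz_re hc hM, sub_self]
  exact ⟨c, fun z hz => by linear_combination h1 z hz⟩

lemma _root_.HolDisk.energyLE_of_re {h : ℂ → ℂ} (hh : HolDisk h) {M : ℝ}
    (hM : EnergyLE (fun x => (h (circ x)).re) M) : EnergyLE (fun x => h (circ x)) (4 * M) := by
  have hc : Continuous fun x => (h (circ x)).re := Complex.continuous_re.comp hh.continuous_circ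
  obtain ⟨c, h1⟩ := hh.eq_schwarz_re hM
  rw [show (fun x => h (circ x)) = fun x => schwarz (fun x => (h (circ x)).re) (circ x) + c * I from
    funext fun x => h1 _ (circ_mem_closedBall x)]
  exact (energyLE_add_const _).2 (energyLE_schwarz hc hM)

/-- A sequence of holomorphic disks which is uniformly Cauchy on the circle converges to a
holomorphic disk. -/
lemma exists_holDisk_of_cauchy {f : ℕ → ℂ → ℂ} (hf : ∀ n, HolDisk (f n))
    (h : ∀ ε > 0, ∃ N, ∀ n k, N ≤ n → ∀ x, ‖f n (circ x) - f (n + k) (circ x)‖ ≤ ε) :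
    ∃ g, HolDisk g ∧ ∀ z ∈ closedBall (0 : ℂ) 1, Tendsto (fun n => f n z) atTop (𝓝 (g z)) := by
  have hu : UniformCauchySeqOn f atTop (closedBall 0 1) := by
    rw [Metric.uniformCauchySeqOn_iff]
    intro ε hε
    obtain ⟨N, hN⟩ := h (ε / 2) (by positivity)
    have key : ∀ m n, N ≤ m → m ≤ n → ∀ z ∈ closedBall (0 : ℂ) 1, dist (f m z) (f n z) < ε :=
      fun m n hm hmn z hz => by
        obtain ⟨k, rfl⟩ := Nat.exists_eq_add_of_le hmn
        rw [dist_eq_norm]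
        exact (((hf m).sub (hf (m + k))).norm_le (hN m k hm) z hz).trans_lt (by linarith)
    refine ⟨N, fun m hm n hn z hz => ?_⟩
    rcases le_total m n with hmn | hmn
    · exact key m n hm hmn z hz
    · rw [dist_comm]; exact key n m hn hmn z hz
  have hlim : ∀ z, ∃ w, z ∈ closedBall (0 : ℂ) 1 → Tendsto (fun n => f n z) atTop (𝓝 w) := by
    intro z
    by_cases hz : z ∈ closedBall (0 : ℂ) 1
    · obtain ⟨w, hw⟩ := cauchySeq_tendsto_of_complete (hu.cauchySeq hz)
      exact ⟨w, fun _ => hw⟩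
    · exact ⟨0, fun h => absurd h hz⟩
  choose g hg using hlim
  have ht : TendstoUniformlyOn f g atTop (closedBall 0 1) := hu.tendstoUniformlyOn_of_tendsto hg
  refine ⟨g, ⟨ht.continuousOn (Frequently.of_forall fun n => (hf n).1), ?_⟩, hg⟩
  exact (ht.mono ball_subset_closedBall).tendstoLocallyUniformlyOn.differentiableOn
    (Eventually.of_forall fun n => (hf n).2) isOpen_ball

namespace BaseDisk

variable {F : ℂ → ℂ → ℝ} (B : BaseDisk F)

/-- The right-hand side of the boundary value problem `Re h = rhs τ h` for level disks. -/
def rhs (τ : ℝ) (h : ℂ → ℂ) (x : UnitAddCircle) : ℝ :=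
  B.resid x (h (circ x)) + τ * rhWeight B.L x

lemma re_eq_rhs_iff (τ : ℝ) (h : ℂ → ℂ) (x : UnitAddCircle) : (h (circ x)).re = B.rhs τ h x ↔
    F (circ x) (B.g (circ x) + B.invFactor (circ x) * h (circ x)) = B.t + τ := by
  rw [rhs, resid]
  have := (rhWeight_pos B.L x).ne'
  constructor
  · intro h1
    have h2 : rhWeight B.L x *
        (F (circ x) (B.g (circ x) + B.invFactor (circ x) * h (circ x)) - B.t - τ) = 0 := by
      linear_combination h1
    linear_combination (mul_eq_zero.1 h2).resolve_left this
  · intro h; rw [h]; ring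

variable {B} {C : ℝ} (hC : B.Bounds C) (hF : IsSmoothTorusFamily F)
include hC hF

omit hF in
lemma Bounds.weight_le (x : UnitAddCircle) : |rhWeight B.L x| ≤ C :=
  ((norm_snd_le (B.coeffs x).2).trans (norm_snd_le (B.coeffs x))).trans (hC.norm_coeffs_le x)

omit hC in
lemma continuous_rhs (τ : ℝ) {h : ℂ → ℂ} (hh : HolDisk h) : Continuous (B.rhs τ h) :=
  ((B.continuous_resid hF).comp (continuous_id.prodMk hh.continuous_circ)).add
    (continuous_const.mul (continuous_rhWeight B.continuous_L B.energyLE_L))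

lemma Bounds.energyLE_rhs {τ : ℝ} (hτ : |τ| ≤ 1) {h : ℂ → ℂ} (hh : HolDisk h) {M : ℝ}
    (hM : EnergyLE (fun x => h (circ x)) M) (hη : ∀ x, ‖h (circ x)‖ ≤ 1 / (10 * C)) :
    EnergyLE (B.rhs τ h) (3 / 100 * M + 15 * C ^ 3) := by
  have h1C := hC.one_le
  have hη1 : 1 / (10 * C) ≤ 1 := by rw [div_le_one (by positivity)]; linarith
  refine (EnergyLE.of_dominated₂ (C₁ := 3 / 100) (C₂ := 12 * C ^ 2) (C₃ := 3 * C ^ 2)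
    (continuous_rhs hF τ hh) hh.continuous_circ B.continuous_coeffs hM hC.energyLE_coeffs
    (by norm_num) (by positivity) fun x s => ?_).mono ?_
  · set d := ‖B.coeffs (x + s) - B.coeffs x‖
    set e := ‖h (circ (x + s)) - h (circ x)‖
    have h1 := hC.resid_lipschitz _ hη1 (x + s) _ _ (hη (x + s)) (hη x)
    have h2 := hC.resid_translate x s (h (circ x)) ((hη x).trans hη1)
    have h3 : |rhWeight B.L (x + s) - rhWeight B.L x| ≤ d :=
      (norm_snd_le (B.coeffs (x + s) - B.coeffs x).2).trans
        (norm_snd_le (B.coeffs (x + s) - B.coeffs x))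
    have h4 : C * (1 / (10 * C)) = 1 / 10 := by field_simp
    rw [h4] at h1
    have h5 : B.rhs τ h (x + s) - B.rhs τ h x =
        (B.resid (x + s) (h (circ (x + s))) - B.resid (x + s) (h (circ x))) +
        ((B.resid (x + s) (h (circ x)) - B.resid x (h (circ x))) +
        τ * (rhWeight B.L (x + s) - rhWeight B.L x)) := by simp only [rhs]; ring
    have hd : 0 ≤ d := norm_nonneg _
    have he : 0 ≤ e := norm_nonneg _
    have h6 : ‖B.rhs τ h (x + s) - B.rhs τ h x‖ ≤ 1 / 10 * e + 2 * C * d + C * |s| := by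
      rw [h5, Real.norm_eq_abs]
      have a1 := abs_add_le (B.resid (x + s) (h (circ (x + s))) - B.resid (x + s) (h (circ x)))
        ((B.resid (x + s) (h (circ x)) - B.resid x (h (circ x))) +
        τ * (rhWeight B.L (x + s) - rhWeight B.L x))
      have a2 := abs_add_le (B.resid (x + s) (h (circ x)) - B.resid x (h (circ x)))
        (τ * (rhWeight B.L (x + s) - rhWeight B.L x))
      have a3 : |τ * (rhWeight B.L (x + s) - rhWeight B.L x)| ≤ 1 * d := by
        rw [abs_mul]; gcongr
      nlinarith
    have h7 := pow_le_pow_left₀ (norm_nonneg _) h6 2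
    have hs := sq_abs s
    refine h7.trans ?_
    rw [← hs]
    nlinarith [sq_nonneg (1 / 10 * e - 2 * C * d), sq_nonneg (1 / 10 * e - C * |s|),
      sq_nonneg (2 * C * d - C * |s|)]
  · nlinarith [sq_nonneg C, mul_nonneg (sq_nonneg C) (sub_nonneg.2 h1C)]

/-- A priori energy bound for solutions of the boundary value problem. -/
lemma Bounds.energyLE_of_re_eq_rhs {τ : ℝ} (hτ : |τ| ≤ 1) {h : ℂ → ℂ} (hh : HolDisk h) {M : ℝ}
    (hM : EnergyLE (fun x => h (circ x)) M) (hη : ∀ x, ‖h (circ x)‖ ≤ 1 / (10 * C))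
    (heq : ∀ x, (h (circ x)).re = B.rhs τ h x) :
    EnergyLE (fun x => h (circ x)) (120 * C ^ 3) := by
  have h1C := hC.one_le
  have hC3 : 0 ≤ C ^ 3 := by positivity
  have step : ∀ n : ℕ, EnergyLE (fun x => h (circ x)) (120 * C ^ 3 + (1 / 2) ^ n * |M|) := by
    intro n
    induction n with
    | zero => exact hM.mono (by linarith [le_abs_self M])
    | succ n ih =>
      have h1 := hC.energyLE_rhs hF hτ hh ih hη
      have h2 := hh.energyLE_of_re (by simpa only [heq] using h1)
      refine h2.mono ?_
      rw [pow_succ (1 / 2 : ℝ) n]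
      have : 0 ≤ (1 / 2 : ℝ) ^ n * |M| := by positivity
      nlinarith
  intro s
  have ht : Tendsto (fun n : ℕ => (120 * C ^ 3 + (1 / 2 : ℝ) ^ n * |M|) * s ^ 2) atTop
      (𝓝 ((120 * C ^ 3 + 0 * |M|) * s ^ 2)) :=
    ((tendsto_const_nhds.add ((tendsto_pow_atTop_nhds_zero_of_lt_one (by norm_num)
      (by norm_num)).mul_const _)).mul_const _)
  have := ge_of_tendsto ht (Eventually.of_forall fun n => step n s)
  simpa using this

end BaseDisk

lemma meanSq_le_of_sq_le {E E' : Type*} [NormedAddCommGroup E] [NormedAddCommGroup E']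
    {f : UnitAddCircle → E} {g : UnitAddCircle → E'} (hf : Continuous f) (hg : Continuous g)
    {a b : ℝ} (h : ∀ x, ‖f x‖ ^ 2 ≤ a * ‖g x‖ ^ 2 + b) : meanSq f ≤ a * meanSq g + b := by
  have h1 := integral_mono_of_continuous (f := fun x => ‖f x‖ ^ 2)
    (g := fun x => a * ‖g x‖ ^ 2 + b) (by fun_prop) (by fun_prop) h
  rwa [integral_add (integrable_of_continuous (by fun_prop)) (integrable_const _),
    integral_const_mul, integral_haar_const] at h1

namespace BaseDisk

variable {F : ℂ → ℂ → ℝ} (B : BaseDisk F)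

/-- The fixed point map for the boundary value problem. -/
def picard (τ c : ℝ) (h : ℂ → ℂ) (z : ℂ) : ℂ := schwarz (B.rhs τ h) z + c * I

/-- The class of disks on which the fixed point map is a contraction. -/
structure Admissible (C : ℝ) (h : ℂ → ℂ) : Prop where
  hol : HolDisk h
  energy : EnergyLE (fun x => h (circ x)) (120 * C ^ 3)
  norm_le : ∀ x, ‖h (circ x)‖ ≤ 1 / (10 * C)

variable {B} {C : ℝ} (hC : B.Bounds C) (hF : IsSmoothTorusFamily F) {τ : ℝ} (hτ : |τ| ≤ 1)
include hC

lemma Bounds.abs_resid_sub_le {h k : ℂ → ℂ} (hh : ∀ x, ‖h (circ x)‖ ≤ 1 / (10 * C))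
    (hk : ∀ x, ‖k (circ x)‖ ≤ 1 / (10 * C)) (x : UnitAddCircle) :
    |B.resid x (h (circ x)) - B.resid x (k (circ x))| ≤ 1 / 10 * ‖h (circ x) - k (circ x)‖ := by
  have h1C := hC.one_le
  have h1 := hC.resid_lipschitz (1 / (10 * C)) (by rw [div_le_one (by positivity)]; linarith) x
    _ _ (hh x) (hk x)
  have h4 : C * (1 / (10 * C)) = 1 / 10 := by field_simp
  rwa [h4] at h1

include hF hτ

lemma Admissible.holDisk_picard {h : ℂ → ℂ} (hh : Admissible C h) (c : ℝ) :
    HolDisk (B.picard τ c h) :=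
  (holDisk_schwarz (continuous_rhs hF τ hh.hol)
    (hC.energyLE_rhs hF hτ hh.hol hh.energy hh.norm_le)).add (holDisk_const _)

lemma Admissible.energyLE_picard {h : ℂ → ℂ} (hh : Admissible C h) (c : ℝ) :
    EnergyLE (fun x => B.picard τ c h (circ x)) (120 * C ^ 3) := by
  have h1 := energyLE_schwarz (continuous_rhs hF τ hh.hol)
    (hC.energyLE_rhs hF hτ hh.hol hh.energy hh.norm_le)
  refine (energyLE_add_const _).2 (h1.mono ?_)
  have := hC.one_le
  have : 0 ≤ C ^ 3 := by positivity
  linarith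

lemma Admissible.meanSq_picard_sub_le {h k : ℂ → ℂ} (hh : Admissible C h) (hk : Admissible C k)
    (c : ℝ) : meanSq (fun x => B.picard τ c h (circ x) - B.picard τ c k (circ x)) ≤
      1 / 10 * meanSq (fun x => h (circ x) - k (circ x)) := by
  have c1 := continuous_rhs hF (B := B) τ hh.hol
  have c2 := continuous_rhs hF (B := B) τ hk.hol
  have e1 := hC.energyLE_rhs hF hτ hh.hol hh.energy hh.norm_le
  have e2 := hC.energyLE_rhs hF hτ hk.hol hk.energy hk.norm_le
  have h1 : (fun x => B.picard τ c h (circ x) - B.picard τ c k (circ x)) =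
      fun x => schwarz (fun y => B.rhs τ h y - B.rhs τ k y) (circ x) := by
    ext x
    rw [← schwarz_sub c1 e1 c2 e2 (circ_mem_closedBall x), picard, picard]; ring
  rw [h1]
  have c3 : Continuous fun x => B.rhs τ h x - B.rhs τ k x := c1.sub c2
  have c4 : Continuous fun x => h (circ x) - k (circ x) :=
    hh.hol.continuous_circ.sub hk.hol.continuous_circ
  have h2 := meanSq_schwarz_le (u := fun x => B.rhs τ h x - B.rhs τ k x) c3 (e1.sub c1 c2 e2)
  have h3 := meanSq_le_of_sq_le (f := fun x => B.rhs τ h x - B.rhs τ k x)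
    (g := fun x => h (circ x) - k (circ x)) (a := 1 / 100) (b := 0) c3 c4 fun x => by
      have := hC.abs_resid_sub_le hh.norm_le hk.norm_le x
      have := pow_le_pow_left₀ (abs_nonneg _) this 2
      rw [mul_pow] at this
      simp only [rhs, add_sub_add_right_eq_sub, Real.norm_eq_abs]
      linarith
  linarith

lemma Admissible.meanSq_picard_le {h : ℂ → ℂ} (hh : Admissible C h) (c : ℝ) :
    meanSq (fun x => B.picard τ c h (circ x) - c * I) ≤
      2 / 5 * meanSq (fun x => h (circ x) - c * I) + (2 / 5 * c ^ 2 + 20 * C ^ 2 * τ ^ 2) := by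
  have c1 := continuous_rhs hF (B := B) τ hh.hol
  have e1 := hC.energyLE_rhs hF hτ hh.hol hh.energy hh.norm_le
  have h1 : (fun x => B.picard τ c h (circ x) - c * I) =
      fun x => schwarz (B.rhs τ h) (circ x) := by
    ext x; rw [picard]; ring
  rw [h1]
  have h2 := meanSq_schwarz_le c1 e1
  have c2 : Continuous fun x => h (circ x) - c * I :=
    hh.hol.continuous_circ.sub continuous_const
  have h3 := meanSq_le_of_sq_le (g := fun x => h (circ x) - c * I) (a := 1 / 25)
    (b := 1 / 25 * c ^ 2 + 2 * C ^ 2 * τ ^ 2) c1 c2 fun x => by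
      have h1C := hC.one_le
      have a1 := hC.abs_resid_sub_le hh.norm_le (k := 0) (fun x => by
        simp only [Pi.zero_apply, norm_zero]; positivity) x
      simp only [Pi.zero_apply, resid_zero, sub_zero] at a1
      have a2 : ‖h (circ x)‖ ≤ ‖h (circ x) - c * I‖ + |c| := by
        have := norm_add_le (h (circ x) - c * I) (c * I)
        simpa using this
      have a3 := hC.weight_le x
      have a4 : |B.rhs τ h x| ≤ 1 / 10 * (‖h (circ x) - c * I‖ + |c|) + |τ| * C := by
        rw [rhs]
        refine (abs_add_le _ _).trans ?_
        rw [abs_mul]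
        gcongr
        linarith
      have a5 := pow_le_pow_left₀ (abs_nonneg _) a4 2
      rw [Real.norm_eq_abs]
      refine a5.trans ?_
      rw [← sq_abs c, ← sq_abs τ]
      nlinarith [sq_nonneg (1 / 10 * (‖h (circ x) - c * I‖ + |c|) - |τ| * C),
        sq_nonneg (‖h (circ x) - c * I‖ - |c|)]
  linarith

omit hτ
/-- Existence of small solutions of the boundary value problem. -/
lemma Bounds.exists_solution {ε : ℝ} (hε : 0 < ε) (hεC : ε ≤ 1 / (10 * C)) :
    ∃ δ : ℝ, 0 < δ ∧ ∀ c τ : ℝ, |c| ≤ δ → |τ| ≤ δ → ∃ h : ℂ → ℂ, HolDisk h ∧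
      EnergyLE (fun x => h (circ x)) (120 * C ^ 3) ∧ (h 0).im = c ∧ (∀ x, ‖h (circ x)‖ ≤ ε) ∧
      ∀ x, (h (circ x)).re = B.rhs τ h x := by
  have h1C := hC.one_le
  obtain ⟨ρ, hρ, hρε⟩ := exists_meanSq_bound (120 * C ^ 3) (half_pos hε)
  have hδ : 0 < min (min 1 (ε / 2)) (Real.sqrt ρ / (7 * C)) := by positivity
  refine ⟨_, hδ, fun c τ hc hτ => ?_⟩
  set δ := min (min 1 (ε / 2)) (Real.sqrt ρ / (7 * C))
  have hδ1 : δ ≤ 1 := (min_le_left _ _).trans (min_le_left _ _)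
  have hδε : δ ≤ ε / 2 := (min_le_left _ _).trans (min_le_right _ _)
  have hδρ : 49 * C ^ 2 * δ ^ 2 ≤ ρ := by
    have := min_le_right (min 1 (ε / 2)) (Real.sqrt ρ / (7 * C))
    rw [le_div_iff₀ (by positivity)] at this
    have := pow_le_pow_left₀ (by positivity) this 2
    rw [Real.sq_sqrt hρ.le] at this
    linarith
  have hτ1 := hτ.trans hδ1
  have hc2 : c ^ 2 ≤ δ ^ 2 := sq_le_sq' (abs_le.1 hc).1 (abs_le.1 hc).2
  have hτ2 : τ ^ 2 ≤ δ ^ 2 := sq_le_sq' (abs_le.1 hτ).1 (abs_le.1 hτ).2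
  have hsmall : 2 / 5 * c ^ 2 + 20 * C ^ 2 * τ ^ 2 ≤ 3 / 5 * ρ := by
    nlinarith [mul_le_mul_of_nonneg_left hτ2 (sq_nonneg C), sq_nonneg δ,
      mul_nonneg (sq_nonneg δ) (sub_nonneg.2 (one_le_pow₀ h1C (n := 2)))]
  have hsup : ∀ h : ℂ → ℂ, HolDisk h → EnergyLE (fun x => h (circ x)) (120 * C ^ 3) →
      meanSq (fun x => h (circ x) - c * I) ≤ ρ → ∀ x, ‖h (circ x)‖ ≤ ε := fun h hh he hm x => by
    have c1 : Continuous fun x => h (circ x) - c * I := hh.continuous_circ.sub continuous_const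
    have e1 : EnergyLE (fun x => h (circ x) - c * I) (120 * C ^ 3) := by
      simpa only [sub_eq_add_neg] using (energyLE_add_const (-(c * I : ℂ))).2 he
    have h1 := hρε (fun x => h (circ x) - c * I) c1 e1 hm x
    have h2 := norm_add_le (h (circ x) - c * I) (c * I)
    simp only [sub_add_cancel, norm_mul, norm_real, norm_I, mul_one, Real.norm_eq_abs] at h2
    linarith
  let f : ℕ → ℂ → ℂ := fun n => (B.picard τ c)^[n] fun _ => c * I
  have fs : ∀ n, f (n + 1) = B.picard τ c (f n) := fun n => Function.iterate_succ_apply' _ _ _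
  have inv : ∀ n, Admissible C (f n) ∧ meanSq (fun x => f n (circ x) - c * I) ≤ ρ := by
    intro n
    induction n with
    | zero =>
      have h1 : meanSq (fun x => f 0 (circ x) - c * I) ≤ ρ := by
        simp only [f, Function.iterate_zero, id, sub_self]
        simpa [meanSq] using hρ.le
      have h2 : EnergyLE (fun x => f 0 (circ x)) (120 * C ^ 3) :=
        (energyLE_const _).mono (by positivity)
      exact ⟨⟨holDisk_const _, h2, fun x => (hsup _ (holDisk_const _) h2 h1 x).trans hεC⟩, h1⟩
    | succ n ih =>
      rw [fs]
      have h1 := ih.1.holDisk_picard hC hF hτ1 c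
      have h2 := ih.1.energyLE_picard hC hF hτ1 c
      have h3 := ih.1.meanSq_picard_le hC hF hτ1 c
      have h4 : meanSq (fun x => B.picard τ c (f n) (circ x) - c * I) ≤ ρ := by linarith [ih.2]
      exact ⟨⟨h1, h2, fun x => (hsup _ h1 h2 h4 x).trans hεC⟩, h4⟩
  have hfε : ∀ n x, ‖f n (circ x)‖ ≤ ε := fun n => hsup _ (inv n).1.hol (inv n).1.energy (inv n).2
  have hd : ∀ k n, meanSq (fun x => f n (circ x) - f (n + k) (circ x)) ≤
      (1 / 10) ^ n * (2 * ε) ^ 2 := by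
    intro k n
    induction n with
    | zero =>
      rw [pow_zero, one_mul]
      exact meanSq_le_of_norm_le (f := fun x => f 0 (circ x) - f (0 + k) (circ x))
        ((inv 0).1.hol.continuous_circ.sub (inv _).1.hol.continuous_circ)
        fun x => (norm_sub_le _ _).trans (by linarith [hfε 0 x, hfε (0 + k) x])
    | succ n ih =>
      rw [add_right_comm, fs, fs]
      have := (inv n).1.meanSq_picard_sub_le hC hF hτ1 (inv (n + k)).1 c
      rw [pow_succ]
      linarith
  obtain ⟨h, hh, hlim⟩ := exists_holDisk_of_cauchy (fun n => (inv n).1.hol) fun e he => by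
    obtain ⟨ρ', hρ', hb⟩ := exists_meanSq_bound (4 * (120 * C ^ 3 + 120 * C ^ 3)) he
    have ht : Tendsto (fun n : ℕ => (1 / 10 : ℝ) ^ n * (2 * ε) ^ 2) atTop (𝓝 (0 * (2 * ε) ^ 2)) :=
      (tendsto_pow_atTop_nhds_zero_of_lt_one (by norm_num) (by norm_num)).mul_const _
    rw [zero_mul] at ht
    obtain ⟨N, hN⟩ := eventually_atTop.1 (ht.eventually (gt_mem_nhds hρ'))
    refine ⟨N, fun n k hn => hb (fun x => f n (circ x) - f (n + k) (circ x)) ((inv n).1.hol.continuous_circ.sub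
      (inv (n + k)).1.hol.continuous_circ) ?_ ((hd k n).trans (hN n hn).le)⟩
    exact (inv n).1.energy.sub (inv n).1.hol.continuous_circ
      (inv (n + k)).1.hol.continuous_circ (inv (n + k)).1.energy
  have hlimc : ∀ x, Tendsto (fun n => f n (circ x)) atTop (𝓝 (h (circ x))) :=
    fun x => hlim _ (circ_mem_closedBall x)
  refine ⟨h, hh, energyLE_of_tendsto (fun n => (inv n).1.hol.continuous_circ) hfε
    (fun n => (inv n).1.energy) hlimc, ?_, fun x => le_of_tendsto (hlimc x).norm
      (Eventually.of_forall fun n => hfε n x), fun x => ?_⟩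
  · have h1 := (Complex.continuous_im.tendsto _).comp (hlim 0 (by simp))
    have h2 : ∀ n, (f n 0).im = c := fun n => by
      cases n with
      | zero => simp [f]
      | succ n => rw [fs, picard, schwarz_zero]; simp
    refine tendsto_nhds_unique h1 ?_
    simp only [Function.comp_def, h2, tendsto_const_nhds_iff]
  · have h1 := ((Complex.continuous_re.tendsto _).comp (hlimc x)).comp (tendsto_add_atTop_nat 1)
    have h2 : Tendsto (fun n => B.rhs τ (f n) x) atTop (𝓝 (B.rhs τ h x)) :=
      (((B.continuous_resid hF).tendsto (x, h (circ x))).comp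
        (tendsto_const_nhds.prodMk_nhds (hlimc x))).add tendsto_const_nhds
    refine tendsto_nhds_unique h1 (h2.congr fun n => ?_)
    simp only [Function.comp_apply, fs, picard, add_re]
    rw [schwarz_re (continuous_rhs hF τ (inv n).1.hol)
      (hC.energyLE_rhs hF hτ1 (inv n).1.hol (inv n).1.energy (inv n).1.norm_le)]
    simp

end BaseDisk

/-- The boundary values of `k` and `g` differ by at most `η`. -/
def CloseOnCircle (η : ℝ) (g k : ℂ → ℂ) : Prop := ∀ x, ‖k (circ x) - g (circ x)‖ ≤ η

namespace BaseDisk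

variable {F : ℂ → ℂ → ℝ} {B : BaseDisk F} {C : ℝ} (hC : B.Bounds C) (hF : IsSmoothTorusFamily F)
include hC hF

lemma Bounds.exists_levelDisk {ε : ℝ} (hε : 0 < ε) : ∃ δ : ℝ, 0 < δ ∧ ∀ c τ : ℝ, |c| ≤ δ → |τ| ≤ δ →
    ∃ k : ℂ → ℂ, IsLevelDisk F (B.t + τ) k ∧ (B.factor 0 * (k 0 - B.g 0)).im = c ∧
      CloseOnCircle ε B.g k := by
  have h1C := hC.one_le
  have hε' : 0 < min (ε / C) (1 / (10 * C)) := by positivity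
  obtain ⟨δ, hδ, h⟩ := hC.exists_solution hF hε' (min_le_right _ _)
  refine ⟨δ, hδ, fun c τ hc hτ => ?_⟩
  obtain ⟨h, hh, he, h0, hle, hre⟩ := h c τ hc hτ
  have hm := B.holDisk_invFactor.mul hh
  have hi : EnergyLE (fun x => B.invFactor (circ x)) C :=
    hC.energyLE_coeffs.contraction (Ψ := fun p => p.2.1) B.continuous_coeffs (by fun_prop)
      fun v v' => (norm_fst_le (v - v').2).trans (norm_snd_le (v - v'))
  obtain ⟨M, hM⟩ := B.isLevelDisk.energy
  refine ⟨fun z => B.g z + B.invFactor z * h z, ⟨B.isLevelDisk.hol.add hm, ⟨_, hM.add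
    B.isLevelDisk.hol.continuous_circ hm.continuous_circ (hi.mul
      B.holDisk_invFactor.continuous_circ hh.continuous_circ he
      (fun x => hC.norm_invFactor_le _ (circ_mem_closedBall x)) hle)⟩,
    fun x => (B.re_eq_rhs_iff τ h x).1 (hre x)⟩, ?_, fun x => ?_⟩
  · rw [add_sub_cancel_left, ← mul_assoc, factor_mul_invFactor, one_mul, h0]
  · rw [add_sub_cancel_left, norm_mul]
    calc _ ≤ C * (ε / C) := by
          gcongr
          · exact hC.norm_invFactor_le _ (circ_mem_closedBall x)
          · exact (hle x).trans (min_le_left _ _)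
      _ = ε := by field_simp

/-- Level disks close to a base disk have uniformly bounded energy. -/
lemma Bounds.exists_energy_bound : ∃ η M : ℝ, 0 < η ∧ η ≤ 1 ∧ ∀ t k, IsLevelDisk F t k →
    CloseOnCircle η B.g k → EnergyLE (fun x => k (circ x)) M := by
  have h1C := hC.one_le
  obtain ⟨K, hK0, hK⟩ := exists_lipschitz hF (C + 1)
  have hg : ∀ x, ‖B.g (circ x)‖ ≤ C := fun x => (norm_fst_le (B.coeffs x)).trans
    (hC.norm_coeffs_le x)
  have hi : EnergyLE (fun x => B.invFactor (circ x)) C :=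
    hC.energyLE_coeffs.contraction (Ψ := fun p => p.2.1) B.continuous_coeffs (by fun_prop)
      fun v v' => (norm_fst_le (v - v').2).trans (norm_snd_le (v - v'))
  have hge : EnergyLE (fun x => B.g (circ x)) C :=
    hC.energyLE_coeffs.contraction (Ψ := fun p => p.1) B.continuous_coeffs (by fun_prop)
      fun v v' => norm_fst_le (v - v')
  have hη : 0 < min (min 1 (1 / K)) (1 / (10 * C) / C) := by positivity
  refine ⟨_, 4 * (C + (C + 1) ^ 2 * (C + 120 * C ^ 3)), hη,
    (min_le_left _ _).trans (min_le_left _ _), fun t k hk hkg => ?_⟩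
  set η := min (min 1 (1 / K)) (1 / (10 * C) / C)
  have hη1 : η ≤ 1 := (min_le_left _ _).trans (min_le_left _ _)
  have hηK : K * η ≤ 1 := by
    have : η ≤ 1 / K := (min_le_left _ _).trans (min_le_right _ _)
    rw [le_div_iff₀ hK0] at this
    linarith
  have hηC : C * η ≤ 1 / (10 * C) := by
    have : η ≤ 1 / (10 * C) / C := min_le_right _ _
    rw [le_div_iff₀ (by positivity)] at this
    linarith
  have hd := hk.hol.sub B.isLevelDisk.hol
  have hh := B.holDisk_factor.mul hd
  have hle : ∀ x, ‖B.factor (circ x) * (k (circ x) - B.g (circ x))‖ ≤ 1 / (10 * C) := fun x => by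
    rw [norm_mul]
    refine le_trans ?_ hηC
    gcongr
    exacts [hC.norm_factor_le _ (circ_mem_closedBall x), hkg x]
  have heq : ∀ z, B.invFactor z * (B.factor z * (k z - B.g z)) = k z - B.g z := fun z => by
    rw [← mul_assoc, invFactor_mul_factor, one_mul]
  have hτ : |t - B.t| ≤ 1 := by
    have := (hK 0 0 (k (circ 0)) (B.g (circ 0)) ?_ ((hg 0).trans (by linarith))).1
    · rw [coe_zero, add_zero, hk.level, B.isLevelDisk.level, abs_zero, zero_add] at this
      exact this.trans (by nlinarith [hkg 0])
    · have := norm_le_norm_add_norm_sub' (k (circ 0)) (B.g (circ 0))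
      linarith [hkg 0, hg 0]
  obtain ⟨M, hM⟩ := hk.energy
  obtain ⟨M', hM'⟩ := B.isLevelDisk.energy
  have hfe : ∃ M, EnergyLE (fun x => B.factor (circ x)) M := by
    obtain ⟨C', hC'⟩ := (isCompact_range (holDisk_rhLog B.continuous_L
      B.energyLE_L).continuous_circ).isBounded.exists_norm_le
    exact ⟨_, (energyLE_rhLog B.continuous_L B.energyLE_L).cexp (holDisk_rhLog B.continuous_L
      B.energyLE_L).continuous_circ fun x => hC' _ ⟨x, rfl⟩⟩
  obtain ⟨M'', hM''⟩ := hfe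
  have hhe := hM''.mul B.holDisk_factor.continuous_circ hd.continuous_circ
    (hM.sub hk.hol.continuous_circ B.isLevelDisk.hol.continuous_circ hM')
    (fun x => hC.norm_factor_le _ (circ_mem_closedBall x)) hkg
  have h1 := hC.energyLE_of_re_eq_rhs hF hτ hh hhe hle fun x => by
    refine (B.re_eq_rhs_iff (t - B.t) (fun z => B.factor z * (k z - B.g z)) x).2 ?_
    rw [heq, add_sub_cancel, hk.level]; ring
  have h2 := hge.add B.isLevelDisk.hol.continuous_circ
    (B.holDisk_invFactor.mul hh).continuous_circ (hi.mul
      B.holDisk_invFactor.continuous_circ hh.continuous_circ h1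
      (fun x => hC.norm_invFactor_le _ (circ_mem_closedBall x)) (B' := 1)
      fun x => (hle x).trans (by rw [div_le_one (by positivity)]; linarith))
  simpa only [heq, add_sub_cancel] using h2

end BaseDisk

lemma continuous_avgGrad {F : ℂ → ℂ → ℝ} (hF : IsSmoothTorusFamily F) {k k' : UnitAddCircle → ℂ}
    (hk : Continuous k) (hk' : Continuous k') : Continuous fun x => avgGrad F x (k x) (k' x) := by
  have hg := continuous_grad hF
  refine intervalIntegral.continuous_parametric_intervalIntegral_of_continuous' ?_ 0 1
  fun_prop

lemma norm_log_le_of_norm_sub_one_le {u : ℂ} (hu : ‖u - 1‖ ≤ 1 / 3) : ‖Complex.log u‖ ≤ 1 / 2 := by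
  have := Complex.norm_log_one_add_half_le_self (z := u - 1) (by linarith)
  rw [add_sub_cancel] at this
  linarith

lemma mem_slitPlane_of_norm_sub_one_le {u : ℂ} (hu : ‖u - 1‖ ≤ 1 / 3) : u ∈ slitPlane := by
  have := Complex.mem_slitPlane_of_norm_lt_one (z := u - 1) (by linarith)
  rwa [add_sub_cancel] at this

lemma EnergyLE.clog {u : UnitAddCircle → ℂ} {M : ℝ} (hu : Continuous u) (h : EnergyLE u M)
    (hu1 : ∀ x, ‖u x - 1‖ ≤ 1 / 3) : EnergyLE (fun x => Complex.log (u x)) ((3 / 2) ^ 2 * M) := by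
  refine h.lipschitz_comp (Ψ := Complex.log) (S := closedBall 1 (1 / 3)) hu
    (hu.clog fun x => mem_slitPlane_of_norm_sub_one_le (hu1 x))
    (fun x => by simpa [dist_eq_norm] using hu1 x) fun v hv v' hv' => ?_
  refine (convex_closedBall (1 : ℂ) (1 / 3)).norm_image_sub_le_of_norm_deriv_le (𝕜 := ℂ)
    (fun z hz => ?_) (fun z hz => ?_) hv' hv
  all_goals rw [mem_closedBall, dist_eq_norm] at hz
  · exact (Complex.hasDerivAt_log (mem_slitPlane_of_norm_sub_one_le hz)).differentiableAt
  · rw [(Complex.hasDerivAt_log (mem_slitPlane_of_norm_sub_one_le hz)).deriv, norm_inv]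
    have h1 := norm_sub_norm_le (1 : ℂ) z
    rw [norm_one, norm_sub_rev] at h1
    rw [inv_le_comm₀ (by linarith) (by norm_num)]
    linarith

namespace BaseDisk

variable {F : ℂ → ℂ → ℝ} (B : BaseDisk F) (hF : IsSmoothTorusFamily F)
include hF

lemma exists_log_avgGrad_of_energyLE (M₀ : ℝ) : ∃ η M : ℝ, 0 < η ∧ ∀ q q' : UnitAddCircle → ℂ,
    Continuous q → Continuous q' → EnergyLE q M₀ → EnergyLE q' M₀ →
    (∀ x, ‖q x - B.g (circ x)‖ ≤ η) → (∀ x, ‖q' x - B.g (circ x)‖ ≤ η) →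
    ∃ l : UnitAddCircle → ℂ, Continuous l ∧ EnergyLE l M ∧ (∀ x, ‖l x‖ ≤ 1 / 2) ∧
      ∀ x, Complex.exp (B.L x + l x) = avgGrad F x (q x) (q' x) := by
  obtain ⟨C, hC⟩ := B.exists_bounds hF
  have h1C := hC.one_le
  obtain ⟨K, hK0, hK⟩ := exists_lipschitz hF (C + 1)
  have hg : ∀ x, ‖B.g (circ x)‖ ≤ C := fun x => (norm_fst_le (B.coeffs x)).trans
    (hC.norm_coeffs_le x)
  obtain ⟨BL, hBL⟩ := (isCompact_range B.continuous_L).isBounded.exists_norm_le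
  replace hBL : ∀ x, ‖B.L x‖ ≤ BL := fun x => hBL _ ⟨x, rfl⟩
  have heL : EnergyLE (fun x => -B.L x) B.energyL :=
    B.energyLE_L.contraction B.continuous_L continuous_neg fun v v' => by
      rw [neg_sub_neg, norm_sub_rev]
  obtain ⟨W, hW, hexp⟩ : ∃ W : ℝ, 0 < W ∧ ∀ x, ‖Complex.exp (-B.L x)‖ ≤ W :=
    ⟨_, Real.exp_pos BL, fun x => (Complex.norm_exp_le_exp_norm _).trans
      (Real.exp_le_exp.2 (by rw [norm_neg]; exact hBL x))⟩
  obtain ⟨N, hN⟩ : ∃ N, EnergyLE (fun x => Complex.exp (-B.L x)) N := ⟨_, heL.cexp (C := BL)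
    B.continuous_L.neg fun x => by rw [norm_neg]; exact hBL x⟩
  obtain ⟨G, hG⟩ : ∃ G : ℝ, ∀ x, ‖grad F x (B.g (circ x))‖ ≤ G :=
    ⟨Real.exp BL, fun x => by
      rw [← B.exp_L]
      exact (Complex.norm_exp_le_exp_norm _).trans (Real.exp_le_exp.2 (hBL x))⟩
  refine ⟨min 1 (1 / (6 * K * W)),
    (3 / 2) ^ 2 * ((G + 2 * K + W) ^ 2 * (2 * (2 * K) ^ 2 * (M₀ + M₀) + 2 * (2 * K) ^ 2 + N)),
    by positivity, fun q q' qc qc' eq eq' hkg hkg' => ?_⟩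
  set η := min 1 (1 / (6 * K * W))
  have hη1 : η ≤ 1 := min_le_left _ _
  have hηK : 2 * K * η * W ≤ 1 / 3 := by
    have : η ≤ 1 / (6 * K * W) := min_le_right _ _
    rw [le_div_iff₀ (by positivity)] at this
    linarith
  have hR : ∀ k : UnitAddCircle → ℂ, (∀ x, ‖k x - B.g (circ x)‖ ≤ η) → ∀ x, ‖k x‖ ≤ C + 1 :=
      fun k hk x => by
    have := norm_le_norm_add_norm_sub' (k x) (B.g (circ x))
    linarith [hk x, hg x]
  have hkR := hR q hkg
  have hkR' := hR q' hkg'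
  have hgR : ∀ x, ‖B.g (circ x)‖ ≤ C + 1 := fun x => (hg x).trans (by linarith)
  have hlip := fun x s {w w' v v' : ℂ} => avgGrad_lipschitz hF (R := C + 1)
    (fun x s w w' hw hw' => (hK x s w w' hw hw').2.1) hK0.le x s (w := w) (w' := w') (v := v) (v' := v')
  have Qc := continuous_avgGrad hF qc qc'
  have QE : EnergyLE (fun x => avgGrad F x (q x) (q' x))
      (2 * (2 * K) ^ 2 * (M₀ + M₀) + 2 * (2 * K) ^ 2) := by
    have e := eq.prodMk qc qc' eq'
    refine EnergyLE.comp (f := fun x => (q x, q' x)) (K := 2 * K)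
      (Ψ := fun x p => avgGrad F x p.1 p.2)
      (S := {p : ℂ × ℂ | ‖p.1‖ ≤ C + 1 ∧ ‖p.2‖ ≤ C + 1}) (qc.prodMk qc') Qc e
      (fun x => ⟨hkR x, hkR' x⟩) fun x s v hv v' hv' => (hlip x s hv.1 hv.2 hv'.1 hv'.2).trans ?_
    have e1 := norm_fst_le (v - v')
    have e2 := norm_snd_le (v - v')
    simp only [Prod.fst_sub, Prod.snd_sub] at e1 e2
    nlinarith [abs_nonneg s]
  have Qa : ∀ x, ‖avgGrad F x (q x) (q' x) - grad F x (B.g (circ x))‖ ≤ 2 * K * η :=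
    fun x => by
      have := hlip x 0 (hkR x) (hkR' x) (hgR x) (hgR x)
      rw [avgGrad_self, coe_zero, add_zero, abs_zero, zero_add] at this
      nlinarith [hkg x, hkg' x]
  have QB : ∀ x, ‖avgGrad F x (q x) (q' x)‖ ≤ G + 2 * K := fun x => by
    have := norm_le_norm_add_norm_sub' (avgGrad F x (q x) (q' x))
      (grad F x (B.g (circ x)))
    nlinarith [hG x, Qa x]
  generalize hQ : (fun x => avgGrad F x (q x) (q' x)) = Q at Qc QE
  replace hQ := fun x => congrFun hQ x
  simp only [hQ] at Qa QB ⊢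
  have ec : Continuous fun x => Complex.exp (-B.L x) := Complex.continuous_exp.comp B.continuous_L.neg
  have uc : Continuous fun x => Q x * Complex.exp (-B.L x) := Qc.mul ec
  have u1 : ∀ x, ‖Q x * Complex.exp (-B.L x) - 1‖ ≤ 1 / 3 := fun x => by
    have e : Q x * Complex.exp (-B.L x) - 1 =
        (Q x - grad F x (B.g (circ x))) * Complex.exp (-B.L x) := by
      rw [← B.exp_L, sub_mul, ← Complex.exp_add, add_neg_cancel, Complex.exp_zero]
    rw [e, norm_mul]
    exact (mul_le_mul (Qa x) (hexp x) (norm_nonneg _) (by positivity)).trans hηK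
  have uE := QE.mul Qc ec hN QB hexp
  refine ⟨fun x => Complex.log (Q x * Complex.exp (-B.L x)),
    uc.clog fun x => mem_slitPlane_of_norm_sub_one_le (u1 x), uE.clog uc u1,
    fun x => norm_log_le_of_norm_sub_one_le (u1 x), fun x => ?_⟩
  rw [Complex.exp_add, Complex.exp_log
    (slitPlane_ne_zero (mem_slitPlane_of_norm_sub_one_le (u1 x))), mul_left_comm, ← Complex.exp_add,
    add_neg_cancel, Complex.exp_zero, mul_one]

lemma exists_log_avgGrad : ∃ η M : ℝ, 0 < η ∧ η ≤ 1 ∧ ∀ t t' k k',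
    IsLevelDisk F t k → IsLevelDisk F t' k' → CloseOnCircle η B.g k → CloseOnCircle η B.g k' →
    ∃ l : UnitAddCircle → ℂ, Continuous l ∧ EnergyLE l M ∧ (∀ x, ‖l x‖ ≤ 1 / 2) ∧
      ∀ x, Complex.exp (B.L x + l x) = avgGrad F x (k (circ x)) (k' (circ x)) := by
  obtain ⟨C, hC⟩ := B.exists_bounds hF
  obtain ⟨η₀, M₀, hη₀, hη₀1, hE⟩ := hC.exists_energy_bound hF
  obtain ⟨η₁, M, hη₁, h⟩ := B.exists_log_avgGrad_of_energyLE hF M₀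
  refine ⟨min η₀ η₁, M, lt_min hη₀ hη₁, (min_le_left _ _).trans hη₀1,
    fun t t' k k' hk hk' hkg hkg' => ?_⟩
  exact h _ _ hk.hol.continuous_circ hk'.hol.continuous_circ
    (hE t k hk fun x => (hkg x).trans (min_le_left _ _))
    (hE t' k' hk' fun x => (hkg' x).trans (min_le_left _ _))
    (fun x => (hkg x).trans (min_le_right _ _)) fun x => (hkg' x).trans (min_le_right _ _)

/-- The difference of two level disks close to a base disk solves a linear Riemann-Hilbert
problem whose coefficients are controlled by the base disk. -/
lemma exists_difference_formula : ∃ η C : ℝ, 0 < η ∧ η ≤ 1 ∧ 1 ≤ C ∧ ∀ t t' k k',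
    IsLevelDisk F t k → IsLevelDisk F t' k' → CloseOnCircle η B.g k → CloseOnCircle η B.g k' →
    ∃ (E H : ℂ → ℂ) (γ φ : ℝ), (∀ z ∈ closedBall (0 : ℂ) 1,
      E z * (k z - k' z) = (t - t' : ℝ) * H z + γ * I ∧ 1 ≤ C * ‖E z‖ ∧ ‖E z‖ ≤ C ∧ ‖H z‖ ≤ C) ∧
      |φ| ≤ 1 / 2 ∧ E 0 = B.factor 0 * Complex.exp (φ * I) ∧ (H 0).im = 0 := by
  obtain ⟨η, M, hη, hη1, hl⟩ := B.exists_log_avgGrad hF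
  obtain ⟨BL, hBL⟩ := (isCompact_range B.continuous_L).isBounded.exists_norm_le
  replace hBL : ∀ x, ‖B.L x‖ ≤ BL := fun x => hBL _ ⟨x, rfl⟩
  obtain ⟨C', hC'0, hRH⟩ := exists_riemannHilbert_bound (BL + 1 / 2) (4 * (B.energyL + M)) 1 0
  refine ⟨η, Real.exp C' + C', hη, hη1,
    by linarith [Real.add_one_le_exp C'], fun t t' k k' hk hk' hkg hkg' => ?_⟩
  obtain ⟨l, lc, lE, lb, hexpL⟩ := hl t t' k k' hk hk' hkg hkg'
  have Lc : Continuous fun x => B.L x + l x := B.continuous_L.add lc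
  have LE := B.energyLE_L.add B.continuous_L lc lE
  have hb1 : EnergyLE (fun _ : UnitAddCircle => (1 : ℝ)) 0 := energyLE_const _
  obtain ⟨-, -, hbd⟩ := hRH (fun x => B.L x + l x) (fun _ => 1) Lc LE
    (fun x => (norm_add_le _ _).trans (add_le_add (hBL x) (lb x))) continuous_const hb1 (by simp)
  obtain ⟨γ, hγ⟩ := riemannHilbert Lc LE continuous_const hb1 (hk.hol.sub hk'.hol)
    (β := t - t') fun x => by rw [hexpL, ← slice_sub_eq hF, hk.level, hk'.level, mul_one]
  refine ⟨fun z => Complex.exp (rhLog (fun x => B.L x + l x) z),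
    rhSol (fun x => B.L x + l x) fun _ => 1, γ,
    ∫ x, (l x).im ∂haarAddCircle, fun z hz => ⟨hγ z hz, ?_, ?_, ?_⟩, ?_, ?_,
    rhSol_zero_im _ _⟩
  · obtain ⟨h1, -⟩ := hbd z hz
    rw [Complex.norm_exp]
    have h2 := (abs_le.1 ((abs_re_le_norm _).trans h1)).1
    calc (1 : ℝ) = Real.exp C' * Real.exp (-C') := by rw [← Real.exp_add]; simp
      _ ≤ (Real.exp C' + C') * Real.exp (rhLog (fun x => B.L x + l x) z).re := by gcongr; linarith
  · refine (Complex.norm_exp_le_exp_norm _).trans ?_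
    have := Real.exp_le_exp.2 (hbd z hz).1
    linarith
  · have := (hbd z hz).2
    linarith [Real.exp_pos C']
  · exact abs_integral_le_of_abs_le fun x => (abs_im_le_norm _).trans (lb x)
  · simp only [factor]
    rw [← Complex.exp_add, rhLog_zero, rhLog_zero, ← add_mul, ← ofReal_add, ← integral_add]
    · rfl
    · exact integrable_of_continuous (Complex.continuous_im.comp B.continuous_L)
    · exact integrable_of_continuous (Complex.continuous_im.comp lc)

end BaseDisk

lemma exists_preimage_of_perturbation {f : ℝ → ℝ → ℝ} {δ A : ℝ} (hδ : 0 < δ)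
    (hc : ∀ τ, |τ| ≤ δ → ContinuousOn (fun c => f c τ) (Icc (-δ) δ))
    (hi : InjOn (fun c => f c 0) (Icc (-δ) δ)) (h0 : f 0 0 = 0)
    (hA : ∀ c τ, |c| ≤ δ → |τ| ≤ δ → |f c τ - f c 0| ≤ A * |τ|) :
    ∃ ρ : ℝ, 0 < ρ ∧ ρ ≤ δ ∧ ∀ τ y, |τ| ≤ ρ → |y| ≤ ρ → ∃ c, |c| ≤ δ ∧ f c τ = y := by
  have hm : (-δ) ∈ Icc (-δ) δ := ⟨le_rfl, by linarith⟩
  have hM : δ ∈ Icc (-δ) δ := ⟨by linarith, le_rfl⟩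
  have hz : (0 : ℝ) ∈ Icc (-δ) δ := ⟨by linarith, hδ.le⟩
  have habs : |-δ| ≤ δ ∧ |δ| ≤ δ := by rw [abs_neg, abs_of_pos hδ]; exact ⟨le_rfl, le_rfl⟩
  have key : ∃ m : ℝ, 0 < m ∧ (f (-δ) 0 ≤ -m ∧ m ≤ f δ 0 ∨ f δ 0 ≤ -m ∧ m ≤ f (-δ) 0) := by
    rcases (hc 0 (by simpa using hδ.le)).strictMonoOn_of_injOn_Icc' (by linarith) hi with h | h
    · have h1 := h hm hz (by linarith)
      have h2 := h hz hM hδ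
      simp only [h0] at h1 h2
      exact ⟨min (-f (-δ) 0) (f δ 0), lt_min (by linarith) h2, Or.inl
        ⟨by linarith [min_le_left (-f (-δ) 0) (f δ 0)], min_le_right _ _⟩⟩
    · have h1 := h hm hz (by linarith)
      have h2 := h hz hM hδ
      simp only [h0] at h1 h2
      exact ⟨min (f (-δ) 0) (-f δ 0), lt_min h1 (by linarith), Or.inr
        ⟨by linarith [min_le_right (f (-δ) 0) (-f δ 0)], min_le_left _ _⟩⟩
  obtain ⟨m, hm0, hkey⟩ := key
  refine ⟨min δ (min (m / 2) (m / (2 * (|A| + 1)))), by positivity, min_le_left _ _,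
    fun τ y hτ hy => ?_⟩
  have hτδ : |τ| ≤ δ := hτ.trans (min_le_left _ _)
  have hy2 : |y| ≤ m / 2 := hy.trans ((min_le_right _ _).trans (min_le_left _ _))
  have hτ2 : A * |τ| ≤ m / 2 := by
    have h1 : |τ| ≤ m / (2 * (|A| + 1)) := hτ.trans ((min_le_right _ _).trans (min_le_right _ _))
    rw [le_div_iff₀ (by positivity)] at h1
    nlinarith [le_abs_self A, abs_nonneg τ]
  have h1 := abs_le.1 ((hA (-δ) τ habs.1 hτδ).trans hτ2)
  have h2 := abs_le.1 ((hA δ τ habs.2 hτδ).trans hτ2)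
  obtain ⟨hy3, hy4⟩ := abs_le.1 hy2
  have hy5 : y ∈ uIcc (f (-δ) τ) (f δ τ) := by
    rw [mem_uIcc]
    rcases hkey with h | h
    · left; constructor <;> linarith
    · right; constructor <;> linarith
  have := intermediate_value_uIcc (f := fun c => f c τ) (a := -δ) (b := δ)
    (by rw [uIcc_of_le (by linarith)]; exact hc τ hτδ) hy5
  rw [uIcc_of_le (by linarith)] at this
  obtain ⟨c, hc1, hc2⟩ := this
  exact ⟨c, abs_le.2 hc1, hc2⟩

/-- Two nearby points on one level curve with the same tangential coordinate agree. -/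
lemma exists_planar_unique {F : ℂ → ℂ → ℝ} (hF : IsSmoothTorusFamily F) (x : UnitAddCircle) {p : ℂ}
    (hp : p ≠ 0) : ∃ η : ℝ, 0 < η ∧ ∀ w w', ‖w - p‖ ≤ η → ‖w' - p‖ ≤ η →
      F (circ x) w = F (circ x) w' → (grad F x p * (w - w')).im = 0 → w = w' := by
  obtain ⟨K, hK0, hK⟩ := exists_lipschitz hF (‖p‖ + 1)
  have ha : 0 < ‖grad F x p‖ := norm_pos_iff.2 (grad_ne_zero hF x hp)
  refine ⟨min 1 (‖grad F x p‖ / (4 * K)), by positivity, fun w w' hw hw' hl him => ?_⟩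
  have hR : ∀ w, ‖w - p‖ ≤ min 1 (‖grad F x p‖ / (4 * K)) → ‖w‖ ≤ ‖p‖ + 1 := fun w hw => by
    have := norm_le_norm_add_norm_sub' w p
    linarith [hw.trans (min_le_left _ _)]
  have h1 := avgGrad_lipschitz hF (R := ‖p‖ + 1) (fun x s w w' hw hw' => (hK x s w w' hw hw').2.1)
    hK0.le x 0 (hR w hw) (hR w' hw') (v := p) (v' := p) (by linarith) (by linarith)
  rw [avgGrad_self, coe_zero, add_zero, abs_zero, zero_add] at h1
  have h2 := hw.trans (min_le_right _ _)
  have h3 := hw'.trans (min_le_right _ _)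
  rw [le_div_iff₀ (by positivity)] at h2 h3
  have h4 : ‖avgGrad F x w w' - grad F x p‖ ≤ ‖grad F x p‖ / 2 := by linarith
  have h5 := slice_sub_eq hF x w w'
  rw [hl, sub_self] at h5
  have h6 : ((grad F x p - avgGrad F x w w') * (w - w')).re = (grad F x p * (w - w')).re := by
    rw [sub_mul, sub_re, ← h5, sub_zero]
  have h7 := Complex.norm_le_abs_re_add_abs_im (grad F x p * (w - w'))
  rw [him, abs_zero, add_zero, ← h6] at h7
  have h8 := h7.trans (abs_re_le_norm _)
  rw [norm_mul, norm_mul, norm_sub_rev (grad F x p)] at h8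
  have h9 : ‖w - w'‖ ≤ 0 := by nlinarith [norm_nonneg (w - w')]
  exact sub_eq_zero.1 (norm_le_zero_iff.1 h9)

lemma CloseOnCircle.mono {η η' : ℝ} {g k : ℂ → ℂ} (h : CloseOnCircle η g k) (hη : η ≤ η') :
    CloseOnCircle η' g k := fun x => (h x).trans hη

namespace BaseDisk

variable {F : ℂ → ℂ → ℝ} (B : BaseDisk F) (hF : IsSmoothTorusFamily F)
include hF

/-- Comparison of level disks close to a base disk. -/
lemma exists_comparison : ∃ η C : ℝ, 0 < η ∧ η ≤ 1 ∧ 1 ≤ C ∧ ∀ t t' k k',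
    IsLevelDisk F t k → IsLevelDisk F t' k' → CloseOnCircle η B.g k → CloseOnCircle η B.g k' →
    ∀ w ∈ closedBall (0 : ℂ) 1,
      (∀ z ∈ closedBall (0 : ℂ) 1, ‖k w - k' w‖ ≤ C * (‖k z - k' z‖ + |t - t'|)) ∧
      ‖k w - k' w‖ ≤ C * (|(B.factor 0 * (k 0 - k' 0)).im| + |t - t'|) := by
  obtain ⟨η, C, hη, hη1, hC, h⟩ := B.exists_difference_formula hF
  refine ⟨η, 4 * C ^ 2, hη, hη1, by nlinarith, fun t t' k k' hk hk' hkg hkg' w hw => ?_⟩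
  obtain ⟨E, H, γ, φ, hEH, hφ, hE0, hH0⟩ := h t t' k k' hk hk' hkg hkg'
  have key : ‖k w - k' w‖ ≤ C * (C * |t - t'| + |γ|) := by
    obtain ⟨h1, h2, h3, h4⟩ := hEH w hw
    have h5 : ‖E w‖ * ‖k w - k' w‖ ≤ C * |t - t'| + |γ| := by
      rw [← norm_mul, h1]
      refine (norm_add_le _ _).trans ?_
      simp only [norm_mul, norm_real, norm_I, mul_one, Real.norm_eq_abs]
      nlinarith [abs_nonneg (t - t')]
    calc ‖k w - k' w‖ ≤ (C * ‖E w‖) * ‖k w - k' w‖ :=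
          le_mul_of_one_le_left (norm_nonneg _) h2
      _ = C * (‖E w‖ * ‖k w - k' w‖) := by ring
      _ ≤ _ := by gcongr
  have fin : ∀ A : ℝ, 0 ≤ A → |γ| ≤ 2 * (C * A + C * |t - t'|) →
      ‖k w - k' w‖ ≤ 4 * C ^ 2 * (A + |t - t'|) := fun A hA hγ => by
    nlinarith [abs_nonneg (t - t'), mul_nonneg (sq_nonneg C) hA,
      mul_nonneg (sq_nonneg C) (abs_nonneg (t - t'))]
  refine ⟨fun z hz => fin _ (norm_nonneg _) ?_, fin _ (abs_nonneg _) ?_⟩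
  · obtain ⟨h1, h2, h3, h4⟩ := hEH z hz
    have h5 : (γ : ℂ) * I = E z * (k z - k' z) - (t - t' : ℝ) * H z := by rw [h1]; ring
    have h6 : |γ| = ‖(γ : ℂ) * I‖ := by simp
    have h7 : |γ| ≤ ‖E z‖ * ‖k z - k' z‖ + |t - t'| * ‖H z‖ := by
      rw [h6, h5]
      refine (norm_sub_le _ _).trans ?_
      rw [norm_mul, norm_mul, norm_real, Real.norm_eq_abs]
    nlinarith [norm_nonneg (k z - k' z), abs_nonneg (t - t'),
      mul_le_mul_of_nonneg_right h3 (norm_nonneg (k z - k' z)),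
      mul_le_mul_of_nonneg_left h4 (abs_nonneg (t - t'))]
  · obtain ⟨h1, h2, h3, h4⟩ := hEH 0 (by simp)
    set u := B.factor 0 * (k 0 - k' 0)
    have h5 : u * Complex.exp (φ * I) = (t - t' : ℝ) * H 0 + γ * I := by
      rw [← h1, hE0]; ring
    have h6 : u = ((t - t' : ℝ) * H 0 + γ * I) * Complex.exp (-(φ * I)) := by
      rw [← h5, mul_assoc, ← Complex.exp_add, add_neg_cancel, Complex.exp_zero, mul_one]
    have h7 : u.im = γ * Real.cos φ - (t - t') * (H 0).re * Real.sin φ := by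
      rw [h6, ← neg_mul, ← ofReal_neg, Complex.exp_mul_I, ← ofReal_cos, ← ofReal_sin]
      simp [hH0, -ofReal_cos, -ofReal_sin]; ring
    have h8 : (7 / 8 : ℝ) ≤ Real.cos φ := by
      have := Real.one_sub_sq_div_two_le_cos (x := φ)
      have := sq_le_sq' (abs_le.1 hφ).1 (abs_le.1 hφ).2
      linarith
    have h9 : |γ| * Real.cos φ ≤ |u.im| + |t - t'| * C := by
      rw [← abs_of_pos (show 0 < Real.cos φ by linarith), ← abs_mul,
        show γ * Real.cos φ = u.im + (t - t') * (H 0).re * Real.sin φ by rw [h7]; ring]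
      refine (abs_add_le _ _).trans ?_
      rw [abs_mul, abs_mul]
      have := mul_le_mul ((abs_re_le_norm (H 0)).trans h4) (Real.abs_sin_le_one φ) (abs_nonneg _)
        (by linarith)
      nlinarith [abs_nonneg (t - t')]
    nlinarith [abs_nonneg γ, abs_nonneg u.im, abs_nonneg (t - t')]

/-- Level disks close to a base disk exist through every nearby point of the fiber over `1`. -/
lemma exists_levelDisk_through {ε : ℝ} (hε : 0 < ε) : ∃ δ : ℝ, 0 < δ ∧ ∀ w, ‖w - B.g 1‖ ≤ δ →
    ∃ k, IsLevelDisk F (F 1 w) k ∧ k 1 = w ∧ CloseOnCircle ε B.g k := by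
  obtain ⟨C, hC⟩ := B.exists_bounds hF
  obtain ⟨η, A, hη, hη1, hA, hcmp⟩ := B.exists_comparison hF
  have hp0 : B.g (circ 0) ≠ 0 := B.ne_zero _ (circ_mem_closedBall 0)
  obtain ⟨η', hη', huniq⟩ := exists_planar_unique hF 0 hp0
  set ε' := min ε (min η η')
  have hε' : 0 < ε' := by positivity
  have hε'1 : ε' ≤ ε := min_le_left _ _
  have hε'2 : ε' ≤ η := (min_le_right _ _).trans (min_le_left _ _)
  have hε'3 : ε' ≤ η' := (min_le_right _ _).trans (min_le_right _ _)
  obtain ⟨δ, hδ, hex⟩ := hC.exists_levelDisk hF hε'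
  choose! k hk hk0 hkg using hex
  have h1b : (1 : ℂ) ∈ closedBall (0 : ℂ) 1 := by simp
  have h0b : (0 : ℂ) ∈ closedBall (0 : ℂ) 1 := by simp
  have hcirc0 : circ 0 = 1 := circ_zero
  rw [hcirc0] at huniq
  have huniq' : ∀ w w', ‖w - B.g 1‖ ≤ η' → ‖w' - B.g 1‖ ≤ η' → F 1 w = F 1 w' →
      (B.factor 1 * (w - B.g 1)).im = (B.factor 1 * (w' - B.g 1)).im → w = w' := by
    intro w w' hw hw' hl him
    refine huniq w w' hw hw' hl ?_
    have h1 := B.factor_circ 0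
    rw [hcirc0] at h1
    have h2 : (B.factor 1 * (w - w')).im = 0 := by
      rw [show w - w' = (w - B.g 1) - (w' - B.g 1) by ring, mul_sub, sub_im, him, sub_self]
    rw [h1, mul_assoc, im_ofReal_mul] at h2
    exact (mul_eq_zero.1 h2).resolve_left (rhWeight_pos _ _).ne'
  have hk1 : ∀ c τ, |c| ≤ δ → |τ| ≤ δ → ‖k c τ 1 - B.g 1‖ ≤ η' := fun c τ hc hτ => by
    have := hkg c τ hc hτ 0
    rw [hcirc0] at this
    exact this.trans hε'3
  have hkl : ∀ c τ, |c| ≤ δ → |τ| ≤ δ → F 1 (k c τ 1) = B.t + τ := fun c τ hc hτ => by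
    have := (hk c τ hc hτ).level 0
    rwa [hcirc0] at this
  have hlip : ∀ c τ c' τ', |c| ≤ δ → |τ| ≤ δ → |c'| ≤ δ → |τ'| ≤ δ →
      ∀ z ∈ closedBall (0 : ℂ) 1, ‖k c τ z - k c' τ' z‖ ≤ A * (|c - c'| + |τ - τ'|) := by
    intro c τ c' τ' hc hτ hc' hτ' z hz
    have := (hcmp _ _ _ _ (hk c τ hc hτ) (hk c' τ' hc' hτ') ((hkg c τ hc hτ).mono hε'2)
      ((hkg c' τ' hc' hτ').mono hε'2) z hz).2
    rwa [show k c τ 0 - k c' τ' 0 = (k c τ 0 - B.g 0) - (k c' τ' 0 - B.g 0) by ring, mul_sub,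
      sub_im, hk0 c τ hc hτ, hk0 c' τ' hc' hτ', add_sub_add_left_eq_sub] at this
  have hylip : ∀ c τ c' τ', |c| ≤ δ → |τ| ≤ δ → |c'| ≤ δ → |τ'| ≤ δ →
      |(B.factor 1 * (k c τ 1 - B.g 1)).im - (B.factor 1 * (k c' τ' 1 - B.g 1)).im| ≤
        C * A * (|c - c'| + |τ - τ'|) := by
    intro c τ c' τ' hc hτ hc' hτ'
    rw [← sub_im, ← mul_sub, sub_sub_sub_cancel_right]
    refine (abs_im_le_norm _).trans ?_
    rw [norm_mul, mul_assoc]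
    exact mul_le_mul (hC.norm_factor_le 1 h1b) (hlip c τ c' τ' hc hτ hc' hτ' 1 h1b) (norm_nonneg _)
      (by linarith [hC.one_le])
  have habs0 : |(0 : ℝ)| ≤ δ := by simpa using hδ.le
  obtain ⟨ρ, hρ, hρδ, hpre⟩ := exists_preimage_of_perturbation (A := C * A)
    (f := fun c τ => (B.factor 1 * (k c τ 1 - B.g 1)).im) hδ
    (fun τ hτ => by
      refine LipschitzOnWith.continuousOn (K := (C * A).toNNReal) ?_
      refine LipschitzOnWith.of_dist_le_mul fun c hc c' hc' => ?_
      have := hylip c τ c' τ (abs_le.2 hc) hτ (abs_le.2 hc') hτ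
      rw [Real.coe_toNNReal _ (by have := hC.one_le; positivity), Real.dist_eq, Real.dist_eq]
      simpa using this)
    (fun c hc c' hc' h => by
      replace hc := abs_le.2 hc
      replace hc' := abs_le.2 hc'
      have h1 := huniq' _ _ (hk1 c 0 hc habs0) (hk1 c' 0 hc' habs0)
        (by rw [hkl c 0 hc habs0, hkl c' 0 hc' habs0]) h
      have h2 := (hcmp _ _ _ _ (hk c 0 hc habs0) (hk c' 0 hc' habs0) ((hkg c 0 hc habs0).mono hε'2)
        ((hkg c' 0 hc' habs0).mono hε'2) 0 h0b).1 1 h1b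
      rw [h1, sub_self, norm_zero, sub_self, abs_zero, add_zero, mul_zero] at h2
      have h3 := sub_eq_zero.1 (norm_le_zero_iff.1 h2)
      rw [← hk0 c 0 hc habs0, ← hk0 c' 0 hc' habs0, h3])
    (by
      have h2 := (hcmp _ _ _ _ (hk 0 0 habs0 habs0) B.isLevelDisk ((hkg 0 0 habs0 habs0).mono hε'2)
        (fun x => by simpa using hη.le) 1 h1b).2
      rw [hk0 0 0 habs0 habs0, abs_zero, zero_add, add_sub_cancel_left, abs_zero, mul_zero] at h2
      simp only [norm_le_zero_iff.1 h2, mul_zero, zero_im])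
    (fun c τ hc hτ => by simpa using hylip c τ c 0 hc hτ hc habs0)
  have hlev : F 1 (B.g 1) = B.t := by
    have := B.isLevelDisk.level 0
    rwa [hcirc0] at this
  have hcont : Continuous (F 1) := by
    have := (contDiff_slice hF 0).continuous
    rwa [hcirc0] at this
  obtain ⟨d, hd, hdρ⟩ := Metric.continuous_iff.1 hcont (B.g 1) ρ hρ
  refine ⟨min (min (d / 2) η') (ρ / C), by have := hC.one_le; positivity, fun w hw => ?_⟩
  have hw1 : ‖w - B.g 1‖ < d :=
    (hw.trans ((min_le_left _ _).trans (min_le_left _ _))).trans_lt (half_lt_self hd)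
  have hw2 : ‖w - B.g 1‖ ≤ η' := hw.trans ((min_le_left _ _).trans (min_le_right _ _))
  have hw3 : C * ‖w - B.g 1‖ ≤ ρ := by
    have h1 := hw.trans (min_le_right _ _)
    rw [le_div_iff₀ (by linarith [hC.one_le])] at h1
    linarith
  have hτ : |F 1 w - B.t| ≤ ρ := by
    have := hdρ w (by rwa [dist_eq_norm])
    rw [Real.dist_eq, hlev] at this
    exact this.le
  obtain ⟨c, hc, hyc⟩ := hpre (F 1 w - B.t) ((B.factor 1 * (w - B.g 1)).im) hτ (by
    refine (abs_im_le_norm _).trans (le_trans ?_ hw3)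
    rw [norm_mul]
    gcongr
    exact hC.norm_factor_le 1 h1b)
  have hτδ := hτ.trans hρδ
  have hlev' := hk c _ hc hτδ
  rw [add_sub_cancel] at hlev'
  refine ⟨k c (F 1 w - B.t), hlev', ?_, (hkg c _ hc hτδ).mono hε'1⟩
  exact huniq' _ _ (hk1 c _ hc hτδ) hw2 (by rw [hkl c _ hc hτδ, add_sub_cancel]) hyc

end BaseDisk

lemma EnergyLE.translate {E : Type*} [NormedAddCommGroup E] {f : UnitAddCircle → E} {M : ℝ}
    (h : EnergyLE f M) (s : UnitAddCircle) : EnergyLE (fun x => f (x + s)) M := fun r => by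
  have := integral_add_right_eq_self (μ := haarAddCircle)
    (fun x : UnitAddCircle => ‖f (x + (r : UnitAddCircle)) - f x‖ ^ 2) s
  have e : ∀ x, x + s + (r : UnitAddCircle) = x + r + s := fun x => add_right_comm _ _ _
  simp only [e] at this
  exact this.trans_le (h r)

lemma exists_norm_translate_sub_le {f : UnitAddCircle → ℂ} (hf : Continuous f) {η : ℝ}
    (hη : 0 < η) : ∃ s₀ : ℝ, 0 < s₀ ∧ ∀ s : ℝ, |s| ≤ s₀ → ∀ x,
      ‖f (x + (s : UnitAddCircle)) - f x‖ ≤ η := by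
  obtain ⟨δ, hδ, h⟩ := Metric.uniformContinuous_iff.1
    (CompactSpace.uniformContinuous_of_continuous hf) η hη
  refine ⟨δ / 2, by positivity, fun s hs x => ?_⟩
  rw [← dist_eq_norm]
  refine (h ?_).le
  rw [dist_eq_norm, add_sub_cancel_left]
  have h1 : ‖(s : UnitAddCircle)‖ ≤ ‖s‖ := QuotientAddGroup.norm_mk_le_norm
  rw [Real.norm_eq_abs] at h1
  linarith

namespace BaseDisk
variable {F : ℂ → ℂ → ℝ} (B : BaseDisk F) (hF : IsSmoothTorusFamily F)
include hF

lemma exists_energyLE_translate_sub : ∃ s₀ N : ℝ, 0 < s₀ ∧ ∀ s : ℝ, 0 < s → s ≤ s₀ →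
    EnergyLE (fun x => B.g (circ (x + (s : UnitAddCircle))) - B.g (circ x)) (s ^ 2 * N) := by
  have hk := B.isLevelDisk
  have gc := hk.hol.continuous_circ
  obtain ⟨M, hM⟩ := hk.energy
  obtain ⟨η, Ml, hη, hl⟩ := B.exists_log_avgGrad_of_energyLE hF M
  obtain ⟨s₀, hs₀, hsmall⟩ := exists_norm_translate_sub_le gc hη
  obtain ⟨R, hR⟩ := (isCompact_range gc).isBounded.exists_norm_le
  replace hR : ∀ x, ‖B.g (circ x)‖ ≤ R := fun x => hR _ ⟨x, rfl⟩
  obtain ⟨K, hK0, hK⟩ := exists_lipschitz hF R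
  obtain ⟨BL, hBL⟩ := (isCompact_range B.continuous_L).isBounded.exists_norm_le
  replace hBL : ∀ x, ‖B.L x‖ ≤ BL := fun x => hBL _ ⟨x, rfl⟩
  obtain ⟨C, hC0, hRH⟩ := exists_riemannHilbert_bound (BL + 1 / 2) (4 * (B.energyL + Ml)) K
    (2 * K ^ 2 * M + 2 * K ^ 2)
  refine ⟨s₀, (Real.exp C + C) ^ 2 * (Real.exp C ^ 2 * C + C), hs₀, fun s hs hss => ?_⟩
  have qc : Continuous fun x => B.g (circ (x + (s : UnitAddCircle))) :=
    continuous_translate gc s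
  have qE : EnergyLE (fun x => B.g (circ (x + (s : UnitAddCircle)))) M := hM.translate s
  obtain ⟨l, lc, lE, lb, hexp⟩ := hl _ _ qc gc qE hM
    (hsmall s (by rwa [abs_of_pos hs])) (fun x => by simpa using hη.le)
  have Lc : Continuous fun x => B.L x + l x := B.continuous_L.add lc
  have LE := B.energyLE_L.add B.continuous_L lc lE
  have LB : ∀ x, ‖B.L x + l x‖ ≤ BL + 1 / 2 :=
    fun x => (norm_add_le _ _).trans (add_le_add (hBL x) (lb x))
  obtain ⟨b, hb⟩ : ∃ b : UnitAddCircle → ℝ, ∀ x, b x = (F (circ x) (B.g (circ (x + s))) -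
      F (circ (x + s)) (B.g (circ (x + s)))) / s := ⟨_, fun _ => rfl⟩
  have hbf := funext hb
  have bc : Continuous b := by
    have h1 := (continuous_slice hF).comp (continuous_id.prodMk qc)
    have h2 := (continuous_slice hF).comp ((continuous_add_const (s : UnitAddCircle)).prodMk qc)
    rw [hbf]
    exact (h1.sub h2).div_const s
  have bE : EnergyLE b (2 * K ^ 2 * M + 2 * K ^ 2) := by
    rw [hbf] at bc ⊢
    refine EnergyLE.comp (f := fun x => B.g (circ (x + (s : UnitAddCircle)))) (K := K)
      (Ψ := fun x v => (F (circ x) v - F (circ (x + s)) v) / s) (S := closedBall 0 R) qc bc qE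
      (fun x => by simpa using hR (x + s)) fun x r v hv v' hv' => ?_
    have h := (hK x r v v' (by simpa using hv) (by simpa using hv')).2.2 s
    rw [← sub_div, Real.norm_eq_abs, abs_div, div_le_iff₀ (abs_pos.2 hs.ne'),
      add_right_comm x (r : UnitAddCircle), ← abs_neg]
    refine le_of_eq_of_le (congrArg _ ?_) (h.trans_eq ?_) <;> ring
  have bB : ∀ x, |b x| ≤ K := fun x => by
    have h := (hK x s _ _ (hR (x + s)) (hR (x + s))).1
    rw [hb, abs_div, div_le_iff₀ (abs_pos.2 hs.ne'), abs_sub_comm]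
    simpa using h
  obtain ⟨E1, E2, hbd⟩ := hRH _ b Lc LE LB bc bE bB
  obtain ⟨c, hc⟩ := riemannHilbert Lc LE bc bE ((hk.hol.comp_rotation s).sub hk.hol) (β := s)
    fun x => by
      rw [hexp, ← circ_add, add_comm (s : UnitAddCircle) x, ← slice_sub_eq hF, hk.level, hb,
        hk.level (x + s)]
      field_simp
  have hc0 : c = 0 := by
    have h := congrArg Complex.im (hc 0 (by simp))
    simpa [rhSol_zero_im] using h.symm
  have hD : ∀ x, B.g (circ (x + (s : UnitAddCircle))) - B.g (circ x) = (s : ℂ) *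
      (Complex.exp (-rhLog (fun x => B.L x + l x) (circ x)) *
        rhSol (fun x => B.L x + l x) b (circ x)) := fun x => by
    have h := hc (circ x) (circ_mem_closedBall x)
    simp only [hc0, ofReal_zero, zero_mul, add_zero] at h
    rw [← circ_add, add_comm (s : UnitAddCircle) x] at h
    rw [mul_left_comm, ← h, ← mul_assoc, ← Complex.exp_add, neg_add_cancel, Complex.exp_zero,
      one_mul]
  have c1 := (holDisk_rhLog Lc LE).neg.continuous_circ
  have c2 := (holDisk_rhSol Lc LE bc bE).continuous_circ
  have e1 : EnergyLE (fun x => -rhLog (fun x => B.L x + l x) (circ x)) C :=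
    E1.contraction (holDisk_rhLog Lc LE).continuous_circ continuous_neg fun v v' => by
      rw [neg_sub_neg, norm_sub_rev]
  have B1 : ∀ x, ‖-rhLog (fun x => B.L x + l x) (circ x)‖ ≤ C := fun x => by
    rw [norm_neg]; exact (hbd _ (circ_mem_closedBall x)).1
  have e2 := (e1.cexp c1 B1).mul (Complex.continuous_exp.comp c1) c2 E2
    (fun x => (Complex.norm_exp_le_exp_norm _).trans (Real.exp_le_exp.2 (B1 x)))
    (fun x => (hbd _ (circ_mem_closedBall x)).2)
  rw [funext hD]
  have e3 := e2.lipschitz_comp (Ψ := fun v => (s : ℂ) * v) (S := univ) (K := s)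
    ((Complex.continuous_exp.comp c1).mul c2)
    (continuous_const.mul ((Complex.continuous_exp.comp c1).mul c2)) (fun _ => mem_univ _)
    (fun v _ v' _ => by rw [← mul_sub, norm_mul, norm_real, Real.norm_eq_abs, abs_of_pos hs])
  exact e3

end BaseDisk

lemma sum_pow_four_le {f : UnitAddCircle → ℂ} (hf : Continuous f) {s₀ N : ℝ} (hs₀ : 0 < s₀)
    (h : ∀ s : ℝ, 0 < s → s ≤ s₀ →
      EnergyLE (fun x => f (x + (s : UnitAddCircle)) - f x) (s ^ 2 * N)) (S : Finset ℤ) :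
    ∑ n ∈ S, (n : ℝ) ^ 4 * ‖fourierCoeff f n‖ ^ 2 ≤ N := by
  obtain ⟨s, hs, hs', hS⟩ := exists_pos_small S hs₀
  have hc : Continuous fun x => f (x + (s : UnitAddCircle)) - f x :=
    (continuous_translate hf s).sub hf
  have h1 := (h s hs hs').sum_le hc S
  have h2 : s ^ 2 * ∑ n ∈ S, (n : ℝ) ^ 4 * ‖fourierCoeff f n‖ ^ 2 ≤ s ^ 2 * N := by
    refine le_trans ?_ h1
    rw [Finset.mul_sum]
    refine Finset.sum_le_sum fun n hn => ?_
    rw [fourierCoeff_translate_sub hf, norm_mul, mul_pow]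
    have h3 := abs_le_norm_fourier_sub_one (hS n hn)
    have h4 : (n * s) ^ 2 ≤ ‖fourier n (s : UnitAddCircle) - 1‖ ^ 2 := by
      rw [← sq_abs]; gcongr
    calc s ^ 2 * ((n : ℝ) ^ 4 * ‖fourierCoeff f n‖ ^ 2)
        = (n : ℝ) ^ 2 * ((n * s) ^ 2 * ‖fourierCoeff f n‖ ^ 2) := by ring
      _ ≤ _ := by gcongr
  exact le_of_mul_le_mul_left h2 (by positivity)

lemma summable_rpow_of_sum_le {a : ℕ → ℂ} {N : ℝ}
    (h : ∀ S : Finset ℕ, ∑ n ∈ S, (n : ℝ) ^ 4 * ‖a n‖ ^ 2 ≤ N) :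
    Summable fun n : ℕ => (n : ℝ) ^ (5 / 4 : ℝ) * ‖a n‖ := by
  have h1 : Summable fun n : ℕ => (n : ℝ) ^ 4 * ‖a n‖ ^ 2 :=
    summable_of_sum_le (fun _ => by positivity) h
  have h2 : Summable fun n : ℕ => (n : ℝ) ^ (-(3 / 2) : ℝ) :=
    Real.summable_nat_rpow.2 (by norm_num)
  refine Summable.of_nonneg_of_le (fun _ => by positivity) (fun n => ?_) (h1.add h2)
  rcases n.eq_zero_or_pos with rfl | hn
  · rw [Nat.cast_zero, Real.zero_rpow (by norm_num)]; simp
  have hn' : (0 : ℝ) < n := by exact_mod_cast hn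
  have e1 : (n : ℝ) ^ (5 / 4 : ℝ) = (n : ℝ) ^ 2 * (n : ℝ) ^ (-(3 / 4) : ℝ) := by
    rw [← Real.rpow_natCast, ← Real.rpow_add hn']; norm_num
  have e2 : (n : ℝ) ^ (-(3 / 2) : ℝ) = ((n : ℝ) ^ (-(3 / 4) : ℝ)) ^ 2 := by
    rw [← Real.rpow_natCast, ← Real.rpow_mul hn'.le]; norm_num
  rw [e1, e2]
  have : 0 ≤ (n : ℝ) ^ 2 * ‖a n‖ := by positivity
  nlinarith [sq_nonneg ((n : ℝ) ^ 2 * ‖a n‖ - (n : ℝ) ^ (-(3 / 4) : ℝ)),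
    Real.rpow_nonneg hn'.le (-(3 / 4))]

lemma norm_pow_sub_pow_le {z w : ℂ} (hz : ‖z‖ ≤ 1) (hw : ‖w‖ ≤ 1) (n : ℕ) :
    ‖z ^ n - w ^ n‖ ≤ n * ‖z - w‖ := by
  induction n with
  | zero => simp
  | succ n ih =>
    have e : z ^ (n + 1) - w ^ (n + 1) = z * (z ^ n - w ^ n) + (z - w) * w ^ n := by ring
    rw [e]
    refine (norm_add_le _ _).trans ?_
    rw [norm_mul, norm_mul, norm_pow]
    have h1 := mul_le_mul hz ih (norm_nonneg _) zero_le_one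
    have h2 := mul_le_of_le_one_right (norm_nonneg (z - w)) (pow_le_one₀ (norm_nonneg w) hw (n := n))
    push_cast
    linarith

lemma norm_pow_sub_pow_le_rpow {z w : ℂ} (hz : ‖z‖ ≤ 1) (hw : ‖w‖ ≤ 1) (n : ℕ) :
    ‖z ^ n - w ^ n‖ ≤ 2 * ((n : ℝ) ^ (1 / 4 : ℝ) * ‖z - w‖ ^ (1 / 4 : ℝ)) := by
  rw [← Real.mul_rpow (by positivity) (norm_nonneg _)]
  have hx : 0 ≤ (n : ℝ) * ‖z - w‖ := by positivity
  have h1 := norm_pow_sub_pow_le hz hw n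
  rcases le_total ((n : ℝ) * ‖z - w‖) 1 with h | h
  · have h2 := Real.rpow_le_rpow_of_exponent_ge_of_imp hx h (by norm_num : (1 / 4 : ℝ) ≤ 1)
      (by norm_num)
    rw [Real.rpow_one] at h2
    linarith
  · have h2 := Real.one_le_rpow h (by norm_num : (0 : ℝ) ≤ 1 / 4)
    have h3 := norm_sub_le (z ^ n) (w ^ n)
    rw [norm_pow, norm_pow] at h3
    linarith [pow_le_one₀ (norm_nonneg w) hw (n := n), pow_le_one₀ (norm_nonneg z) hz (n := n)]

lemma c1AlphaOnDisk_of_hasSum {a : ℕ → ℂ} {g : ℂ → ℂ}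
    (ha : Summable fun n : ℕ => (n : ℝ) ^ (5 / 4 : ℝ) * ‖a n‖)
    (hg : ∀ z ∈ closedBall (0 : ℂ) 1, HasSum (fun n => a n * z ^ n) (g z)) :
    C1AlphaOnDisk g (1 / 4) := by
  have hb := (summable_nat_add_iff 1).2 ha
  set b : ℕ → ℂ := fun n => (n + 1) * a (n + 1) with hbdef
  have hbn : ∀ n : ℕ, ‖b n‖ = (n + 1) * ‖a (n + 1)‖ := fun n => by
    rw [hbdef]
    simp only [norm_mul]
    congr 1
    exact_mod_cast Complex.norm_natCast (n + 1)
  have hb' : Summable fun n : ℕ => (n : ℝ) ^ (1 / 4 : ℝ) * ‖b n‖ := by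
    refine Summable.of_nonneg_of_le (fun _ => by positivity) (fun n => ?_) hb
    have e : ((n : ℝ) + 1) ^ (5 / 4 : ℝ) = ((n : ℝ) + 1) ^ (1 / 4 : ℝ) * ((n : ℝ) + 1) := by
      rw [← Real.rpow_add_one (by positivity)]; norm_num
    push_cast
    rw [hbn, e, mul_assoc]
    gcongr
    linarith
  have hbs : Summable fun n => ‖b n‖ := by
    refine Summable.of_nonneg_of_le (fun _ => by positivity) (fun n => ?_) hb
    push_cast
    rw [hbn]
    gcongr
    have h1 : (1 : ℝ) ≤ (n : ℝ) + 1 := by linarith [Nat.cast_nonneg (α := ℝ) n]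
    simpa using Real.rpow_le_rpow_of_exponent_le h1 (by norm_num : (1 : ℝ) ≤ 5 / 4)
  have hH := holDisk_powerSeries hbs
  refine ⟨_, fun z hz => ?_, hH.1, 2 * ∑' n : ℕ, (n : ℝ) ^ (1 / 4 : ℝ) * ‖b n‖,
    fun z hz w hw => ?_⟩
  · have hu : Summable fun n : ℕ => (n : ℝ) * ‖a n‖ := by
      refine (summable_nat_add_iff 1).1 (hbs.congr fun n => ?_)
      rw [hbn]; push_cast; rfl
    have hd := hasDerivAt_tsum_of_isPreconnected (g := fun n z => a n * z ^ n)
      (g' := fun n z => a n * (n * z ^ (n - 1))) (t := ball (0 : ℂ) 1) (y₀ := z) hu isOpen_ball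
      (convex_ball 0 1).isPreconnected (fun n y _ => (hasDerivAt_pow n y).const_mul _)
      (fun n y hy => ?_) hz (hg z (ball_subset_closedBall hz)).summable hz
    · have hs : Summable fun n : ℕ => a n * (n * z ^ (n - 1)) := by
        refine (summable_nat_add_iff 1).1
          ((hasSum_powerSeries hbs (ball_subset_closedBall hz)).summable.congr fun n => ?_)
        simp only [hbdef, add_tsub_cancel_right]
        push_cast; ring
      rw [hs.tsum_eq_zero_add] at hd
      simp only [CharP.cast_eq_zero, zero_mul, mul_zero, zero_add, add_tsub_cancel_right] at hd
      have e : ∑' n, b n * z ^ n = ∑' n : ℕ, a (n + 1) * (((n + 1 : ℕ) : ℂ) * z ^ n) :=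
        tsum_congr fun n => by simp only [hbdef]; push_cast; ring
      rw [e]
      refine hd.congr_of_eventuallyEq ?_
      filter_upwards [isOpen_ball.mem_nhds hz] with y hy
      exact (hg y (ball_subset_closedBall hy)).tsum_eq.symm
    · rw [norm_mul, norm_mul, norm_pow, Complex.norm_natCast, mul_left_comm]
      have : ‖y‖ ^ (n - 1) ≤ 1 := pow_le_one₀ (norm_nonneg _) (mem_ball_zero_iff.1 hy).le
      gcongr
      exact mul_le_of_le_one_right (norm_nonneg _) this
  · have h1 := (hasSum_powerSeries hbs hz).sub (hasSum_powerSeries hbs hw)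
    rw [← h1.tsum_eq]
    rw [mul_right_comm, ← tsum_mul_left]
    refine tsum_of_norm_bounded (Summable.hasSum (hb'.mul_left _)) fun n => ?_
    rw [← mul_sub, norm_mul]
    have := norm_pow_sub_pow_le_rpow (by simpa using hz) (by simpa using hw) n
    calc _ ≤ ‖b n‖ * (2 * ((n : ℝ) ^ (1 / 4 : ℝ) * ‖z - w‖ ^ (1 / 4 : ℝ))) := by gcongr
      _ = _ := by ring

/-- Nonvanishing level disks are of class `C^{1,1/4}` up to the boundary. -/
lemma IsLevelDisk.c1AlphaOnDisk {F : ℂ → ℂ → ℝ} (hF : IsSmoothTorusFamily F) {t : ℝ} {g : ℂ → ℂ}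
    (hg : IsLevelDisk F t g) (h0 : ∀ z ∈ closedBall (0 : ℂ) 1, g z ≠ 0) :
    C1AlphaOnDisk g (1 / 4) := by
  obtain ⟨B, rfl, rfl⟩ := exists_baseDisk hF hg h0
  obtain ⟨s₀, N, hs₀, h⟩ := B.exists_energyLE_translate_sub hF
  obtain ⟨M, hM⟩ := hg.energy
  have h1 := sum_pow_four_le hg.hol.continuous_circ hs₀ h
  refine c1AlphaOnDisk_of_hasSum (summable_rpow_of_sum_le (N := N) fun S => ?_)
    fun z hz => hg.hol.hasSum hM hz
  have h2 := h1 (S.map Nat.castEmbedding)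
  simpa using h2

section

lemma norm_circ_add_sub_le (x : UnitAddCircle) (s : ℝ) :
    ‖circ (x + (s : UnitAddCircle)) - circ x‖ ≤ 2 * Real.pi * |s| := by
  have e : circ (x + (s : UnitAddCircle)) - circ x =
      circ x * (Complex.exp (I * ((2 * Real.pi * s : ℝ) : ℂ)) - 1) := by
    rw [circ_add, circ_coe, mul_sub, mul_one]
    congr 3
    push_cast; ring
  rw [e, norm_mul, norm_circ, one_mul]
  refine (Real.norm_exp_I_mul_ofReal_sub_one_le (x := 2 * Real.pi * s)).trans ?_
  rw [Real.norm_eq_abs, abs_mul, abs_of_pos (by positivity : 0 < 2 * Real.pi)]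

lemma energyLE_circ : EnergyLE circ ((2 * Real.pi) ^ 2) := fun s => by
  have h : Continuous fun x => circ (x + (s : UnitAddCircle)) - circ x :=
    (continuous_translate continuous_circ s).sub continuous_circ
  refine (meanSq_le_of_norm_le h fun x => norm_circ_add_sub_le x s).trans_eq ?_
  rw [mul_pow, sq_abs]

variable {F : ℂ → ℂ → ℝ} (hF : IsSmoothTorusFamily F)

/-- A holomorphic disk of class `C^{1,α}` with trace in a torus of the family is a level disk. -/
lemma isLevelDisk_of_c1AlphaOnDisk {t α : ℝ} {k : ℂ → ℂ} (h : C1AlphaOnDisk k α) (hk : HolDisk k)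
    (ht : DiskTraceIn k (TorusOf F t)) : IsLevelDisk F t k := by
  refine ⟨hk, ?_, fun x => (ht _ (circ_mem x)).2⟩
  obtain ⟨k', hd, hc, -⟩ := h
  obtain ⟨A, hA⟩ := (isCompact_closedBall (0 : ℂ) 1).exists_bound_of_continuousOn hc
  have h1 : LipschitzOnWith A.toNNReal k (ball 0 1) :=
    (convex_ball (0 : ℂ) 1).lipschitzOnWith_of_nnnorm_hasDerivWithin_le
      (fun z hz => (hd z hz).hasDerivWithinAt) fun z hz => by
        rw [← NNReal.coe_le_coe]
        exact (hA z (ball_subset_closedBall hz)).trans (Real.le_coe_toNNReal A)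
  have hcl := closure_ball (0 : ℂ) one_ne_zero
  have h2 := h1.closure (hcl ▸ hk.1)
  rw [hcl] at h2
  exact ⟨_, energyLE_circ.lipschitz_comp (S := closedBall 0 1) continuous_circ hk.continuous_circ
    circ_mem_closedBall fun v hv v' hv' => h2.norm_sub_le hv hv'⟩

include hF

lemma apply_zero_eq_zero {l : ℂ} (hl : l ∈ sphere (0 : ℂ) 1) : F l 0 = 0 := by
  obtain ⟨ε, hε, h⟩ := hF.2.2.1
  rw [h l hl 0 (by simpa using hε), map_zero]

lemma isCompact_level {l : ℂ} (hl : l ∈ sphere (0 : ℂ) 1) {t : ℝ} (ht : 0 < t) :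
    IsCompact {w | F l w = t} := by
  obtain ⟨c, ⟨hc, hper, -⟩, -, -, hr⟩ := hF.2.2.2.2.2 l hl t ht
  rw [← hr, ← (show Function.Periodic c (2 * Real.pi) from hper).image_Icc Real.two_pi_pos 0]
  exact isCompact_Icc.image hc.continuous

/-- Points of the level curve of height `t₀` can be moved injectively to nearby level curves. -/
lemma exists_planar_transport (x : UnitAddCircle) {t₀ : ℝ} (ht₀ : 0 < t₀) :
    ∃ δ A : ℝ, 0 < δ ∧ 0 < A ∧ ∃ W : ℂ → ℝ → ℂ,
      (∀ p, F (circ x) p = t₀ → W p t₀ = p) ∧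
      (∀ p t, F (circ x) p = t₀ → |t - t₀| ≤ δ → F (circ x) (W p t) = t) ∧
      ∀ p p' t t', F (circ x) p = t₀ → F (circ x) p' = t₀ → |t - t₀| ≤ δ → |t' - t₀| ≤ δ →
        ‖W p t - W p' t'‖ ≤ A * (‖p - p'‖ + |t - t'|) ∧ (W p t = W p' t' → p = p') := by
  have hg := continuous_grad hF
  have hgx : Continuous fun w => grad F x w := by fun_prop
  have hfx : Continuous fun w => F (circ x) w :=
    (continuous_slice hF).comp (continuous_const.prodMk continuous_id)
  set P := {w | F (circ x) w = t₀} with hP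
  have hPc : IsCompact P := isCompact_level hF (circ_mem x) ht₀
  have hP0 : ∀ p ∈ P, p ≠ 0 := fun p hp h0 => by
    have : F (circ x) p = t₀ := hp
    rw [h0, apply_zero_eq_zero hF (circ_mem x)] at this
    exact ht₀.ne this
  obtain ⟨R, hR⟩ := hPc.isBounded.exists_norm_le
  obtain ⟨G₀, hG₀⟩ := (hPc.image hgx).isBounded.exists_norm_le
  obtain ⟨G, hG1, hG⟩ : ∃ G : ℝ, 1 ≤ G ∧ ∀ p ∈ P, ‖grad F x p‖ ≤ G :=
    ⟨max 1 G₀, le_max_left _ _, fun p hp => (hG₀ _ ⟨p, hp, rfl⟩).trans (le_max_right _ _)⟩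
  obtain ⟨m, hm0, hm⟩ : ∃ m : ℝ, 0 < m ∧ ∀ p ∈ P, m ≤ ‖grad F x p‖ ^ 2 := by
    rcases P.eq_empty_or_nonempty with h | h
    · exact ⟨1, one_pos, by simp [h]⟩
    · obtain ⟨p, hp, hmin⟩ := hPc.exists_isMinOn h (f := fun p => ‖grad F x p‖ ^ 2)
        (by fun_prop)
      exact ⟨_, pow_pos (norm_pos_iff.2 (grad_ne_zero hF x (hP0 p hp))) 2, fun q hq => hmin hq⟩
  obtain ⟨K, hK0, hK⟩ := exists_lipschitz hF (R + 1)
  obtain ⟨σ, hσ, h1, h2, h3⟩ : ∃ σ : ℝ, 0 < σ ∧ σ * G ≤ 1 ∧ 2 * K * σ ≤ 1 ∧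
      16 * G ^ 2 * K * σ ≤ m := by
    refine ⟨min (1 / G) (min (1 / (2 * K)) (m / (16 * G ^ 2 * K))), by positivity, ?_, ?_, ?_⟩
    · rw [← le_div_iff₀ (by positivity)]; exact min_le_left _ _
    · rw [← le_div_iff₀' (by positivity)]; exact (min_le_right _ _).trans (min_le_left _ _)
    · rw [← le_div_iff₀' (by positivity)]; exact (min_le_right _ _).trans (min_le_right _ _)
  have hRP : ∀ p ∈ P, ‖p‖ ≤ R + 1 := fun p hp => (hR p hp).trans (by linarith)
  -- the normal field
  obtain ⟨n, hn⟩ : ∃ n : ℂ → ℂ, ∀ p, n p = starRingEnd ℂ (grad F x p) := ⟨_, fun _ => rfl⟩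
  have hnG : ∀ p ∈ P, ‖n p‖ ≤ G := fun p hp => by rw [hn, RCLike.norm_conj]; exact hG p hp
  have hgK : ∀ w w', ‖w‖ ≤ R + 1 → ‖w'‖ ≤ R + 1 → ‖grad F x w - grad F x w'‖ ≤ K * ‖w - w'‖ :=
    fun w w' hw hw' => by simpa using (hK x 0 w w' hw hw').2.1
  have hfK : ∀ w w', ‖w‖ ≤ R + 1 → ‖w'‖ ≤ R + 1 →
      |F (circ x) w - F (circ x) w'| ≤ K * ‖w - w'‖ :=
    fun w w' hw hw' => by simpa using (hK x 0 w w' hw hw').1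
  have hnK : ∀ p ∈ P, ∀ p' ∈ P, ‖n p - n p'‖ ≤ K * ‖p - p'‖ := fun p hp p' hp' => by
    rw [hn, hn, ← map_sub, RCLike.norm_conj]
    exact hgK _ _ (hRP p hp) (hRP p' hp')
  have haK : ∀ p ∈ P, ∀ w w', ‖w‖ ≤ R + 1 → ‖w'‖ ≤ R + 1 →
      ‖avgGrad F x w w' - grad F x p‖ ≤ K * (‖w - p‖ + ‖w' - p‖) := fun p hp w w' hw hw' => by
    have := avgGrad_lipschitz hF (fun x s w w' hw hw' => (hK x s w w' hw hw').2.1) hK0.le x 0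
      hw hw' (hRP p hp) (hRP p hp)
    simpa [avgGrad_self] using this
  have hsn : ∀ p ∈ P, ∀ s : ℝ, |s| ≤ σ → ‖(s : ℂ) * n p‖ ≤ σ * G := fun p hp s hs => by
    rw [norm_mul, norm_real, Real.norm_eq_abs]
    exact mul_le_mul hs (hnG p hp) (norm_nonneg _) hσ.le
  have hRs : ∀ p ∈ P, ∀ s : ℝ, |s| ≤ σ → ‖p + s * n p‖ ≤ R + 1 := fun p hp s hs =>
    (norm_add_le _ _).trans (add_le_add (hR p hp) ((hsn p hp s hs).trans h1))
  -- lower bound for the normal derivative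
  have hlow : ∀ p ∈ P, ∀ w w', ‖w‖ ≤ R + 1 → ‖w'‖ ≤ R + 1 → ‖w - p‖ + ‖w' - p‖ ≤ 2 * (σ * G) →
      m / 2 ≤ (avgGrad F x w w' * n p).re := fun p hp w w' hw hw' hww => by
    have e : avgGrad F x w w' * n p =
        (avgGrad F x w w' - grad F x p) * n p + ((‖grad F x p‖ ^ 2 : ℝ) : ℂ) := by
      rw [sub_mul, hn, Complex.mul_conj']; push_cast; ring
    have e1 := abs_re_le_norm ((avgGrad F x w w' - grad F x p) * n p)
    rw [norm_mul] at e1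
    have e2 := mul_le_mul (haK p hp w w' hw hw') (hnG p hp) (norm_nonneg _) (by positivity)
    rw [e, add_re, ofReal_re]
    have e3 := (abs_le.1 (e1.trans e2)).1
    have e4 : K * (‖w - p‖ + ‖w' - p‖) * G ≤ K * (2 * (σ * G)) * G := by gcongr
    nlinarith [hm p hp]
  have hmono : ∀ p ∈ P, ∀ s s' : ℝ, |s| ≤ σ → |s'| ≤ σ →
      m / 2 * |s - s'| ≤ |F (circ x) (p + s * n p) - F (circ x) (p + s' * n p)| ∧
      (s' ≤ s → m / 2 * (s - s') ≤
        F (circ x) (p + s * n p) - F (circ x) (p + s' * n p)) := fun p hp s s' hs hs' => by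
    have e := slice_sub_eq hF x (p + s * n p) (p + s' * n p)
    have e0 : avgGrad F x (p + s * n p) (p + s' * n p) * (p + s * n p - (p + s' * n p)) =
      ((s - s' : ℝ) : ℂ) * (avgGrad F x (p + s * n p) (p + s' * n p) * n p) := by push_cast; ring
    rw [e0, re_ofReal_mul] at e
    have e2 := hlow p hp _ _ (hRs p hp s hs) (hRs p hp s' hs') (by
      rw [add_sub_cancel_left, add_sub_cancel_left]
      linarith [hsn p hp s hs, hsn p hp s' hs'])
    constructor
    · rw [e, abs_mul, mul_comm, abs_of_pos (lt_of_lt_of_le (by positivity) e2)]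
      gcongr
    · intro h
      rw [e, mul_comm]
      exact mul_le_mul_of_nonneg_left e2 (by linarith)
  have hex : ∀ p ∈ P, ∀ t, |t - t₀| ≤ m / 2 * σ → ∃ s : ℝ, |s| ≤ σ ∧
      F (circ x) (p + s * n p) = t := fun p hp t ht => by
    have hpt : F (circ x) p = t₀ := hp
    have c : Continuous fun s : ℝ => F (circ x) (p + s * n p) :=
      hfx.comp (by fun_prop)
    have a1 := (hmono p hp σ 0 (by rw [abs_of_pos hσ]) (by simpa using hσ.le)).2 hσ.le
    have a2 := (hmono p hp 0 (-σ) (by simpa using hσ.le) (by rw [abs_neg, abs_of_pos hσ])).2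
      (by linarith)
    simp only [ofReal_zero, zero_mul, add_zero, hpt] at a1 a2
    obtain ⟨b1, b2⟩ := abs_le.1 ht
    obtain ⟨s, hs, hst⟩ := intermediate_value_Icc (by linarith : -σ ≤ σ) c.continuousOn
      (show t ∈ Icc (F (circ x) (p + ((-σ : ℝ) : ℂ) * n p)) _ from ⟨by linarith, by linarith⟩)
    exact ⟨s, abs_le.2 hs, hst⟩
  choose! S hS hSt using hex
  refine ⟨m / 2 * σ, 1 + G * (2 / m * (1 + 2 * K)) + 1, by positivity, by positivity,
    fun p t => p + S p t * n p, fun p hp => ?_, fun p t hp ht => hSt p hp t ht,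
    fun p p' t t' hp hp' ht ht' => ⟨?_, fun h => ?_⟩⟩
  · have h0 : |t₀ - t₀| ≤ m / 2 * σ := by simp; positivity
    have e := (hmono p hp (S p t₀) 0 (hS p hp _ h0) (by simpa using hσ.le)).1
    rw [hSt p hp _ h0, ofReal_zero, zero_mul, add_zero, show F (circ x) p = t₀ from hp, sub_self,
      abs_zero, sub_zero] at e
    have : S p t₀ = 0 := by
      rw [← abs_nonpos_iff]
      by_contra! hc
      nlinarith [mul_pos hm0 hc]
    simp [this]
  · have e := (hmono p hp (S p t) (S p' t') (hS p hp _ ht) (hS p' hp' _ ht')).1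
    have e1 : |F (circ x) (p' + S p' t' * n p') - F (circ x) (p + S p' t' * n p)| ≤
        K * (2 * ‖p - p'‖) := by
      refine (hfK _ _ (hRs p' hp' _ (hS p' hp' _ ht')) (hRs p hp _ (hS p' hp' _ ht'))).trans ?_
      gcongr
      have : p' + S p' t' * n p' - (p + S p' t' * n p) = -(p - p') - S p' t' * (n p - n p') := by
        ring
      rw [this]
      refine (norm_sub_le _ _).trans ?_
      rw [norm_neg, norm_mul, norm_real, Real.norm_eq_abs]
      have := mul_le_mul (hS p' hp' _ ht') (hnK p hp p' hp') (norm_nonneg _) hσ.le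
      nlinarith [norm_nonneg (p - p')]
    rw [hSt p hp _ ht] at e
    rw [hSt p' hp' _ ht'] at e1
    have e2 : |t - F (circ x) (p + S p' t' * n p)| ≤ |t - t'| + K * (2 * ‖p - p'‖) :=
      (abs_sub_le _ t' _).trans (by linarith)
    have e3 : |S p t - S p' t'| ≤ 2 / m * (|t - t'| + K * (2 * ‖p - p'‖)) := by
      rw [div_mul_eq_mul_div, le_div_iff₀ hm0]
      linarith
    have e4 : p + S p t * n p - (p' + S p' t' * n p') =
        (p - p') + ((S p t - S p' t' : ℝ) : ℂ) * n p + S p' t' * (n p - n p') := by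
      push_cast; ring
    rw [e4]
    have e5 : ‖((S p t - S p' t' : ℝ) : ℂ) * n p‖ ≤
        2 / m * (|t - t'| + K * (2 * ‖p - p'‖)) * G := by
      rw [norm_mul, norm_real, Real.norm_eq_abs]
      exact mul_le_mul e3 (hnG p hp) (norm_nonneg _) (by positivity)
    have e6 : ‖(S p' t' : ℂ) * (n p - n p')‖ ≤ ‖p - p'‖ := by
      rw [norm_mul, norm_real, Real.norm_eq_abs]
      have := mul_le_mul (hS p' hp' _ ht') (hnK p hp p' hp') (norm_nonneg _) hσ.le
      nlinarith [norm_nonneg (p - p')]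
    have e7 := norm_add₃_le (a := p - p') (b := ((S p t - S p' t' : ℝ) : ℂ) * n p)
      (c := S p' t' * (n p - n p'))
    have e8 : 0 ≤ 2 / m * G * ‖p - p'‖ := by positivity
    have e9 : 0 ≤ 2 / m * G * K * |t - t'| := by positivity
    have : |t - t'| ≥ 0 := abs_nonneg _
    nlinarith
  · have hs := hS p hp _ ht
    have hs' := hS p' hp' _ ht'
    replace h : p + S p t * n p = p' + S p' t' * n p' := h
    generalize S p t = s at h hs
    generalize S p' t' = s' at h hs'
    have hd : p - p' = ((s' - s : ℝ) : ℂ) * n p' - s * (n p - n p') := by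
      push_cast; linear_combination h
    have e := slice_sub_eq hF x p p'
    rw [show F (circ x) p = t₀ from hp, show F (circ x) p' = t₀ from hp', sub_self] at e
    have e0 : avgGrad F x p p' * (p - p') = ((s' - s : ℝ) : ℂ) * (avgGrad F x p p' * n p') -
        s * (avgGrad F x p p' * (n p - n p')) := by rw [hd]; ring
    rw [e0, sub_re, re_ofReal_mul, re_ofReal_mul] at e
    have hpp : ‖p - p'‖ ≤ 2 * (σ * G) := by
      have : p - p' = s' * n p' - s * n p := by linear_combination h
      rw [this]
      refine (norm_sub_le _ _).trans ?_
      linarith [hsn p hp s hs, hsn p' hp' s' hs']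
    have e2 := hlow p' hp' p p' (hRP p hp) (hRP p' hp') (by simpa using hpp)
    have e3 : ‖avgGrad F x p p'‖ ≤ 2 * G := by
      have i1 := haK p' hp' p p' (hRP p hp) (hRP p' hp')
      have i2 := norm_le_norm_add_norm_sub' (avgGrad F x p p') (grad F x p')
      rw [sub_self, norm_zero, add_zero] at i1
      nlinarith [hG p' hp']
    have e4 : |(avgGrad F x p p' * (n p - n p')).re| ≤ 2 * G * (K * ‖p - p'‖) := by
      refine (abs_re_le_norm _).trans ?_
      rw [norm_mul]
      exact mul_le_mul e3 (hnK p hp p' hp') (norm_nonneg _) (by positivity)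
    have e5 : |s' - s| * (m / 2) ≤ σ * (2 * G * (K * ‖p - p'‖)) := by
      calc |s' - s| * (m / 2) ≤ |s' - s| * |(avgGrad F x p p' * n p').re| := by
            gcongr; exact e2.trans (le_abs_self _)
        _ = |s * (avgGrad F x p p' * (n p - n p')).re| := by
            rw [← abs_mul]; congr 1; linarith
        _ ≤ _ := by rw [abs_mul]; gcongr
    have e6 : ‖p - p'‖ ≤ |s' - s| * G + σ * (K * ‖p - p'‖) := by
      conv_lhs => rw [hd]
      refine (norm_sub_le _ _).trans ?_
      rw [norm_mul, norm_mul, norm_real, norm_real, Real.norm_eq_abs, Real.norm_eq_abs]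
      gcongr
      exacts [hnG p' hp', hnK p hp p' hp']
    have e7 : ‖p - p'‖ ≤ 2 * G * |s' - s| := by nlinarith [norm_nonneg (p - p')]
    have e8 : ‖p - p'‖ * m ≤ 8 * G ^ 2 * K * σ * ‖p - p'‖ := by
      have := mul_le_mul_of_nonneg_left e5 (by positivity : 0 ≤ 4 * G)
      have := mul_le_mul_of_nonneg_right e7 hm0.le
      linarith
    have e9 : ‖p - p'‖ ≤ 0 := by
      by_contra! hc
      nlinarith [mul_pos hc hm0]
    exact sub_eq_zero.1 (norm_le_zero_iff.1 e9)

end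

lemma not_injective_of_continuous {f : UnitAddCircle → ℝ} (hf : Continuous f) :
    ¬ Function.Injective f := fun hi => by
  set e : UnitAddCircle := ((1 / 2 : ℝ) : UnitAddCircle) with he
  have hee : e + e = 0 := by
    rw [he, ← AddCircle.coe_add, add_halves]
    exact AddCircle.coe_period 1
  have he0 : e ≠ 0 := fun h => by
    obtain ⟨n, hn⟩ := (AddCircle.coe_eq_zero_iff (1 : ℝ)).1 h
    simp only [zsmul_eq_mul, mul_one] at hn
    have : ((2 * n : ℤ) : ℝ) = ((1 : ℤ) : ℝ) := by push_cast; linarith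
    have := Int.cast_injective (α := ℝ) this
    omega
  have hc : Continuous fun x => f x - f (x + e) := hf.sub (continuous_translate hf e)
  have h0 : (0 : ℝ) ∈ range fun x => f x - f (x + e) := by
    have hpre := (isPreconnected_range hc).ordConnected
    have h1 : f 0 - f (0 + e) ∈ range fun x => f x - f (x + e) := ⟨0, rfl⟩
    have h2 : -(f 0 - f (0 + e)) ∈ range fun x => f x - f (x + e) :=
      ⟨e, by simp only [hee, zero_add]; ring⟩
    rcases le_total 0 (f 0 - f (0 + e)) with h | h
    · exact hpre.out h2 h1 ⟨by linarith, h⟩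
    · exact hpre.out h1 h2 ⟨h, by linarith⟩
  obtain ⟨x, hx⟩ := h0
  have := hi (sub_eq_zero.1 hx)
  exact he0 (left_eq_add.1 this)

lemma surjective_of_continuous_injective {p : ℝ} (hp : 0 < p) {ψ : UnitAddCircle → AddCircle p}
    (hψ : Continuous ψ) (hi : Function.Injective ψ) : Function.Surjective ψ := fun b => by
  by_contra! hb
  have := Fact.mk hp
  obtain ⟨a, rfl⟩ := QuotientAddGroup.mk_surjective b
  have hm : ∀ x, ψ x ∈ (AddCircle.openPartialHomeomorphCoe p a).target := hb
  refine not_injective_of_continuous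
    ((AddCircle.openPartialHomeomorphCoe p a).continuousOn_symm.comp_continuous hψ hm) ?_
  exact fun x y hxy => hi ((AddCircle.openPartialHomeomorphCoe p a).symm.injOn (hm x) (hm y) hxy)

/-- A continuous injective loop inside a simple closed curve covers the curve. -/
lemma range_subset_of_injective {c : ℝ → ℂ} (hc : IsSCC c) {φ : UnitAddCircle → ℂ}
    (hφ : Continuous φ) (hi : Function.Injective φ) (hr : ∀ y, φ y ∈ range c) :
    range c ⊆ range φ := by
  obtain ⟨hs, hper, hinj, -⟩ := hc
  have := Fact.mk Real.two_pi_pos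
  have hper' : Function.Periodic c (2 * Real.pi) := hper
  have hcb : Continuous hper'.lift := hs.continuous.quotient_lift _
  have hIco : ∀ a : AddCircle (2 * Real.pi), ∃ s ∈ Ico 0 (2 * Real.pi),
      (s : AddCircle (2 * Real.pi)) = a := fun a => by
    have := AddCircle.coe_image_Ico_eq (2 * Real.pi) 0
    rw [zero_add] at this
    exact (this.symm ▸ mem_univ a :)
  have hci : Function.Injective hper'.lift := fun a b hab => by
    obtain ⟨s, hs, rfl⟩ := hIco a
    obtain ⟨s', hs', rfl⟩ := hIco b
    rw [hper'.lift_coe, hper'.lift_coe] at hab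
    rw [hinj hs hs' hab]
  have hemb := hcb.isClosedEmbedding hci
  choose s hs using hr
  have hsφ : (hper'.lift ∘ fun y => (s y : AddCircle (2 * Real.pi))) = φ := by
    funext y
    rw [Function.comp_apply, hper'.lift_coe, hs]
  have hψ : Continuous fun y => (s y : AddCircle (2 * Real.pi)) :=
    hemb.isEmbedding.continuous_iff.2 (hsφ ▸ hφ)
  have hψi : Function.Injective fun y => (s y : AddCircle (2 * Real.pi)) :=
    Function.Injective.of_comp (f := hper'.lift) (hsφ ▸ hi)
  rintro _ ⟨r, rfl⟩
  obtain ⟨y, hy⟩ := surjective_of_continuous_injective Real.two_pi_pos hψ hψi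
    (r : AddCircle (2 * Real.pi))
  refine ⟨y, ?_⟩
  rw [← hs, ← hper'.lift_coe (s y), ← hper'.lift_coe r]
  exact congrArg _ hy

lemma circ_injective : Function.Injective circ := fun _ _ h =>
  AddCircle.injective_toCircle one_ne_zero (Subtype.ext h)

/-- A continuous family of nonvanishing level disks that are pairwise disjoint up to the
boundary. -/
structure LevelFamily (F : ℂ → ℂ → ℝ) (t₀ : ℝ) (g : ℂ → ℂ → ℂ) : Prop where
  cont : ContinuousOn (fun q : ℂ × ℂ => g q.1 q.2) (closedBall (0 : ℂ) 1 ×ˢ sphere (0 : ℂ) 1)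
  level : ∀ ξ ∈ sphere (0 : ℂ) 1, IsLevelDisk F t₀ fun z => g z ξ
  ne_zero : ∀ ξ ∈ sphere (0 : ℂ) 1, ∀ z ∈ closedBall (0 : ℂ) 1, g z ξ ≠ 0
  disjoint : ∀ ξ ∈ sphere (0 : ℂ) 1, ∀ η ∈ sphere (0 : ℂ) 1, ξ ≠ η →
    ∀ z ∈ closedBall (0 : ℂ) 1, g z ξ ≠ g z η

namespace LevelFamily

variable {F : ℂ → ℂ → ℝ} {t₀ : ℝ} {g : ℂ → ℂ → ℂ} (hg : LevelFamily F t₀ g)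
  (hF : IsSmoothTorusFamily F)
include hg

lemma exists_modulus {η : ℝ} (hη : 0 < η) : ∃ r : ℝ, 0 < r ∧
    ∀ ξ ∈ sphere (0 : ℂ) 1, ∀ ξ' ∈ sphere (0 : ℂ) 1, ‖ξ - ξ'‖ < r →
      ∀ z ∈ closedBall (0 : ℂ) 1, ‖g z ξ - g z ξ'‖ ≤ η := by
  have hK := (isCompact_closedBall (0 : ℂ) 1).prod (isCompact_sphere (0 : ℂ) 1)
  obtain ⟨r, hr, h⟩ := Metric.uniformContinuousOn_iff.1
    (hK.uniformContinuousOn_of_continuous hg.cont) η hη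
  refine ⟨r, hr, fun ξ hξ ξ' hξ' hd z hz => ?_⟩
  have := h (z, ξ) ⟨hz, hξ⟩ (z, ξ') ⟨hz, hξ'⟩ (by simpa [Prod.dist_eq, dist_eq_norm] using hd)
  rw [dist_eq_norm] at this
  exact this.le

/-- Induction principle: a property of sets of leaves that is inherited by subsets, stable under
unions and holds for the leaves uniformly close to a given one, holds for all leaves. -/
lemma induction_on {p : Set ℂ → Prop} (h0 : p ∅) (hmono : ∀ s s', s ⊆ s' → p s' → p s)
    (hunion : ∀ s s', p s → p s' → p (s ∪ s'))
    (hloc : ∀ ξ₀ ∈ sphere (0 : ℂ) 1, ∃ η : ℝ, 0 < η ∧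
      p {ξ ∈ sphere (0 : ℂ) 1 | ∀ z ∈ closedBall (0 : ℂ) 1, ‖g z ξ - g z ξ₀‖ ≤ η}) :
    p (sphere (0 : ℂ) 1) := by
  refine (isCompact_sphere (0 : ℂ) 1).induction_on h0 (fun s s' => hmono s s')
    (fun s s' => hunion s s') fun ξ₀ hξ₀ => ?_
  obtain ⟨η, hη, hp⟩ := hloc ξ₀ hξ₀
  obtain ⟨r, hr, hmod⟩ := hg.exists_modulus hη
  refine ⟨_, ?_, hp⟩
  filter_upwards [self_mem_nhdsWithin, mem_nhdsWithin_of_mem_nhds (Metric.ball_mem_nhds ξ₀ hr)]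
    with ξ hξ hξr
  exact ⟨hξ, hmod ξ hξ ξ₀ hξ₀ (mem_ball_iff_norm.1 hξr)⟩

include hF in
lemma exists_uniform_comparison : ∃ η C : ℝ, 0 < η ∧ 1 ≤ C ∧
    ∀ ξ ∈ sphere (0 : ℂ) 1, ∀ t t' k k', IsLevelDisk F t k → IsLevelDisk F t' k' →
      CloseOnCircle η (fun z => g z ξ) k → CloseOnCircle η (fun z => g z ξ) k' →
      ∀ w ∈ closedBall (0 : ℂ) 1, ∀ z ∈ closedBall (0 : ℂ) 1,
        ‖k w - k' w‖ ≤ C * (‖k z - k' z‖ + |t - t'|) := by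
  refine hg.induction_on (p := fun s => ∃ η C : ℝ, 0 < η ∧ 1 ≤ C ∧
    ∀ ξ ∈ s, ∀ t t' k k', IsLevelDisk F t k → IsLevelDisk F t' k' →
      CloseOnCircle η (fun z => g z ξ) k → CloseOnCircle η (fun z => g z ξ) k' →
      ∀ w ∈ closedBall (0 : ℂ) 1, ∀ z ∈ closedBall (0 : ℂ) 1,
        ‖k w - k' w‖ ≤ C * (‖k z - k' z‖ + |t - t'|)) ⟨1, 1, one_pos, le_rfl, by simp⟩ ?_ ?_ fun ξ₀ hξ₀ => ?_
  · rintro s s' hs ⟨η, C, hη, hC, h⟩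
    exact ⟨η, C, hη, hC, fun ξ hξ => h ξ (hs hξ)⟩
  · rintro s s' ⟨η, C, hη, hC, h⟩ ⟨η', C', hη', hC', h'⟩
    refine ⟨min η η', max C C', lt_min hη hη', hC.trans (le_max_left _ _), ?_⟩
    rintro ξ (hξ | hξ) t t' k k' hk hk' hkg hkg' w hw z hz
    · refine (h ξ hξ t t' k k' hk hk' (hkg.mono (min_le_left _ _)) (hkg'.mono (min_le_left _ _))
        w hw z hz).trans ?_
      gcongr
      exact le_max_left _ _
    · refine (h' ξ hξ t t' k k' hk hk' (hkg.mono (min_le_right _ _))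
        (hkg'.mono (min_le_right _ _)) w hw z hz).trans ?_
      gcongr
      exact le_max_right _ _
  · obtain ⟨B, hB, -⟩ := exists_baseDisk hF (hg.level ξ₀ hξ₀) (hg.ne_zero ξ₀ hξ₀)
    obtain ⟨η, C, hη, -, hC, h⟩ := B.exists_comparison hF
    refine ⟨η / 2, half_pos hη, η / 2, C, half_pos hη, hC, ?_⟩
    rintro ξ ⟨hξ, hξ'⟩ t t' k k' hk hk' hkg hkg' w hw z hz
    have hclose : ∀ k, CloseOnCircle (η / 2) (fun z => g z ξ) k → CloseOnCircle η B.g k := by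
      intro k hk x
      rw [hB]
      calc ‖k (circ x) - g (circ x) ξ₀‖ ≤ ‖k (circ x) - g (circ x) ξ‖
            + ‖g (circ x) ξ - g (circ x) ξ₀‖ := norm_sub_le_norm_sub_add_norm_sub _ _ _
        _ ≤ η / 2 + η / 2 := add_le_add (hk x) (hξ' _ (circ_mem_closedBall x))
        _ = η := add_halves η
    exact (h t t' k k' hk hk' (hclose k hkg) (hclose k' hkg') w hw).1 z hz

include hF in
lemma exists_uniform_levelDisk {ε : ℝ} (hε : 0 < ε) : ∃ δ : ℝ, 0 < δ ∧
    ∀ ξ ∈ sphere (0 : ℂ) 1, ∀ w, ‖w - g 1 ξ‖ ≤ δ →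
      ∃ k, IsLevelDisk F (F 1 w) k ∧ k 1 = w ∧ CloseOnCircle ε (fun z => g z ξ) k := by
  refine hg.induction_on (p := fun s => ∃ δ : ℝ, 0 < δ ∧ ∀ ξ ∈ s, ∀ w, ‖w - g 1 ξ‖ ≤ δ →
      ∃ k, IsLevelDisk F (F 1 w) k ∧ k 1 = w ∧ CloseOnCircle ε (fun z => g z ξ) k)
    ⟨1, one_pos, by simp⟩ ?_ ?_ fun ξ₀ hξ₀ => ?_
  · rintro s s' hs ⟨δ, hδ, h⟩
    exact ⟨δ, hδ, fun ξ hξ => h ξ (hs hξ)⟩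
  · rintro s s' ⟨δ, hδ, h⟩ ⟨δ', hδ', h'⟩
    refine ⟨min δ δ', lt_min hδ hδ', ?_⟩
    rintro ξ (hξ | hξ) w hw
    · exact h ξ hξ w (hw.trans (min_le_left _ _))
    · exact h' ξ hξ w (hw.trans (min_le_right _ _))
  · obtain ⟨B, hB, -⟩ := exists_baseDisk hF (hg.level ξ₀ hξ₀) (hg.ne_zero ξ₀ hξ₀)
    obtain ⟨δ, hδ, h⟩ := B.exists_levelDisk_through hF (half_pos hε)
    have hmin : 0 < min (δ / 2) (ε / 2) := by positivity
    refine ⟨min (δ / 2) (ε / 2), hmin, δ / 2, half_pos hδ, ?_⟩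
    rintro ξ ⟨hξ, hξ'⟩ w hw
    have h1 : (1 : ℂ) ∈ closedBall (0 : ℂ) 1 := by simp
    obtain ⟨k, hk, hk1, hkg⟩ := h w (by
      rw [hB]
      calc ‖w - g 1 ξ₀‖ ≤ ‖w - g 1 ξ‖ + ‖g 1 ξ - g 1 ξ₀‖ := norm_sub_le_norm_sub_add_norm_sub _ _ _
        _ ≤ δ / 2 + δ / 2 := add_le_add hw ((hξ' 1 h1).trans (min_le_left _ _))
        _ = δ := add_halves δ)
    refine ⟨k, hk, hk1, fun x => ?_⟩
    have h2 := hkg x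
    rw [hB] at h2
    have h3 := (hξ' _ (circ_mem_closedBall x)).trans (min_le_right _ _)
    rw [norm_sub_rev] at h3
    calc ‖k (circ x) - g (circ x) ξ‖ ≤ ‖k (circ x) - g (circ x) ξ₀‖
          + ‖g (circ x) ξ₀ - g (circ x) ξ‖ := norm_sub_le_norm_sub_add_norm_sub _ _ _
      _ ≤ ε / 2 + ε / 2 := add_le_add h2 h3
      _ = ε := add_halves ε

lemma exists_separation {r : ℝ} (hr : 0 < r) : ∃ m : ℝ, 0 < m ∧
    ∀ ξ ∈ sphere (0 : ℂ) 1, ∀ η ∈ sphere (0 : ℂ) 1, r ≤ ‖ξ - η‖ →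
      ∀ z ∈ closedBall (0 : ℂ) 1, m ≤ ‖g z ξ - g z η‖ := by
  have hK := (((isCompact_closedBall (0 : ℂ) 1).prod
    ((isCompact_sphere (0 : ℂ) 1).prod (isCompact_sphere (0 : ℂ) 1)))).inter_right
    (isClosed_le continuous_const (by fun_prop : Continuous fun q : ℂ × ℂ × ℂ => ‖q.2.1 - q.2.2‖) :
      IsClosed {q : ℂ × ℂ × ℂ | r ≤ ‖q.2.1 - q.2.2‖})
  have h1 : ContinuousOn (fun q : ℂ × ℂ × ℂ => g q.1 q.2.1)
      (closedBall (0 : ℂ) 1 ×ˢ (sphere (0 : ℂ) 1 ×ˢ sphere (0 : ℂ) 1)) :=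
    hg.cont.comp (f := fun q : ℂ × ℂ × ℂ => (q.1, q.2.1)) (by fun_prop)
      fun q hq => ⟨hq.1, hq.2.1⟩
  have h2 : ContinuousOn (fun q : ℂ × ℂ × ℂ => g q.1 q.2.2)
      (closedBall (0 : ℂ) 1 ×ˢ (sphere (0 : ℂ) 1 ×ˢ sphere (0 : ℂ) 1)) :=
    hg.cont.comp (f := fun q : ℂ × ℂ × ℂ => (q.1, q.2.2)) (by fun_prop)
      fun q hq => ⟨hq.1, hq.2.2⟩
  have h3 : ContinuousOn (fun q : ℂ × ℂ × ℂ => ‖g q.1 q.2.1 - g q.1 q.2.2‖)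
      (closedBall (0 : ℂ) 1 ×ˢ (sphere (0 : ℂ) 1 ×ˢ sphere (0 : ℂ) 1)) := (h1.sub h2).norm
  obtain ⟨m, hm, h⟩ := hK.exists_forall_le' (a := 0) (h3.mono inter_subset_left) fun q hq => by
    have hq2 : r ≤ ‖q.2.1 - q.2.2‖ := hq.2
    refine norm_pos_iff.2 (sub_ne_zero.2 (hg.disjoint _ hq.1.2.1 _ hq.1.2.2 ?_ _ hq.1.1))
    exact sub_ne_zero.1 (norm_pos_iff.1 (hr.trans_le hq2))
  exact ⟨m, hm, fun ξ hξ η hη hd z hz => h (z, ξ, η) ⟨⟨hz, hξ, hη⟩, hd⟩⟩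

lemma exists_norm_lower_bound : ∃ m : ℝ, 0 < m ∧
    ∀ ξ ∈ sphere (0 : ℂ) 1, ∀ z ∈ closedBall (0 : ℂ) 1, m ≤ ‖g z ξ‖ := by
  have hK := (isCompact_closedBall (0 : ℂ) 1).prod (isCompact_sphere (0 : ℂ) 1)
  obtain ⟨m, hm, h⟩ := hK.exists_forall_le' (a := 0) hg.cont.norm fun q hq =>
    norm_pos_iff.2 (hg.ne_zero _ hq.2 _ hq.1)
  exact ⟨m, hm, fun ξ hξ z hz => h (z, ξ) ⟨hz, hξ⟩⟩

end LevelFamily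

section

variable {F : ℂ → ℂ → ℝ} {t₀ : ℝ} {g : ℂ → ℂ → ℂ}

lemma CloseOnCircle.norm_sub_le {η : ℝ} {h k : ℂ → ℂ} (hhk : CloseOnCircle η h k) (hh : HolDisk h)
    (hk : HolDisk k) {z : ℂ} (hz : z ∈ closedBall (0 : ℂ) 1) : ‖k z - h z‖ ≤ η :=
  (hk.sub hh).norm_le hhk z hz

lemma pos_of_isHolTransFoliation (hF : IsSmoothTorusFamily F) (ht₀ : 0 ≤ t₀)
    (hg : IsHolTransFoliation (TorusOf F t₀) g) : 0 < t₀ := by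
  refine ht₀.lt_of_ne fun h0 => ?_
  obtain ⟨-, -, hol, htr, hne, -⟩ := hg
  have h1 : (1 : ℂ) ∈ sphere (0 : ℂ) 1 := by simp
  have hz : ∀ x, ‖g (circ x) 1‖ ≤ 0 := fun x => by
    by_contra! hx
    have hpos := hF.2.2.2.1 _ (circ_mem x) _ (norm_pos_iff.1 hx)
    have := (htr 1 h1 _ (circ_mem x)).2
    simp only at this
    linarith
  have := (hol 1 h1).norm_le hz 0 (by simp)
  exact hne 1 h1 0 (by simp) (norm_le_zero_iff.1 this)

lemma levelFamily_of_isHolTransFoliation (hF : IsSmoothTorusFamily F) (ht₀ : 0 < t₀)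
    (hg : IsHolTransFoliation (TorusOf F t₀) g) : LevelFamily F t₀ g := by
  obtain ⟨hc, ⟨α, -, -, hα⟩, hol, htr, hne, hdis, hex⟩ := hg
  refine ⟨hc, fun ξ hξ => isLevelDisk_of_c1AlphaOnDisk (hα ξ hξ) (hol ξ hξ) (htr ξ hξ),
    fun ξ hξ z hz h => ?_, fun ξ hξ η hη hξη z hz h => ?_⟩
  · rcases (mem_closedBall.1 hz).lt_or_eq with hz | hz
    · exact hne ξ hξ z hz h
    · have := (htr ξ hξ z hz).2
      simp only [h, apply_zero_eq_zero hF hz] at this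
      exact ht₀.ne this
  · rcases (mem_closedBall.1 hz).lt_or_eq with hz | hz
    · exact hdis ξ hξ η hη hξη z hz h
    · exact hξη ((hex _ (htr ξ hξ z hz)).unique ⟨hξ, rfl⟩ ⟨hη, h.symm⟩)

namespace LevelFamily

lemma isHolTransFoliation (hg : LevelFamily F t₀ g) (hF : IsSmoothTorusFamily F) (ht₀ : 0 < t₀) :
    IsHolTransFoliation (TorusOf F t₀) g := by
  have htr : ∀ ξ ∈ sphere (0 : ℂ) 1, ∀ l ∈ sphere (0 : ℂ) 1, F l (g l ξ) = t₀ := by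
    intro ξ hξ l hl
    obtain ⟨x, rfl⟩ := exists_circ_eq hl
    exact (hg.level ξ hξ).level x
  refine ⟨hg.cont, ⟨1 / 4, by norm_num, by norm_num, fun ξ hξ =>
    (hg.level ξ hξ).c1AlphaOnDisk hF (hg.ne_zero ξ hξ)⟩, fun ξ hξ => (hg.level ξ hξ).hol,
    fun ξ hξ l hl => ⟨hl, htr ξ hξ l hl⟩, fun ξ hξ l hl => hg.ne_zero ξ hξ l (ball_subset_closedBall hl),
    fun ξ hξ η hη h l hl => hg.disjoint ξ hξ η hη h l (ball_subset_closedBall hl), ?_⟩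
  rintro ⟨l, w⟩ ⟨hl : l ∈ sphere (0 : ℂ) 1, hw : F l w = t₀⟩
  have hlc : l ∈ closedBall (0 : ℂ) 1 := sphere_subset_closedBall hl
  have huniq : ∀ ξ ∈ sphere (0 : ℂ) 1, ∀ η ∈ sphere (0 : ℂ) 1, g l ξ = g l η → ξ = η := by
    intro ξ hξ η hη h
    by_contra hne
    exact hg.disjoint ξ hξ η hη hne l hlc h
  obtain ⟨c, hc, -, -, hr⟩ := hF.2.2.2.2.2 l hl t₀ ht₀
  have hφ : Continuous fun y => g l (circ y) :=
    hg.cont.comp_continuous (f := fun y => (l, circ y)) (continuous_const.prodMk continuous_circ)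
      fun y => ⟨hlc, circ_mem y⟩
  have hsub := range_subset_of_injective hc hφ
    (fun y y' h => circ_injective (huniq _ (circ_mem y) _ (circ_mem y') h))
    fun y => hr ▸ htr _ (circ_mem y) l hl
  obtain ⟨y, hy⟩ := hsub (hr ▸ hw : w ∈ range c)
  exact ⟨circ y, ⟨circ_mem y, hy⟩, fun ξ hξ => huniq _ hξ.1 _ (circ_mem y) (hξ.2.trans hy.symm)⟩

/-- Level families deform with the level. -/
lemma exists_deformation (hg : LevelFamily F t₀ g) (hF : IsSmoothTorusFamily F) (ht₀ : 0 < t₀) :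
    ∃ δ : ℝ, 0 < δ ∧ ∃ G : ℂ → ℂ → ℝ → ℂ,
      ContinuousOn (fun q : (ℂ × ℂ) × ℝ => G q.1.1 q.1.2 q.2)
        ((closedBall (0 : ℂ) 1 ×ˢ sphere (0 : ℂ) 1) ×ˢ Ioo (t₀ - δ) (t₀ + δ)) ∧
      (∀ l ∈ closedBall (0 : ℂ) 1, ∀ ξ ∈ sphere (0 : ℂ) 1, G l ξ t₀ = g l ξ) ∧
      ∀ t : ℝ, |t - t₀| < δ → LevelFamily F t fun l ξ => G l ξ t := by
  obtain ⟨η, C, hη, hC, hcmp⟩ := hg.exists_uniform_comparison hF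
  obtain ⟨r, hr, hmod⟩ := hg.exists_modulus (half_pos hη)
  obtain ⟨m, hm, hsep⟩ := hg.exists_separation hr
  obtain ⟨m₀, hm₀, hlow⟩ := hg.exists_norm_lower_bound
  set ε := min (η / 2) (min (m / 3) (m₀ / 2)) with hε
  have hε0 : 0 < ε := by positivity
  have hε1 : ε ≤ η / 2 := min_le_left _ _
  have hε2 : ε ≤ m / 3 := (min_le_right _ _).trans (min_le_left _ _)
  have hε3 : ε ≤ m₀ / 2 := (min_le_right _ _).trans (min_le_right _ _)
  obtain ⟨δ₁, hδ₁, hthrough⟩ := hg.exists_uniform_levelDisk hF hε0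
  obtain ⟨δ₂, A, hδ₂, hA, W, hW0, hWt, hWl⟩ := exists_planar_transport hF 0 ht₀
  simp only [circ_zero] at hW0 hWt hWl
  have h1 : (1 : ℂ) ∈ closedBall (0 : ℂ) 1 := by simp
  have hg1 : ∀ ξ ∈ sphere (0 : ℂ) 1, F 1 (g 1 ξ) = t₀ := fun ξ hξ => by
    simpa only [circ_zero] using (hg.level ξ hξ).level 0
  have hδ : 0 < min δ₂ (δ₁ / A) := by positivity
  set δ := min δ₂ (δ₁ / A)
  have hex : ∀ ξ t, ξ ∈ sphere (0 : ℂ) 1 → |t - t₀| < δ → ∃ k, IsLevelDisk F t k ∧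
      k 1 = W (g 1 ξ) t ∧ CloseOnCircle ε (fun z => g z ξ) k := by
    intro ξ t hξ ht
    have ht2 : |t - t₀| ≤ δ₂ := ht.le.trans (min_le_left _ _)
    have ht1 : |t - t₀| ≤ δ₁ / A := ht.le.trans (min_le_right _ _)
    have hd := (hWl _ _ t t₀ (hg1 ξ hξ) (hg1 ξ hξ) ht2 (by simpa using hδ₂.le)).1
    rw [sub_self, norm_zero, zero_add, hW0 _ (hg1 ξ hξ)] at hd
    have := hthrough ξ hξ _ (hd.trans (by rwa [le_div_iff₀' hA] at ht1))
    rwa [hWt _ _ (hg1 ξ hξ) ht2] at this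
  choose! k hk hk1 hkc using hex
  have hk1' : ∀ ξ ∈ sphere (0 : ℂ) 1, ∀ ξ' ∈ sphere (0 : ℂ) 1, ∀ t t', |t - t₀| < δ →
      |t' - t₀| < δ → ‖k ξ t 1 - k ξ' t' 1‖ ≤ A * (‖g 1 ξ - g 1 ξ'‖ + |t - t'|) := by
    intro ξ hξ ξ' hξ' t t' ht ht'
    rw [hk1 ξ t hξ ht, hk1 ξ' t' hξ' ht']
    exact (hWl _ _ t t' (hg1 ξ hξ) (hg1 ξ' hξ') (ht.le.trans (min_le_left _ _))
      (ht'.le.trans (min_le_left _ _))).1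
  have hnear : ∀ ξ ∈ sphere (0 : ℂ) 1, ∀ ξ' ∈ sphere (0 : ℂ) 1, ‖ξ - ξ'‖ < r → ∀ t t',
      |t - t₀| < δ → |t' - t₀| < δ → ∀ w ∈ closedBall (0 : ℂ) 1, ∀ z ∈ closedBall (0 : ℂ) 1,
      ‖k ξ t w - k ξ' t' w‖ ≤ C * (‖k ξ t z - k ξ' t' z‖ + |t - t'|) := by
    intro ξ hξ ξ' hξ' hd t t' ht ht'
    refine hcmp ξ hξ t t' _ _ (hk ξ t hξ ht) (hk ξ' t' hξ' ht')
      ((hkc ξ t hξ ht).mono (by linarith)) fun x => ?_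
    have h2 := hmod ξ hξ ξ' hξ' hd _ (circ_mem_closedBall x)
    rw [norm_sub_rev] at h2
    calc ‖k ξ' t' (circ x) - g (circ x) ξ‖ ≤ ‖k ξ' t' (circ x) - g (circ x) ξ'‖
          + ‖g (circ x) ξ' - g (circ x) ξ‖ := norm_sub_le_norm_sub_add_norm_sub _ _ _
      _ ≤ ε + η / 2 := add_le_add (hkc ξ' t' hξ' ht' x) h2
      _ ≤ η := by linarith
  have hclose : ∀ ξ ∈ sphere (0 : ℂ) 1, ∀ t, |t - t₀| < δ → ∀ z ∈ closedBall (0 : ℂ) 1,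
      ‖k ξ t z - g z ξ‖ ≤ ε := fun ξ hξ t ht z hz =>
    (hkc ξ t hξ ht).norm_sub_le (hg.level ξ hξ).hol (hk ξ t hξ ht).hol hz
  have hcont : ContinuousOn (fun q : (ℂ × ℂ) × ℝ => k q.1.2 q.2 q.1.1)
      ((closedBall (0 : ℂ) 1 ×ˢ sphere (0 : ℂ) 1) ×ˢ Ioo (t₀ - δ) (t₀ + δ)) := by
    rintro ⟨⟨l, ξ⟩, t⟩ ⟨⟨hl : l ∈ closedBall (0 : ℂ) 1, hξ : ξ ∈ sphere (0 : ℂ) 1⟩, ht⟩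
    have hI : ∀ s, s ∈ Ioo (t₀ - δ) (t₀ + δ) → |s - t₀| < δ := fun s hs =>
      abs_lt.2 ⟨by linarith [hs.1], by linarith [hs.2]⟩
    set S := (closedBall (0 : ℂ) 1 ×ˢ sphere (0 : ℂ) 1) ×ˢ Ioo (t₀ - δ) (t₀ + δ)
    have hfst : Tendsto (fun q : (ℂ × ℂ) × ℝ => k ξ t q.1.1) (𝓝[S] ((l, ξ), t)) (𝓝 (k ξ t l)) := by
      refine ((hk ξ t hξ (hI t ht)).hol.1 l hl).tendsto.comp
        (tendsto_nhdsWithin_iff.2 ⟨?_, ?_⟩)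
      · exact ((by fun_prop : Continuous fun q : (ℂ × ℂ) × ℝ => q.1.1).tendsto _).mono_left
          nhdsWithin_le_nhds
      · filter_upwards [self_mem_nhdsWithin] with q hq using hq.1.1
    have hg1c : Tendsto (fun q : (ℂ × ℂ) × ℝ => g 1 q.1.2) (𝓝[S] ((l, ξ), t)) (𝓝 (g 1 ξ)) := by
      have : ContinuousOn (fun q : (ℂ × ℂ) × ℝ => g 1 q.1.2) S :=
        hg.cont.comp (f := fun q : (ℂ × ℂ) × ℝ => ((1 : ℂ), q.1.2)) (by fun_prop)
          fun q hq => ⟨h1, hq.1.2⟩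
      exact this ((l, ξ), t) ⟨⟨hl, hξ⟩, ht⟩
    have htc : Tendsto (fun q : (ℂ × ℂ) × ℝ => |q.2 - t|) (𝓝[S] ((l, ξ), t)) (𝓝 0) :=
      ((by fun_prop : Continuous fun q : (ℂ × ℂ) × ℝ => |q.2 - t|).tendsto' _ _
        (by simp)).mono_left nhdsWithin_le_nhds
    have hb : Tendsto (fun q : (ℂ × ℂ) × ℝ => C * (A * (‖g 1 q.1.2 - g 1 ξ‖ + |q.2 - t|) + |q.2 - t|))
        (𝓝[S] ((l, ξ), t)) (𝓝 0) := by
      have h3 : Tendsto (fun q : (ℂ × ℂ) × ℝ => ‖g 1 q.1.2 - g 1 ξ‖) (𝓝[S] ((l, ξ), t)) (𝓝 0) :=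
        tendsto_iff_norm_sub_tendsto_zero.1 hg1c
      simpa using (((h3.add htc).const_mul A).add htc).const_mul C
    have hdiff : Tendsto (fun q : (ℂ × ℂ) × ℝ => k q.1.2 q.2 q.1.1 - k ξ t q.1.1)
        (𝓝[S] ((l, ξ), t)) (𝓝 0) := by
      refine squeeze_zero_norm' ?_ hb
      have hnb : ∀ᶠ q : (ℂ × ℂ) × ℝ in 𝓝[S] ((l, ξ), t), ‖q.1.2 - ξ‖ < r :=
        (((by fun_prop : Continuous fun q : (ℂ × ℂ) × ℝ => ‖q.1.2 - ξ‖).tendsto' _ 0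
          (by simp)).mono_left nhdsWithin_le_nhds).eventually_lt_const hr
      filter_upwards [self_mem_nhdsWithin, hnb] with q hq hqr
      refine (hnear _ hq.1.2 ξ hξ hqr _ _ (hI _ hq.2) (hI t ht) _ hq.1.1 1 h1).trans ?_
      gcongr
      exact hk1' _ hq.1.2 ξ hξ _ _ (hI _ hq.2) (hI t ht)
    have := hdiff.add hfst
    simp only [sub_add_cancel, zero_add] at this
    exact this
  refine ⟨δ, hδ, fun l ξ t => k ξ t l, hcont, fun l hl ξ hξ => ?_, fun t ht =>
    ⟨?_, fun ξ hξ => hk ξ t hξ ht, fun ξ hξ z hz (h : k ξ t z = 0) => ?_,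
    fun ξ hξ ξ' hξ' hne z hz (h : k ξ t z = k ξ' t z) => ?_⟩⟩
  · have ht : |t₀ - t₀| < δ := by simpa using hδ
    have h2 := hcmp ξ hξ t₀ t₀ _ _ (hk ξ t₀ hξ ht) (hg.level ξ hξ)
      ((hkc ξ t₀ hξ ht).mono (by linarith)) (fun x => by simpa using hη.le) l hl 1 h1
    rw [hk1 ξ t₀ hξ ht, hW0 _ (hg1 ξ hξ)] at h2
    simp only [sub_self, norm_zero, abs_zero, add_zero, mul_zero] at h2
    exact sub_eq_zero.1 (norm_le_zero_iff.1 h2)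
  · exact hcont.comp (f := fun q : ℂ × ℂ => (q, t)) (by fun_prop)
      fun q hq => ⟨hq, by linarith [(abs_lt.1 ht).1], by linarith [(abs_lt.1 ht).2]⟩
  · have h2 := hclose ξ hξ t ht z hz
    have h3 := hlow ξ hξ z hz
    rw [h, zero_sub, norm_neg] at h2
    linarith
  · rcases lt_or_ge ‖ξ - ξ'‖ r with hd | hd
    · have h2 := hnear ξ hξ ξ' hξ' hd t t ht ht 1 h1 z hz
      rw [h, hk1 ξ t hξ ht, hk1 ξ' t hξ' ht] at h2
      simp only [sub_self, norm_zero, abs_zero, add_zero, mul_zero] at h2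
      have ht2 : |t - t₀| ≤ δ₂ := ht.le.trans (min_le_left _ _)
      have h3 := (hWl _ _ t t (hg1 ξ hξ) (hg1 ξ' hξ') ht2 ht2).2
        (sub_eq_zero.1 (norm_le_zero_iff.1 h2))
      exact hg.disjoint ξ hξ ξ' hξ' hne 1 h1 h3
    · have h2 := hsep ξ hξ ξ' hξ' hd z hz
      have h3 := hclose ξ hξ t ht z hz
      have h4 := hclose ξ' hξ' t ht z hz
      rw [h, norm_sub_rev] at h3
      have := norm_sub_le_norm_sub_add_norm_sub (g z ξ) (k ξ' t z) (g z ξ')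
      linarith

end LevelFamily

end

end TorusFoliation

/-- **Openness.** If the torus `Γ^{t₀}` of a smooth family of graphical tori admits a
holomorphic transverse foliation `g₀`, then for all `t` close enough to `t₀` the tori `Γ^t`
admit holomorphic transverse foliations depending continuously on `t` and agreeing with `g₀`
at `t = t₀`. -/
theorem openness (F : ℂ → ℂ → ℝ) (hF : IsSmoothTorusFamily F) (t₀ : ℝ) (ht₀ : 0 ≤ t₀)
    (g₀ : ℂ → ℂ → ℂ) (hg₀ : IsHolTransFoliation (TorusOf F t₀) g₀) :
    ∃ δ : ℝ, 0 < δ ∧ ∃ G : ℂ → ℂ → ℝ → ℂ,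
      ContinuousOn (fun q : (ℂ × ℂ) × ℝ => G q.1.1 q.1.2 q.2)
        ((closedBall (0 : ℂ) 1 ×ˢ sphere (0 : ℂ) 1) ×ˢ Ioo (t₀ - δ) (t₀ + δ)) ∧
      (∀ l ∈ closedBall (0 : ℂ) 1, ∀ ξ ∈ sphere (0 : ℂ) 1, G l ξ t₀ = g₀ l ξ) ∧
      ∀ t : ℝ, |t - t₀| < δ → 0 ≤ t →
        IsHolTransFoliation (TorusOf F t) (fun l ξ => G l ξ t) := by
  have hpos := TorusFoliation.pos_of_isHolTransFoliation hF ht₀ hg₀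
  obtain ⟨δ, hδ, G, hcont, hG, hlev⟩ :=
    (TorusFoliation.levelFamily_of_isHolTransFoliation hF hpos hg₀).exists_deformation hF hpos
  refine ⟨min δ t₀, lt_min hδ hpos, G, hcont.mono ?_, hG, fun t ht _ => ?_⟩
  · have h := min_le_left δ t₀
    exact prod_mono_right (Ioo_subset_Ioo (by linarith) (by linarith))
  · have h1 := (abs_lt.1 (ht.trans_le (min_le_right _ _))).1
    exact (hlev t (ht.trans_le (min_le_left _ _))).isHolTransFoliation hF (by linarith)
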